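/- arXiv:1404.6022 — 3 statements merged into one kernel-verified Lean document; each statement's English description precedes it below -/
import Mathlib

section
/- (Larger sieve with non-uniform fiber.) Let c > 0 and α ∈ (0,1) be reals and set c' = c²α/10. There exist a constant C > 0 and an integer N₀ (depending on α and c) such that the following holds for all N ≥ N₀. Let A ⊆ [N] be a subset and let 𝒫 be a set of primes p ≤ N^α such that Σ_{p ≤ N^α, p ∉ 𝒫} (log p / p) < c' · log N, and assume |A mod p| ≤ αp for each p ∈ 𝒫. Define 𝒫_unif = { p ∈ 𝒫 : Σ_{r mod p} |{a ∈ A : a ≡ r (mod p)}|² ≤ (1/α + c)·|A|²/p }. If Σ_{p ≤ N^α, p ∉ 𝒫_unif} (log p / p) > c · log N, then |A| ≤ C · N^{α−c'}. -/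
/-- `A` reduced modulo `p`. -/
def modImage (A : Finset ℕ) (p : ℕ) : Finset (ZMod p) :=
  A.image (fun a => (Nat.cast a : ZMod p))

/-- The number of elements of `A` congruent to `r` modulo `p`. -/
def fiberCard (A : Finset ℕ) (p : ℕ) (r : ZMod p) : ℕ :=
  (A.filter (fun a => (Nat.cast a : ZMod p) = r)).card

/-- The primes `p ≤ P` (for a real bound `P ≥ 0`). -/
noncomputable def primesUpTo (P : ℝ) : Finset ℕ :=
  (Finset.range (⌊P⌋₊ + 1)).filter Nat.Prime

/-- Sums over the residues `0, …, p - 1` are sums over `ZMod p`. -/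
theorem sum_range_natCast_zmod {p : ℕ} [NeZero p] (f : ZMod p → ℝ) :
    ∑ r ∈ Finset.range p, f (Nat.cast r) = ∑ r : ZMod p, f r := by
  refine Finset.sum_nbij' (fun r : ℕ => (r : ZMod p)) ZMod.val ?_ ?_ ?_ ?_ ?_
  · intro _ _; exact Finset.mem_univ _
  · intro r _; exact Finset.mem_range.2 (ZMod.val_lt r)
  · intro r hr; exact ZMod.val_cast_of_lt (Finset.mem_range.1 hr)
  · intro r _; exact ZMod.natCast_zmod_val r
  · intro _ _; rfl

/-- The sum of the squared fiber sizes counts the pairs congruent modulo `p`. -/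
theorem sum_fiberCard_sq (A : Finset ℕ) {p : ℕ} [NeZero p] :
    ∑ r ∈ Finset.range p, (fiberCard A p (Nat.cast r) : ℝ) ^ 2 =
      ∑ a ∈ A, ∑ b ∈ A, if (a : ZMod p) = b then (1 : ℝ) else 0 := by
  rw [sum_range_natCast_zmod (fun r => (fiberCard A p r : ℝ) ^ 2)]
  have h : ∀ r : ZMod p,
      (fiberCard A p r : ℝ) = ∑ a ∈ A, if (a : ZMod p) = r then (1 : ℝ) else 0 := by
    intro r
    simp [fiberCard]
  simp_rw [h, sq, Finset.sum_mul_sum]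
  rw [Finset.sum_comm]
  refine Finset.sum_congr rfl fun a _ => ?_
  rw [Finset.sum_comm]
  refine Finset.sum_congr rfl fun b _ => ?_
  simp [eq_comm]

/-- Cauchy–Schwarz over the fibers of reduction modulo `p`. -/
theorem card_sq_le_modImage_mul_sum_fiberCard_sq (A : Finset ℕ) {p : ℕ} [NeZero p] :
    (A.card : ℝ) ^ 2 ≤ ((modImage A p).card : ℝ) *
      ∑ r ∈ Finset.range p, (fiberCard A p (Nat.cast r) : ℝ) ^ 2 := by
  rw [sum_range_natCast_zmod (fun r => (fiberCard A p r : ℝ) ^ 2)]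
  have h : (A.card : ℝ) = ∑ r ∈ modImage A p, (fiberCard A p r : ℝ) := by
    have := Finset.card_eq_sum_card_image (fun a : ℕ => (a : ZMod p)) A
    rw [this]
    push_cast
    rfl
  calc (A.card : ℝ) ^ 2 = (∑ r ∈ modImage A p, (fiberCard A p r : ℝ)) ^ 2 := by rw [← h]
    _ ≤ ((modImage A p).card : ℝ) * ∑ r ∈ modImage A p, (fiberCard A p r : ℝ) ^ 2 :=
        sq_sum_le_card_mul_sum_sq
    _ ≤ _ := by
        gcongr
        exact Finset.subset_univ _

/-- The logarithms of the distinct primes dividing `a - b ≠ 0` sum to at most `log N`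
when `a, b ∈ [1, N]`. -/
theorem sum_log_of_congr_le {N a b : ℕ} (ha : a ∈ Finset.Icc 1 N) (hb : b ∈ Finset.Icc 1 N)
    (hab : a ≠ b) (S : Finset ℕ) (hS : ∀ p ∈ S, p.Prime) :
    ∑ p ∈ S, (if (a : ZMod p) = b then Real.log p else 0) ≤ Real.log N := by
  rw [Finset.mem_Icc] at ha hb
  set d := ((b : ℤ) - a).natAbs with hd
  have hd0 : 0 < d := by omega
  have hdN : d ≤ N := by omega
  rw [← Finset.sum_filter]
  have hdvd : ∏ p ∈ S.filter (fun p : ℕ => (a : ZMod p) = b), p ∣ d := by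
    apply Finset.prod_primes_dvd
    · intro p hp
      exact (hS p (Finset.mem_filter.1 hp).1).prime
    · intro p hp
      have := (Finset.mem_filter.1 hp).2
      rw [ZMod.natCast_eq_natCast_iff, Nat.modEq_iff_dvd] at this
      exact Int.natCast_dvd.1 this
  rw [← Real.log_prod (fun p hp => by
    exact_mod_cast (hS p (Finset.mem_filter.1 hp).1).ne_zero)]
  have hle := (Nat.le_of_dvd hd0 hdvd).trans hdN
  apply Real.log_le_log
  · exact Finset.prod_pos fun p hp => by
      exact_mod_cast (hS p (Finset.mem_filter.1 hp).1).pos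
  · rw [← Nat.cast_prod]
    exact_mod_cast hle

/-- Gallagher's larger sieve inequality, in its form before the fibers are bounded. -/
theorem sum_log_mul_sum_fiberCard_sq_le {N : ℕ} {A : Finset ℕ} (hA : A ⊆ Finset.Icc 1 N)
    (S : Finset ℕ) (hS : ∀ p ∈ S, p.Prime) :
    ∑ p ∈ S, Real.log p * ∑ r ∈ Finset.range p, (fiberCard A p (Nat.cast r) : ℝ) ^ 2 ≤
      A.card * ∑ p ∈ S, Real.log p + (A.card : ℝ) ^ 2 * Real.log N := by
  have h1 : ∀ p ∈ S,
      Real.log p * ∑ r ∈ Finset.range p, (fiberCard A p (Nat.cast r) : ℝ) ^ 2 =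
        ∑ a ∈ A, ∑ b ∈ A, if (a : ZMod p) = b then Real.log p else 0 := by
    intro p hp
    have : NeZero p := ⟨(hS p hp).ne_zero⟩
    rw [sum_fiberCard_sq]
    simp_rw [Finset.mul_sum, mul_ite, mul_one, mul_zero]
  rw [Finset.sum_congr rfl h1, Finset.sum_comm]
  have h2 : ∀ a ∈ A, ∑ p ∈ S, ∑ b ∈ A, (if (a : ZMod p) = b then Real.log p else 0) ≤
      ∑ p ∈ S, Real.log p + A.card * Real.log N := by
    intro a ha
    rw [Finset.sum_comm]
    have hlogN : 0 ≤ Real.log N := Real.log_natCast_nonneg N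
    calc _ ≤ ∑ b ∈ A, ((if a = b then ∑ p ∈ S, Real.log p else 0) + Real.log N) := by
          refine Finset.sum_le_sum fun b hb => ?_
          by_cases hab : a = b
          · subst hab
            simpa using hlogN
          · rw [if_neg hab, zero_add]
            exact sum_log_of_congr_le (hA ha) (hA hb) hab S hS
      _ = _ := by
          rw [Finset.sum_add_distrib, Finset.sum_ite_eq, if_pos ha]
          simp
  calc _ ≤ ∑ a ∈ A, (∑ p ∈ S, Real.log p + A.card * Real.log N) := Finset.sum_le_sum h2
    _ = _ := by
        rw [Finset.sum_const, nsmul_eq_mul]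
        ring

theorem mem_primesUpTo {x : ℝ} (hx : 0 ≤ x) {p : ℕ} :
    p ∈ primesUpTo x ↔ p.Prime ∧ (p : ℝ) ≤ x := by
  rw [primesUpTo, Finset.mem_filter, Finset.mem_range, Nat.lt_succ_iff, Nat.le_floor_iff hx,
    and_comm]

theorem primesUpTo_natFloor (x : ℝ) : primesUpTo x = primesUpTo (⌊x⌋₊ : ℝ) := by
  simp [primesUpTo]

/-- Chebyshev's upper bound. -/
theorem sum_log_primesUpTo_le {x : ℝ} (hx : 0 ≤ x) :
    ∑ p ∈ primesUpTo x, Real.log p ≤ Real.log 4 * x := by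
  refine le_trans (le_of_eq ?_) (Chebyshev.theta_le_log4_mul_x hx)
  rw [Chebyshev.theta]
  refine Finset.sum_congr ?_ fun _ _ => rfl
  ext p
  simp only [primesUpTo, Finset.mem_filter, Finset.mem_range, Finset.mem_Ioc]
  constructor
  · rintro ⟨h, hp⟩
    exact ⟨⟨hp.pos, by omega⟩, hp⟩
  · rintro ⟨⟨_, h⟩, hp⟩
    exact ⟨by omega, hp⟩

theorem log_factorial_eq_sum_primesUpTo (n : ℕ) :
    Real.log (n.factorial : ℝ) =
      ∑ p ∈ primesUpTo n, (n.factorial.factorization p : ℝ) * Real.log p := by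
  rw [Real.log_nat_eq_sum_factorization]
  refine Finsupp.sum_of_support_subset _ ?_ _ (by simp)
  intro p hp
  rw [Nat.support_factorization, Nat.mem_primeFactors] at hp
  rw [mem_primesUpTo (Nat.cast_nonneg n)]
  exact ⟨hp.1, by exact_mod_cast (hp.1.dvd_factorial).1 hp.2.1⟩

theorem div_le_factorization_factorial {p : ℕ} (hp : p.Prime) (n : ℕ) :
    n / p ≤ n.factorial.factorization p := by
  rw [Nat.factorization_factorial hp (b := Nat.log p n + 2) (by omega)]
  have := Finset.single_le_sum (f := fun i => n / p ^ i) (s := Finset.Ico 1 (Nat.log p n + 2))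
    (fun _ _ => Nat.zero_le _) (a := 1) (by simp)
  simpa using this

/-- The upper bound in Mertens' first theorem, at integers. -/
theorem sum_log_div_primesUpTo_natCast_le {n : ℕ} (hn : 1 ≤ n) :
    ∑ p ∈ primesUpTo n, Real.log p / p ≤ Real.log n + Real.log 4 := by
  have hn0 : (0 : ℝ) < n := by exact_mod_cast hn
  have h1 : ∑ p ∈ primesUpTo n, (n * (Real.log p / p) - Real.log p) ≤ n * Real.log n := by
    calc _ ≤ ∑ p ∈ primesUpTo n, (n.factorial.factorization p : ℝ) * Real.log p := by
          refine Finset.sum_le_sum fun p hp => ?_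
          have hpp := ((mem_primesUpTo hn0.le).1 hp).1
          have hlog : 0 ≤ Real.log p := Real.log_natCast_nonneg p
          have h2 : (n : ℝ) / p - 1 ≤ n.factorial.factorization p := by
            have h3 : (n : ℝ) / p < (n / p : ℕ) + 1 := by
              rw [← Nat.floor_div_eq_div (K := ℝ)]
              exact Nat.lt_floor_add_one _
            have h4 : ((n / p : ℕ) : ℝ) ≤ n.factorial.factorization p := by
              exact_mod_cast div_le_factorization_factorial hpp n
            linarith
          calc _ = ((n : ℝ) / p - 1) * Real.log p := by ring
            _ ≤ _ := by gcongr
      _ = Real.log (n.factorial : ℝ) := (log_factorial_eq_sum_primesUpTo n).symm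
      _ ≤ Real.log ((n : ℝ) ^ n) := by
          apply Real.log_le_log (by exact_mod_cast n.factorial_pos)
          exact_mod_cast n.factorial_le_pow
      _ = _ := Real.log_pow _ _
  rw [Finset.sum_sub_distrib, ← Finset.mul_sum] at h1
  have h2 := sum_log_primesUpTo_le hn0.le
  refine le_of_mul_le_mul_left ?_ hn0
  linarith

/-- The lower bound in Mertens' first theorem, at integers. -/
theorem exists_le_sum_log_div_primesUpTo_natCast :
    ∃ K : ℝ, ∀ n : ℕ, 1 ≤ n →
      Real.log n - K ≤ ∑ p ∈ primesUpTo n, Real.log p / p := by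
  have hsum : Summable fun n : ℕ => 4 * (n : ℝ) ^ (-(3 / 2) : ℝ) :=
    (Real.summable_nat_rpow.2 (by norm_num)).mul_left 4
  refine ⟨1 + ∑' n : ℕ, 4 * (n : ℝ) ^ (-(3 / 2) : ℝ), fun n hn => ?_⟩
  have hn0 : (0 : ℝ) < n := by exact_mod_cast hn
  have h1 : n * Real.log n - n ≤ Real.log (n.factorial : ℝ) := by
    have := Stirling.le_log_factorial_stirling (n := n) (by omega)
    have h2 : 0 ≤ Real.log n := Real.log_natCast_nonneg n
    have h3 : 0 ≤ Real.log (2 * Real.pi) :=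
      Real.log_nonneg (by linarith [Real.two_le_pi])
    linarith
  have h2 : Real.log (n.factorial : ℝ) ≤
      n * ∑ p ∈ primesUpTo n, (Real.log p / p + 4 * (p : ℝ) ^ (-(3 / 2) : ℝ)) := by
    rw [log_factorial_eq_sum_primesUpTo, Finset.mul_sum]
    refine Finset.sum_le_sum fun p hp => ?_
    have hpp := ((mem_primesUpTo hn0.le).1 hp).1
    have hp2 : (2 : ℝ) ≤ p := by exact_mod_cast hpp.two_le
    have hp0 : (0 : ℝ) < p := by linarith
    have hlog : 0 ≤ Real.log p := Real.log_natCast_nonneg p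
    have h3 : (n.factorial.factorization p : ℝ) ≤ n / (p - 1) := by
      have h4 := Nat.factorization_factorial_le_div_pred hpp n
      calc (n.factorial.factorization p : ℝ) ≤ ((n / (p - 1) : ℕ) : ℝ) := by exact_mod_cast h4
        _ ≤ (n : ℝ) / ((p - 1 : ℕ) : ℝ) := Nat.cast_div_le
        _ = _ := by rw [Nat.cast_sub hpp.one_le, Nat.cast_one]
    have h5 : Real.log p ≤ 2 * (p : ℝ) ^ (1 / 2 : ℝ) := by
      have := Real.log_le_rpow_div hp0.le (ε := 1 / 2) (by norm_num)
      linarith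
    have h6 : (p : ℝ) ^ (1 / 2 : ℝ) = p ^ 2 * (p : ℝ) ^ (-(3 / 2) : ℝ) := by
      rw [← Real.rpow_natCast, ← Real.rpow_add hp0]
      norm_num
    have h7 : Real.log p / (p - 1) ≤ Real.log p / p + 4 * (p : ℝ) ^ (-(3 / 2) : ℝ) := by
      have hr : 0 ≤ (p : ℝ) ^ (-(3 / 2) : ℝ) := by positivity
      have h8 : Real.log p / (p - 1) = Real.log p / p + Real.log p / (p * (p - 1)) := by
        have : (p : ℝ) - 1 ≠ 0 := by linarith
        field_simp
        ring
      have hq : 0 < (p : ℝ) * (p - 1) := mul_pos hp0 (by linarith)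
      rw [h8, add_le_add_iff_left, div_le_iff₀ hq]
      rw [h6] at h5
      have : (p : ℝ) ^ 2 ≤ 2 * (p * (p - 1)) := by nlinarith
      nlinarith
    calc _ ≤ (n : ℝ) / (p - 1) * Real.log p := by gcongr
      _ = n * (Real.log p / (p - 1)) := by ring
      _ ≤ _ := by gcongr
  have h3 : ∑ p ∈ primesUpTo n, 4 * (p : ℝ) ^ (-(3 / 2) : ℝ) ≤
      ∑' n : ℕ, 4 * (n : ℝ) ^ (-(3 / 2) : ℝ) :=
    hsum.sum_le_tsum _ fun _ _ => by positivity
  rw [Finset.sum_add_distrib] at h2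
  have h4 : (n : ℝ) * (Real.log n - 1) ≤ n * (∑ p ∈ primesUpTo n, Real.log p / p +
      ∑ p ∈ primesUpTo n, 4 * (p : ℝ) ^ (-(3 / 2) : ℝ)) := by linarith
  have := le_of_mul_le_mul_left h4 hn0
  linarith

/-- Mertens' first theorem. -/
theorem exists_abs_sum_log_div_primesUpTo_sub_log_le :
    ∃ K : ℝ, ∀ x : ℝ, 1 ≤ x → |∑ p ∈ primesUpTo x, Real.log p / p - Real.log x| ≤ K := by
  obtain ⟨K, hK⟩ := exists_le_sum_log_div_primesUpTo_natCast
  refine ⟨max (Real.log 4) (K + Real.log 2), fun x hx => ?_⟩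
  have hn : 1 ≤ ⌊x⌋₊ := Nat.one_le_floor_iff x |>.2 hx
  have hn1 : (1 : ℝ) ≤ ⌊x⌋₊ := by exact_mod_cast hn
  have hlt := Nat.lt_floor_add_one x
  have hle := Nat.floor_le (zero_le_one.trans hx)
  have h1 := sum_log_div_primesUpTo_natCast_le hn
  have h2 := hK _ hn
  rw [← primesUpTo_natFloor] at h1 h2
  have h3 : Real.log (⌊x⌋₊ : ℝ) ≤ Real.log x := Real.log_le_log (by linarith) hle
  have h4 : Real.log x ≤ Real.log 2 + Real.log (⌊x⌋₊ : ℝ) := by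
    rw [← Real.log_mul (by norm_num) (by linarith)]
    exact Real.log_le_log (by linarith) (by linarith)
  rw [abs_le]
  constructor
  · linarith [le_max_right (Real.log 4) (K + Real.log 2)]
  · linarith [le_max_left (Real.log 4) (K + Real.log 2)]


theorem larger_sieve_nonuniform_fiber (c : ℝ) (hc : 0 < c)
    (α : ℝ) (hα0 : 0 < α) (hα1 : α < 1) :
    ∃ C : ℝ, C > 0 ∧ ∃ N₀ : ℕ, ∀ N : ℕ, N ≥ N₀ →
      ∀ A : Finset ℕ, A ⊆ Finset.Icc 1 N →
        ∀ Ps : Finset ℕ, (∀ p ∈ Ps, p.Prime ∧ (p : ℝ) ≤ (N : ℝ) ^ α) →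
          (∑ p ∈ (primesUpTo ((N : ℝ) ^ α)).filter (fun p => p ∉ Ps),
              Real.log p / p) < (c ^ 2 * α / 10) * Real.log N →
          (∀ p ∈ Ps, ((modImage A p).card : ℝ) ≤ α * p) →
          ∀ Punif : Finset ℕ,
            (∀ p, p ∈ Punif ↔ p ∈ Ps ∧
              (∑ r ∈ Finset.range p, ((fiberCard A p (Nat.cast r) : ℝ)) ^ 2) ≤
                (1 / α + c) * (A.card : ℝ) ^ 2 / p) →
            (∑ p ∈ (primesUpTo ((N : ℝ) ^ α)).filter (fun p => p ∉ Punif),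
                Real.log p / p) > c * Real.log N →
            (A.card : ℝ) ≤ C * (N : ℝ) ^ (α - c ^ 2 * α / 10) := by
  obtain ⟨K, hK⟩ := exists_abs_sum_log_div_primesUpTo_sub_log_le
  have hK0 : 0 ≤ K := (abs_nonneg _).trans (hK 1 le_rfl)
  have hlog4 : 0 < Real.log 4 := Real.log_pos (by norm_num)
  refine ⟨Real.log 4, hlog4,
    ⌈Real.exp (max (max 1 (K / α)) ((1 + K / α + 2 * c * K) / (2 * c ^ 2 / 5)))⌉₊, ?_⟩
  intro N hN A hA Ps hPs hsumPs himg Punif hPunif hsum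
  set L := Real.log N with hL
  set c' := c ^ 2 * α / 10 with hc'
  set f : ℕ → ℝ := fun p => Real.log p / p with hf
  have hf0 : ∀ p, 0 ≤ f p := fun p => div_nonneg (Real.log_natCast_nonneg p) p.cast_nonneg
  have hexp := (Nat.le_ceil _).trans (Nat.cast_le (α := ℝ).2 hN)
  have hN0 : (0 : ℝ) < N := (Real.exp_pos _).trans_le hexp
  rw [← Real.le_log_iff_exp_le hN0] at hexp
  have hL1 : 1 ≤ L := ((le_max_left _ _).trans (le_max_left _ _)).trans hexp
  have hLα : K ≤ L * α := (div_le_iff₀ hα0).1 <|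
    ((le_max_right _ _).trans (le_max_left _ _)).trans hexp
  have hLc : 1 + K / α + 2 * c * K ≤ L * (2 * c ^ 2 / 5) :=
    (div_le_iff₀ (by positivity)).1 <| (le_max_right _ _).trans hexp
  have hN1 : (1 : ℝ) ≤ N := by
    by_contra! h
    have := Real.log_nonpos hN0.le h.le
    linarith
  have hmertens : ∀ β : ℝ, 0 ≤ β →
      β * L - K ≤ ∑ p ∈ primesUpTo ((N : ℝ) ^ β), f p ∧
        ∑ p ∈ primesUpTo ((N : ℝ) ^ β), f p ≤ β * L + K := by
    intro β hβ
    have := hK _ (Real.one_le_rpow hN1 hβ)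
    rw [Real.log_rpow hN0, abs_le] at this
    constructor <;> linarith [this.1, this.2]
  set U := primesUpTo ((N : ℝ) ^ α) with hU
  have hU2 := (hmertens α hα0.le).2
  have hc2 : c ≤ 2 * α := by
    by_contra! h
    have h1 : ∑ p ∈ U.filter (fun p => p ∉ Punif), f p ≤ ∑ p ∈ U, f p :=
      Finset.sum_le_sum_of_subset_of_nonneg (Finset.filter_subset _ _) fun p _ _ => hf0 p
    have h2 : 2 * α * L ≤ c * L := by gcongr
    linarith
  have hc'0 : 0 < c' := by positivity
  have hcα : c * α ≤ 2 := by nlinarith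
  have hc'α : c' ≤ α := by
    have : c ^ 2 ≤ 10 := by nlinarith
    rw [hc']
    nlinarith
  set β := α - c' with hβ
  have hβ0 : 0 ≤ β := by linarith
  set T := primesUpTo ((N : ℝ) ^ β) with hT
  have hT1 := (hmertens β hβ0).1
  have hxβ0 : 0 ≤ (N : ℝ) ^ β := by positivity
  have hxα0 : 0 ≤ (N : ℝ) ^ α := by positivity
  have hTU : T ⊆ U := by
    intro p hp
    rw [mem_primesUpTo hxβ0] at hp
    rw [mem_primesUpTo hxα0]
    exact ⟨hp.1, hp.2.trans (Real.rpow_le_rpow_of_exponent_le hN1 (by linarith))⟩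
  set S := T.filter (fun p => p ∈ Ps) with hS
  have hSprime : ∀ p ∈ S, p.Prime := fun p hp =>
    ((mem_primesUpTo hxβ0).1 (Finset.mem_filter.1 hp).1).1
  have hsumS : (β - c') * L - K ≤ ∑ p ∈ S, f p := by
    have h1 := Finset.sum_filter_add_sum_filter_not T (fun p => p ∈ Ps) f
    have h2 : ∑ p ∈ T.filter (fun p => p ∉ Ps), f p ≤ ∑ p ∈ U.filter (fun p => p ∉ Ps), f p :=
      Finset.sum_le_sum_of_subset_of_nonneg (Finset.filter_subset_filter _ hTU)
        fun p _ _ => hf0 p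
    linarith
  have hsumS' : (c - 2 * c') * L - 2 * K ≤ ∑ p ∈ S.filter (fun p => p ∉ Punif), f p := by
    have h1 : ∑ p ∈ U.filter (fun p => p ∉ Punif), f p ≤
        ∑ p ∈ U.filter (fun p => p ∉ Ps), f p + ∑ p ∈ S.filter (fun p => p ∉ Punif), f p +
          ∑ p ∈ U \ T, f p := by
      have hsub : U.filter (fun p => p ∉ Punif) ⊆
          (U.filter (fun p => p ∉ Ps) ∪ S.filter (fun p => p ∉ Punif)) ∪ (U \ T) := by
        intro p hp
        simp only [hS, Finset.mem_union, Finset.mem_filter, Finset.mem_sdiff] at hp ⊢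
        tauto
      have hunion : ∀ X Y : Finset ℕ, ∑ p ∈ X ∪ Y, f p ≤ ∑ p ∈ X, f p + ∑ p ∈ Y, f p := by
        intro X Y
        have := Finset.sum_union_inter (s₁ := X) (s₂ := Y) (f := f)
        have := Finset.sum_nonneg (s := X ∩ Y) fun p _ => hf0 p
        linarith
      have h2 := Finset.sum_le_sum_of_subset_of_nonneg hsub fun p _ _ => hf0 p
      exact h2.trans <| (hunion _ _).trans <| add_le_add_left (hunion _ _) _
    have h2 := Finset.sum_sdiff hTU (f := f)
    linarith
  have hfiber : (A.card : ℝ) ^ 2 *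
      (1 / α * ∑ p ∈ S, f p + c * ∑ p ∈ S.filter (fun p => p ∉ Punif), f p) ≤
      ∑ p ∈ S, Real.log p * ∑ r ∈ Finset.range p, (fiberCard A p (Nat.cast r) : ℝ) ^ 2 := by
    rw [Finset.sum_filter (fun p => p ∉ Punif), Finset.mul_sum, Finset.mul_sum,
      ← Finset.sum_add_distrib, Finset.mul_sum]
    refine Finset.sum_le_sum fun p hp => ?_
    have hpPs := (Finset.mem_filter.1 hp).2
    have : NeZero p := ⟨(hSprime p hp).ne_zero⟩
    have hp0 : (0 : ℝ) < p := by exact_mod_cast (hSprime p hp).pos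
    have hlog : 0 ≤ Real.log p := Real.log_natCast_nonneg p
    by_cases hpu : p ∈ Punif
    · have h1 := card_sq_le_modImage_mul_sum_fiberCard_sq A (p := p)
      have h2 : (A.card : ℝ) ^ 2 ≤ α * p *
          ∑ r ∈ Finset.range p, (fiberCard A p (Nat.cast r) : ℝ) ^ 2 :=
        h1.trans (mul_le_mul_of_nonneg_right (himg p hpPs)
          (Finset.sum_nonneg fun _ _ => sq_nonneg _))
      have h3 : (A.card : ℝ) ^ 2 / (α * p) ≤
          ∑ r ∈ Finset.range p, (fiberCard A p (Nat.cast r) : ℝ) ^ 2 := by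
        rw [div_le_iff₀ (by positivity)]
        linarith
      rw [if_neg (not_not.2 hpu)]
      calc _ = Real.log p * ((A.card : ℝ) ^ 2 / (α * p)) := by
            rw [hf]
            field_simp
            ring
        _ ≤ _ := by gcongr
    · have h3 : (1 / α + c) * (A.card : ℝ) ^ 2 / p <
          ∑ r ∈ Finset.range p, (fiberCard A p (Nat.cast r) : ℝ) ^ 2 := by
        by_contra! h
        exact hpu ((hPunif p).2 ⟨hpPs, h⟩)
      rw [if_pos hpu]
      calc _ = Real.log p * ((1 / α + c) * (A.card : ℝ) ^ 2 / p) := by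
            rw [hf]
            ring
        _ ≤ _ := by gcongr
  have hsieve := hfiber.trans (sum_log_mul_sum_fiberCard_sq_le hA S hSprime)
  have hθ : ∑ p ∈ S, Real.log p ≤ Real.log 4 * (N : ℝ) ^ β :=
    (Finset.sum_le_sum_of_subset_of_nonneg (Finset.filter_subset _ _)
      fun p _ _ => Real.log_natCast_nonneg p).trans (sum_log_primesUpTo_le hxβ0)
  have hgain : L + 1 ≤
      1 / α * ∑ p ∈ S, f p + c * ∑ p ∈ S.filter (fun p => p ∉ Punif), f p := by
    have h1 : 1 / α * ((β - c') * L - K) ≤ 1 / α * ∑ p ∈ S, f p := by gcongr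
    have h2 : c * ((c - 2 * c') * L - 2 * K) ≤
        c * ∑ p ∈ S.filter (fun p => p ∉ Punif), f p := by gcongr
    have h3 : 1 / α * ((β - c') * L - K) = (1 - c ^ 2 / 5) * L - K / α := by
      rw [hβ, hc']
      field_simp
      ring
    have h4 : c * ((c - 2 * c') * L - 2 * K) =
        c ^ 2 * L - c ^ 2 * L * (c * α) / 5 - 2 * c * K := by
      rw [hc']
      ring
    have h5 : c ^ 2 * L * (c * α) ≤ c ^ 2 * L * 2 := by gcongr
    linarith
  rcases Nat.eq_zero_or_pos A.card with hA0 | hA0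
  · rw [hA0, Nat.cast_zero]
    positivity
  · have hA1 : (0 : ℝ) < A.card := by exact_mod_cast hA0
    have h1 := mul_le_mul_of_nonneg_left hgain (sq_nonneg (A.card : ℝ))
    have h2 := mul_le_mul_of_nonneg_left hθ hA1.le
    refine le_of_mul_le_mul_left ?_ hA1
    linarith
end

section
/- (Robust Cauchy–Davenport–Chowla.) Let p be a prime, let A, B ⊆ ℤ/pℤ be subsets, and let K > 0 be real. Let S = { s ∈ A + B : |A ∩ (s − B)| ≥ K } be the set of elements of the sumset A + B having at least K representations a + b with a ∈ A, b ∈ B. If |A| ≥ √(Kp) and |B| ≥ √(Kp), then |S| ≥ min(p, |A| + |B| − 1) − 3√(Kp). -/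
open scoped Pointwise

namespace Finset

section AddCommGroup

variable {G : Type*} [AddCommGroup G] [DecidableEq G]

lemma addConvolution_comm' (A B : Finset G) (x : G) :
    A.addConvolution B x = B.addConvolution A x :=
  card_equiv (Equiv.prodComm G G) (by simp [and_comm, add_comm])

lemma addConvolution_union_left {A₁ A₂ : Finset G} (h : Disjoint A₁ A₂) (B : Finset G) (x : G) :
    (A₁ ∪ A₂).addConvolution B x = A₁.addConvolution B x + A₂.addConvolution B x := by
  unfold addConvolution
  rw [union_product, filter_union, card_union_of_disjoint]
  exact disjoint_filter_filter (disjoint_product.2 (Or.inl h))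

lemma addConvolution_union_right (A : Finset G) {B₁ B₂ : Finset G} (h : Disjoint B₁ B₂) (x : G) :
    A.addConvolution (B₁ ∪ B₂) x = A.addConvolution B₁ x + A.addConvolution B₂ x := by
  simp only [addConvolution_comm' A, addConvolution_union_left h]

lemma addConvolution_eq_union_inter_add_sdiff (A B : Finset G) (x : G) :
    A.addConvolution B x =
      (A ∪ B).addConvolution (A ∩ B) x + (A \ B).addConvolution (B \ A) x := by
  have hA : A = (A \ B) ∪ (A ∩ B) := (sdiff_union_inter A B).symm
  have hB : B = (B \ A) ∪ (A ∩ B) := by rw [inter_comm, sdiff_union_inter]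
  have dA : Disjoint (A \ B) (A ∩ B) := disjoint_sdiff_inter A B
  have dB : Disjoint (B \ A) (A ∩ B) := by rw [inter_comm]; exact disjoint_sdiff_inter B A
  have dU : Disjoint (A \ B) B := sdiff_disjoint
  have h1 : A.addConvolution B x =
      (A \ B).addConvolution B x + (A ∩ B).addConvolution B x := by
    rw [← addConvolution_union_left dA, ← hA]
  have h2 : (A \ B).addConvolution B x =
      (A \ B).addConvolution (B \ A) x + (A \ B).addConvolution (A ∩ B) x := by
    rw [← addConvolution_union_right _ dB, ← hB]
  have h3 : (A ∪ B).addConvolution (A ∩ B) x =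
      (A \ B).addConvolution (A ∩ B) x + B.addConvolution (A ∩ B) x := by
    rw [← addConvolution_union_left dU, sdiff_union_self_eq_union]
  rw [h1, h2, h3, addConvolution_comm' (A ∩ B) B]
  ring

variable [Fintype G]

lemma sum_addConvolution (A B : Finset G) : ∑ x, A.addConvolution B x = #A * #B := by
  rw [← card_product]
  exact (card_eq_sum_card_fiberwise fun _ _ => mem_univ _).symm

lemma card_add_card_le_card_add_addConvolution (A B : Finset G) (x : G) :
    #A + #B ≤ Fintype.card G + A.addConvolution B x := by
  rw [← card_inter_vadd_neg, ← card_neg B, ← card_vadd_finset x (-B), ← card_union_add_card_inter]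
  gcongr
  exact card_le_univ _

lemma sum_min_vadd_addConvolution (A B : Finset G) (e : G) (t : ℕ) :
    ∑ x, min t ((e +ᵥ A).addConvolution B x) = ∑ x, min t (A.addConvolution B x) := by
  simp only [vadd_addConvolution_eq_addConvolution_neg_add]
  exact Equiv.sum_comp (Equiv.addLeft (-e)) fun x => min t (A.addConvolution B x)

end AddCommGroup

end Finset

namespace ZMod

open Finset

variable {p : ℕ} [Fact p.Prime]

lemma eq_univ_of_forall_add_mem {A : Finset (ZMod p)} (hA : A.Nonempty) {d : ZMod p}
    (hd : d ≠ 0) (h : ∀ a ∈ A, a + d ∈ A) : A = univ := by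
  obtain ⟨a, ha⟩ := hA
  have key : ∀ n : ℕ, a + n * d ∈ A := fun n => by
    induction n with
    | zero => simpa using ha
    | succ n ih => simpa [add_mul, add_assoc] using h _ ih
  refine eq_univ_of_forall fun x => ?_
  have := key ((x - a) / d).val
  rwa [natCast_zmod_val, div_mul_cancel₀ _ hd, add_sub_cancel] at this

lemma exists_vadd_inter_ssubset {A B : Finset (ZMod p)} (hA : A.Nonempty) (hA' : A ≠ univ)
    (hB : 1 < #B) : ∃ e : ZMod p, ((e +ᵥ A) ∩ B).Nonempty ∧ #((e +ᵥ A) ∩ B) < #B := by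
  obtain ⟨b, hb, c, hc, hbc⟩ := one_lt_card.1 hB
  by_contra! H
  refine hA' (eq_univ_of_forall_add_mem hA (sub_ne_zero.2 hbc.symm) fun a ha => ?_)
  have hb' : b ∈ (b - a) +ᵥ A := mem_vadd_finset.2 ⟨a, ha, by simp⟩
  have hI := eq_of_subset_of_card_le inter_subset_right
    (H (b - a) ⟨b, mem_inter.2 ⟨hb', hb⟩⟩)
  have hc' : c ∈ (b - a) +ᵥ A := (mem_inter.1 (hI.symm.subset hc)).1
  obtain ⟨y, hy, hyc⟩ := mem_vadd_finset.1 hc'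
  have : a + (c - b) = y := by rw [← hyc, vadd_eq_add]; ring
  rwa [this]

/-- **The Pollard theorem** on sums of sets modulo a prime: counting each element with its number of
representations truncated at `t` gives at least `t * min p (#A + #B - t)`. -/
theorem pollard (A B : Finset (ZMod p)) (t : ℕ) (hA : t ≤ #A) (hB : t ≤ #B) :
    t * min p (#A + #B - t) ≤ ∑ x, min t (A.addConvolution B x) := by
  induction hn : #B using Nat.strong_induction_on generalizing A B t with
  | _ n ih =>
  subst hn
  rcases Nat.eq_zero_or_pos t with rfl | ht
  · simp
  rcases le_or_gt p (#A + #B - t) with hp | hp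
  · have h : ∀ x, min t (A.addConvolution B x) = t := fun x => by
      have := card_add_card_le_card_add_addConvolution A B x
      rw [ZMod.card] at this
      omega
    simp [h, ZMod.card, hp, mul_comm]
  rw [min_eq_right hp.le]
  rcases hB.eq_or_lt with rfl | hB
  · simp_rw [min_eq_right addConvolution_le_card_right]
    rw [sum_addConvolution, Nat.add_sub_cancel, mul_comm]
  have hA' : A ≠ univ := by
    rintro rfl
    rw [card_univ, ZMod.card] at hp
    omega
  obtain ⟨e, hI, hIB⟩ := exists_vadd_inter_ssubset (card_pos.1 (ht.trans_le hA)) hA'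
    (show 1 < #B by omega)
  rw [← sum_min_vadd_addConvolution A B e, ← card_vadd_finset e A]
  rw [← card_vadd_finset e A] at hA hp
  generalize e +ᵥ A = A at *
  have hcard := card_union_add_card_inter A B
  have hIpos := card_pos.2 hI
  rcases le_or_gt t #(A ∩ B) with htI | htI
  · have hU : #(A ∩ B) ≤ #(A ∪ B) := card_le_card inter_subset_union
    have := ih _ hIB (A ∪ B) (A ∩ B) t (htI.trans hU) htI rfl
    rw [hcard, min_eq_right hp.le] at this
    refine this.trans (sum_le_sum fun x _ => ?_)
    rw [addConvolution_eq_union_inter_add_sdiff A B]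
    omega
  · have hsA := card_sdiff_add_card_inter A B
    have hsB := card_sdiff_add_card_inter B A
    rw [inter_comm B A] at hsB
    have := ih _ (show #(B \ A) < #B by omega) (A \ B) (B \ A) (t - #(A ∩ B)) (by omega)
      (by omega) rfl
    rw [min_eq_right (by omega)] at this
    have hsum : ∑ x, ((A ∪ B).addConvolution (A ∩ B) x +
        min (t - #(A ∩ B)) ((A \ B).addConvolution (B \ A) x)) ≤
        ∑ x, min t (A.addConvolution B x) := by
      refine sum_le_sum fun x _ => ?_
      have h1 : (A ∪ B).addConvolution (A ∩ B) x ≤ #(A ∩ B) := addConvolution_le_card_right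
      rw [addConvolution_eq_union_inter_add_sdiff A B]
      omega
    rw [sum_add_distrib, sum_addConvolution] at hsum
    refine le_trans ?_ ((Nat.add_le_add_left this _).trans hsum)
    obtain ⟨k, hk⟩ := Nat.exists_eq_add_of_lt htI
    generalize #(A ∩ B) = i at *
    have e1 : t - i = k + 1 := by omega
    rw [e1]
    obtain ⟨m, hm⟩ : ∃ m, #A + #B = t + i + m := ⟨#A + #B - (t + i), by omega⟩
    have e2 : #A + #B - t = i + m := by omega
    have e3 : #(A \ B) + #(B \ A) - (k + 1) = m := by omega
    have e4 : #(A ∪ B) = t + m := by omega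
    rw [e2, e3, e4, hk]
    exact le_of_eq (by ring)

end ZMod

open Finset in
theorem robust_cauchy_davenport_chowla (p : ℕ) (hp : p.Prime)
    (A B : Finset (ZMod p)) (K : ℝ) (hK : 0 < K)
    (hA : Real.sqrt (K * p) ≤ (A.card : ℝ))
    (hB : Real.sqrt (K * p) ≤ (B.card : ℝ)) :
    ∀ S : Finset (ZMod p),
      (∀ s, s ∈ S ↔ s ∈ A + B ∧
        K ≤ ((A ∩ (B.image (fun b => s - b))).card : ℝ)) →
      min (p : ℝ) ((A.card : ℝ) + (B.card : ℝ) - 1) - 3 * Real.sqrt (K * p) ≤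
        (S.card : ℝ) := by
  intro S hS
  have := Fact.mk hp
  have hr : ∀ s, #(A ∩ (B.image (fun b => s - b))) = A.addConvolution B s := fun s => by
    rw [← card_inter_vadd_neg]
    congr 2
    ext x
    rw [← image_neg_eq_neg]
    simp [mem_vadd_finset, sub_eq_add_neg]
  simp_rw [hr] at hS
  have hp0 : (0 : ℝ) < p := by exact_mod_cast hp.pos
  have hX : 0 < Real.sqrt (K * p) := Real.sqrt_pos.2 (by positivity)
  have hXX : Real.sqrt (K * p) * Real.sqrt (K * p) = K * p := Real.mul_self_sqrt (by positivity)
  set X := Real.sqrt (K * p)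
  have hA0 : 0 < #A := by exact_mod_cast hX.trans_le hA
  have hB0 : 0 < #B := by exact_mod_cast hX.trans_le hB
  rcases lt_or_ge X 1 with h1 | h1
  · have hK1 : K ≤ 1 := by
      have : (1 : ℝ) ≤ p := by exact_mod_cast hp.one_le
      nlinarith
    have hSe : S = A + B := by
      ext s
      rw [hS, and_iff_left_iff_imp]
      intro h
      have : (1 : ℝ) ≤ A.addConvolution B s := by
        exact_mod_cast addConvolution_pos.2 h
      exact hK1.trans this
    have hcd := ZMod.cauchy_davenport hp (card_pos.1 hA0) (card_pos.1 hB0)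
    rw [← hSe] at hcd
    have : min (p : ℝ) ((#A : ℝ) + #B - 1) ≤ #S := by
      have h : ((min p (#A + #B - 1) : ℕ) : ℝ) ≤ #S := by exact_mod_cast hcd
      rwa [Nat.cast_min, Nat.cast_sub (by omega), Nat.cast_add, Nat.cast_one] at h
    linarith
  · obtain ⟨t, ht1, htX, hXt⟩ : ∃ t : ℕ, 1 ≤ t ∧ (t : ℝ) ≤ X ∧ X < t + 1 :=
      ⟨⌊X⌋₊, Nat.one_le_floor_iff _ |>.2 h1, Nat.floor_le hX.le, Nat.lt_floor_add_one X⟩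
    have htA : t ≤ #A := by exact_mod_cast htX.trans hA
    have htB : t ≤ #B := by exact_mod_cast htX.trans hB
    have hpol : (t : ℝ) * min (p : ℝ) (#A + #B - t) ≤
        ∑ x, ((min t (A.addConvolution B x) : ℕ) : ℝ) := by
      have h : ((t * min p (#A + #B - t) : ℕ) : ℝ) ≤
          ((∑ x, min t (A.addConvolution B x) : ℕ) : ℝ) := by
        exact_mod_cast ZMod.pollard A B t htA htB
      rwa [Nat.cast_mul, Nat.cast_min, Nat.cast_sub (by omega), Nat.cast_add, Nat.cast_sum] at h
    have hterm : ∀ x, ((min t (A.addConvolution B x) : ℕ) : ℝ) ≤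
        (if x ∈ S then (t : ℝ) else 0) + K := fun x => by
      split_ifs with hx
      · have : ((min t (A.addConvolution B x) : ℕ) : ℝ) ≤ t := by
          exact_mod_cast min_le_left _ _
        linarith
      · have h2 : ((min t (A.addConvolution B x) : ℕ) : ℝ) ≤ A.addConvolution B x := by
          exact_mod_cast min_le_right _ _
        refine h2.trans ?_
        rw [zero_add]
        by_contra! hlt
        refine hx ((hS x).2 ⟨addConvolution_pos.1 ?_, hlt.le⟩)
        exact_mod_cast hK.trans hlt
    have hsum := hpol.trans (sum_le_sum fun x _ => hterm x)
    have hconst : ∑ x : ZMod p, ((if x ∈ S then (t : ℝ) else 0) + K) = t * #S + X * X := by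
      rw [hXX, sum_add_distrib]
      simp [ZMod.card, mul_comm]
    rw [hconst] at hsum
    have ht1' : (1 : ℝ) ≤ t := by exact_mod_cast ht1
    have hXt2 : X * X ≤ t * (2 * X) := by nlinarith
    have hmin : min (p : ℝ) (#A + #B - 1) - (t - 1) ≤ min (p : ℝ) (#A + #B - t) := by
      refine le_min ?_ ?_
      · linarith [min_le_left (p : ℝ) (#A + #B - 1)]
      · linarith [min_le_right (p : ℝ) (#A + #B - 1)]
    have : min (p : ℝ) (#A + #B - t) ≤ #S + 2 * X :=
      le_of_mul_le_mul_left (by linarith) (by linarith : (0 : ℝ) < t)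
    linarith
end

section
/- There exists a constant c₀ > 0 such that for all reals c with 0 < c ≤ c₀ the following holds: if p is a prime and A, B ⊆ ℤ/pℤ are subsets with |A| ≥ cp + 3, |B| ≥ cp + 3, and |A + B| ≤ min(|A| + |B| − 1 + cp, (1−c)p − 3), then A is contained in an arithmetic progression in ℤ/pℤ of length at most |A| + cp, and B is contained in an arithmetic progression in ℤ/pℤ of length at most |B| + cp. -/
open scoped Pointwise

/-- `S` is contained in an arithmetic progression in `ZMod p` of length at most `t`. -/
def InAP {p : ℕ} (S : Finset (ZMod p)) (t : ℝ) : Prop :=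
  ∃ (L : ℕ) (x d : ZMod p), d ≠ 0 ∧ (L : ℝ) ≤ t ∧
    S ⊆ (Finset.range L).image (fun j => x + (Nat.cast j : ZMod p) * d)

/-- The subgroup of periods of a finite set. -/
def periodGroup {G : Type*} [AddCommGroup G] (C : Finset G) : AddSubgroup G where
  carrier := {h | ∀ x, x + h ∈ C ↔ x ∈ C}
  zero_mem' := by simp
  add_mem' := by
    intro a b ha hb x
    rw [← add_assoc]
    exact (hb _).trans (ha _)
  neg_mem' := by
    intro a ha x
    have := ha (x + -a)
    simpa using this.symm

/-- `C` together with one of its period groups has at least `n` elements. -/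
def KneserBound {G : Type*} [AddCommGroup G] (n : ℕ) (C : Finset G) : Prop :=
  ∃ H : AddSubgroup G, (∀ x ∈ C, ∀ h ∈ H, x + h ∈ C) ∧ n ≤ C.card + Nat.card H

lemma kneserBound_inner {G : Type*} [AddCommGroup G] [Finite G] [DecidableEq G]
    (n : ℕ) : ∀ A B : Finset G, B.card = n → 0 ∈ A → 0 ∈ B →
      ∃ C ⊆ A + B, 0 ∈ C ∧ KneserBound (A.card + B.card) C := by
  induction n using Nat.strong_induction_on with
  | _ n ih =>
    intro A B hn hA hB
    by_cases h : ∀ a ∈ A, ∀ b ∈ B, a + b ∈ A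
    · refine ⟨A, fun a ha => ?_, hA, periodGroup A, fun x hx h hh => (hh x).2 hx, ?_⟩
      · simpa using Finset.add_mem_add ha hB
      · have hsub : (B : Set G) ⊆ (periodGroup A : Set G) := by
          intro b hb x
          have himg : A.image (· + b) = A := by
            apply Finset.eq_of_subset_of_card_le
            · intro y hy
              obtain ⟨a, ha, rfl⟩ := Finset.mem_image.1 hy
              exact h a ha b hb
            · rw [Finset.card_image_of_injective _ (add_left_injective b)]
          constructor
          · intro hx
            rw [← himg] at hx
            obtain ⟨a, ha, hax⟩ := Finset.mem_image.1 hx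
            have : a = x := by simpa using hax
            exact this ▸ ha
          · intro hx
            exact h x hx b hb
        have := Set.ncard_le_ncard hsub (Set.toFinite _)
        rw [Set.ncard_coe_finset] at this
        have h2 : (periodGroup A : Set G).ncard = Nat.card (periodGroup A) := rfl
        omega
    · push Not at h
      obtain ⟨e, he, b₀, hb₀, heb⟩ := h
      set B' := B.filter (fun b => e + b ∈ A) with hB'
      set A' := A ∪ B.image (fun b => e + b) with hA'
      have hlt : B'.card < B.card :=
        Finset.card_lt_card (Finset.filter_ssubset.2 ⟨b₀, hb₀, heb⟩)
      have h0 : (0 : G) ∈ B' := by simp [hB', hB, he]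
      obtain ⟨C, hC, hC0, H, hH, hcard⟩ := ih B'.card (hn ▸ hlt) A' B' rfl
        (Finset.mem_union_left _ hA) h0
      refine ⟨C, hC.trans ?_, hC0, H, hH, le_trans ?_ hcard⟩
      · intro z hz
        obtain ⟨x, hx, y, hy, rfl⟩ := Finset.mem_add.1 hz
        obtain ⟨hyB, hyA⟩ := Finset.mem_filter.1 hy
        rcases Finset.mem_union.1 hx with hx | hx
        · exact Finset.add_mem_add hx hyB
        · obtain ⟨b, hb, rfl⟩ := Finset.mem_image.1 hx
          have : e + b + y = (e + y) + b := by abel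
          rw [this]
          exact Finset.add_mem_add hyA hb
      · have h1 := Finset.card_union_add_card_inter A (B.image (fun b => e + b))
        rw [Finset.card_image_of_injective _ (add_right_injective e)] at h1
        have h2 : A ∩ B.image (fun b => e + b) = B'.image (fun b => e + b) := by
          ext z
          simp only [Finset.mem_inter, Finset.mem_image, hB', Finset.mem_filter]
          constructor
          · rintro ⟨hz, b, hb, rfl⟩
            exact ⟨b, ⟨hb, hz⟩, rfl⟩
          · rintro ⟨b, ⟨hb, hz⟩, rfl⟩
            exact ⟨hz, b, hb, rfl⟩
        rw [h2, Finset.card_image_of_injective _ (add_right_injective e), ← hA'] at h1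
        omega

lemma card_lt_of_card_sdiff_add_lt {G : Type*} [AddCommGroup G] [Finite G] [DecidableEq G]
    {C₁ C₂ : Finset G} {H₁ H₂ : AddSubgroup G}
    (h₁ : ∀ x ∈ C₁, ∀ h ∈ H₁, x + h ∈ C₁) (h₂ : ∀ x ∈ C₂, ∀ h ∈ H₂, x + h ∈ C₂)
    (hs₁ : (C₂ \ C₁).card + Nat.card (H₁ ⊓ H₂ : AddSubgroup G) < Nat.card H₁)
    (hs₂ : (C₁ \ C₂).card + Nat.card (H₁ ⊓ H₂ : AddSubgroup G) < Nat.card H₂)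
    {x : G} (hx : x ∈ C₂ \ C₁) : Nat.card H₂ < Nat.card H₁ := by
  classical
  have := Fintype.ofFinite G
  obtain ⟨hx2, hx1⟩ := Finset.mem_sdiff.1 hx
  have key : ∀ H : AddSubgroup G, Nat.card H = (Finset.univ.filter (· ∈ H)).card := by
    intro H
    rw [Nat.card_eq_fintype_card, Fintype.card_subtype]
  have h₁' : ∀ y, ∀ h ∈ H₁, y + h ∈ C₁ ↔ y ∈ C₁ := fun y h hh =>
    ⟨fun hy => by simpa using h₁ _ hy (-h) (H₁.neg_mem hh), fun hy => h₁ _ hy h hh⟩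
  have h₂' : ∀ y, ∀ h ∈ H₂, y + h ∈ C₂ ↔ y ∈ C₂ := fun y h hh =>
    ⟨fun hy => by simpa using h₂ _ hy (-h) (H₂.neg_mem hh), fun hy => h₂ _ hy h hh⟩
  set K : AddSubgroup G := H₁ ⊓ H₂ with hK
  set U := Finset.univ.filter (fun h => h ∈ H₁ ∧ x + h ∈ C₂) with hU
  set A := Finset.univ.filter (fun h => h ∈ H₁ ∧ x + h ∉ C₂) with hA
  set V := Finset.univ.filter (fun h => h ∈ H₂ ∧ x + h ∈ C₁) with hV
  set B := Finset.univ.filter (fun h => h ∈ H₂ ∧ x + h ∉ C₁) with hB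
  have eUA : U.card + A.card = Nat.card H₁ := by
    rw [key, ← Finset.card_filter_add_card_filter_not (s := Finset.univ.filter (· ∈ H₁))
      (fun h => x + h ∈ C₂), Finset.filter_filter, Finset.filter_filter]
  have eVB : V.card + B.card = Nat.card H₂ := by
    rw [key, ← Finset.card_filter_add_card_filter_not (s := Finset.univ.filter (· ∈ H₂))
      (fun h => x + h ∈ C₁), Finset.filter_filter, Finset.filter_filter]
  -- nonempty `K`-periodic sets are large
  have big : ∀ S : Finset G, (∀ s ∈ S, ∀ h ∈ K, s + h ∈ S) → S.Nonempty → Nat.card K ≤ S.card := by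
    rintro S hS ⟨s, hs⟩
    rw [key, ← Finset.card_image_of_injective (Finset.univ.filter (· ∈ K)) (add_right_injective s)]
    apply Finset.card_le_card
    intro z hz
    obtain ⟨h, hh, rfl⟩ := Finset.mem_image.1 hz
    exact hS s hs h (by simpa using hh)
  have pU : U.Nonempty → Nat.card K ≤ U.card := big _ (by
    intro s hs h hh
    simp only [hU, Finset.mem_filter, Finset.mem_univ, true_and] at hs ⊢
    exact ⟨H₁.add_mem hs.1 hh.1, by rw [← add_assoc, h₂' _ _ hh.2]; exact hs.2⟩)
  have pA : A.Nonempty → Nat.card K ≤ A.card := big _ (by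
    intro s hs h hh
    simp only [hA, Finset.mem_filter, Finset.mem_univ, true_and] at hs ⊢
    exact ⟨H₁.add_mem hs.1 hh.1, by rw [← add_assoc, h₂' _ _ hh.2]; exact hs.2⟩)
  have pV : V.Nonempty → Nat.card K ≤ V.card := big _ (by
    intro s hs h hh
    simp only [hV, Finset.mem_filter, Finset.mem_univ, true_and] at hs ⊢
    exact ⟨H₂.add_mem hs.1 hh.2, by rw [← add_assoc, h₁' _ _ hh.1]; exact hs.2⟩)
  have pB : B.Nonempty → Nat.card K ≤ B.card := big _ (by
    intro s hs h hh
    simp only [hB, Finset.mem_filter, Finset.mem_univ, true_and] at hs ⊢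
    exact ⟨H₂.add_mem hs.1 hh.2, by rw [← add_assoc, h₁' _ _ hh.1]; exact hs.2⟩)
  have cnt : ∀ (S T R : Finset G), (∀ s ∈ S, s ∈ H₁) → (∀ t ∈ T, t ∈ H₂) →
      (∀ s ∈ S, ∀ t ∈ T, x + s + t ∈ R) → S.card * T.card ≤ Nat.card K * R.card := by
    intro S T R hS hT hR
    rw [← Finset.card_product]
    refine Finset.card_le_mul_card_image_of_maps_to (f := fun q : G × G => x + q.1 + q.2)
      (fun q hq => ?_) _ (fun z _ => ?_)
    · rw [Finset.mem_product] at hq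
      exact hR _ hq.1 _ hq.2
    · rcases (Finset.filter (fun q : G × G => x + q.1 + q.2 = z) (S ×ˢ T)).eq_empty_or_nonempty
        with h | ⟨q₀, hq₀⟩
      · rw [h]; simp
      · rw [key]
        simp only [Finset.mem_filter, Finset.mem_product] at hq₀
        refine Finset.card_le_card_of_injOn (fun q => q.1 - q₀.1) (fun q hq => ?_) ?_
        · simp only [Finset.coe_filter, Finset.mem_product, Set.mem_ofPred_eq] at hq
          have e : q.1 - q₀.1 = q₀.2 - q.2 := by
            have := hq.2.trans hq₀.2.symm
            rw [sub_eq_sub_iff_add_eq_add]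
            have h3 : q.1 + q.2 = q₀.1 + q₀.2 := by
              rw [add_assoc, add_assoc] at this
              exact add_left_cancel this
            rw [h3, add_comm]
          simp only [Finset.coe_filter, Finset.mem_univ, true_and, Set.mem_ofPred_eq]
          exact ⟨H₁.sub_mem (hS _ hq.1.1) (hS _ hq₀.1.1),
            e ▸ H₂.sub_mem (hT _ hq₀.1.2) (hT _ hq.1.2)⟩
        · intro q hq q' hq' h
          simp only [Finset.coe_filter, Finset.mem_product, Set.mem_ofPred_eq] at hq hq'
          have e1 : q.1 = q'.1 := by simpa using h
          have e2 := hq.2.trans hq'.2.symm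
          rw [e1] at e2
          exact Prod.ext e1 (add_left_cancel e2)
  have c1 : U.card * B.card ≤ Nat.card K * (C₂ \ C₁).card := by
    refine cnt U B _ (by simp +contextual [hU]) (by simp +contextual [hB]) ?_
    intro s hs t ht
    simp only [hU, hB, Finset.mem_filter, Finset.mem_univ, true_and] at hs ht
    rw [Finset.mem_sdiff, h₂' _ _ ht.1, add_right_comm, h₁' _ _ hs.1]
    exact ⟨hs.2, ht.2⟩
  have c2 : A.card * V.card ≤ Nat.card K * (C₁ \ C₂).card := by
    refine cnt A V _ (by simp +contextual [hA]) (by simp +contextual [hV]) ?_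
    intro s hs t ht
    simp only [hA, hV, Finset.mem_filter, Finset.mem_univ, true_and] at hs ht
    rw [Finset.mem_sdiff, h₂' _ _ ht.1, add_right_comm, h₁' _ _ hs.1]
    exact ⟨ht.2, hs.2⟩
  have U0 : Nat.card K ≤ U.card := pU ⟨0, by simp [hU, hx2, H₁.zero_mem]⟩
  have B0 : Nat.card K ≤ B.card := pB ⟨0, by simp [hB, hx1, H₂.zero_mem]⟩
  have K0 : 0 < Nat.card K := Nat.card_pos
  generalize Nat.card K = κ at *
  have d1 : κ * (C₂ \ C₁).card + κ * κ < κ * (U.card + A.card) := by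
    rw [← mul_add, eUA]; exact Nat.mul_lt_mul_of_pos_left hs₁ K0
  have d2 : κ * (C₁ \ C₂).card + κ * κ < κ * (V.card + B.card) := by
    rw [← mul_add, eVB]; exact Nat.mul_lt_mul_of_pos_left hs₂ K0
  rw [← eUA, ← eVB]
  rcases V.eq_empty_or_nonempty with hV0 | hV0
  · rw [hV0, Finset.card_empty]
    nlinarith
  · have V1 := pV hV0
    rcases A.eq_empty_or_nonempty with hA0 | hA0
    · rw [hA0, Finset.card_empty] at d1
      nlinarith
    · have A1 := pA hA0
      exfalso
      have e1 : B.card < A.card := by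
        by_contra hcon
        push Not at hcon
        nlinarith
      nlinarith

lemma KneserBound.union {G : Type*} [AddCommGroup G] [Finite G] [DecidableEq G] {n : ℕ}
    {C₁ C₂ : Finset G} (h₁ : KneserBound n C₁) (h₂ : KneserBound n C₂) :
    KneserBound n (C₁ ∪ C₂) := by
  obtain ⟨H₁, p₁, b₁⟩ := h₁
  obtain ⟨H₂, p₂, b₂⟩ := h₂
  rcases (C₂ \ C₁).eq_empty_or_nonempty with h | ⟨x, hx⟩
  · rw [Finset.sdiff_eq_empty_iff_subset] at h
    rw [Finset.union_eq_left.2 h]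
    exact ⟨H₁, p₁, b₁⟩
  rcases (C₁ \ C₂).eq_empty_or_nonempty with h | ⟨y, hy⟩
  · rw [Finset.sdiff_eq_empty_iff_subset] at h
    rw [Finset.union_eq_right.2 h]
    exact ⟨H₂, p₂, b₂⟩
  refine ⟨H₁ ⊓ H₂, fun z hz h hh => ?_, ?_⟩
  · rcases Finset.mem_union.1 hz with hz | hz
    · exact Finset.mem_union_left _ (p₁ z hz h hh.1)
    · exact Finset.mem_union_right _ (p₂ z hz h hh.2)
  · have e1 : (C₁ ∪ C₂).card = C₁.card + (C₂ \ C₁).card := by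
      have := Finset.card_sdiff_add_card C₂ C₁
      rw [Finset.union_comm] at this
      omega
    have e2 : (C₁ ∪ C₂).card = C₂.card + (C₁ \ C₂).card := by
      have := Finset.card_sdiff_add_card C₁ C₂
      omega
    by_contra hcon
    have s₁ : (C₂ \ C₁).card + Nat.card (H₁ ⊓ H₂ : AddSubgroup G) < Nat.card H₁ := by omega
    have s₂ : (C₁ \ C₂).card + Nat.card (H₁ ⊓ H₂ : AddSubgroup G) < Nat.card H₂ := by omega
    have r₁ := card_lt_of_card_sdiff_add_lt p₁ p₂ s₁ s₂ hx
    have r₂ := card_lt_of_card_sdiff_add_lt p₂ p₁ (inf_comm H₁ H₂ ▸ s₂) (inf_comm H₁ H₂ ▸ s₁) hy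
    omega

lemma kneserBound_add {G : Type*} [AddCommGroup G] [Finite G] [DecidableEq G]
    {A B : Finset G} (hA : A.Nonempty) (hB : B.Nonempty) :
    KneserBound (A.card + B.card) (A + B) := by
  have loc : ∀ c ∈ A + B, ∃ C ⊆ A + B, c ∈ C ∧ KneserBound (A.card + B.card) C := by
    intro c hc
    obtain ⟨a, ha, b, hb, rfl⟩ := Finset.mem_add.1 hc
    obtain ⟨C, hC, h0, H, hH, hn⟩ := kneserBound_inner _ (A.image (· - a)) (B.image (· - b)) rfl
      (Finset.mem_image.2 ⟨a, ha, sub_self a⟩) (Finset.mem_image.2 ⟨b, hb, sub_self b⟩)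
    refine ⟨C.image (· + (a + b)), ?_, Finset.mem_image.2 ⟨0, h0, zero_add _⟩, H, ?_, ?_⟩
    · intro z hz
      obtain ⟨y, hy, rfl⟩ := Finset.mem_image.1 hz
      obtain ⟨u, hu, v, hv, rfl⟩ := Finset.mem_add.1 (hC hy)
      obtain ⟨a', ha', rfl⟩ := Finset.mem_image.1 hu
      obtain ⟨b', hb', rfl⟩ := Finset.mem_image.1 hv
      have : a' - a + (b' - b) + (a + b) = a' + b' := by abel
      rw [this]
      exact Finset.add_mem_add ha' hb'
    · intro z hz h hh
      obtain ⟨y, hy, rfl⟩ := Finset.mem_image.1 hz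
      exact Finset.mem_image.2 ⟨y + h, hH y hy h hh, by abel⟩
    · rw [Finset.card_image_of_injective _ (sub_left_injective),
        Finset.card_image_of_injective _ (sub_left_injective)] at hn
      rwa [Finset.card_image_of_injective _ (add_left_injective _)]
  choose! f hf using loc
  have hun : ∀ S : Finset G, S ⊆ A + B → S.Nonempty →
      KneserBound (A.card + B.card) (S.biUnion f) := by
    intro S
    induction S using Finset.induction_on with
    | empty => intro _ h; exact absurd h (by simp)
    | insert c S _ ih =>
      intro hS _
      rw [Finset.biUnion_insert]
      have hc := (hf c (hS (Finset.mem_insert_self _ _))).2.2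
      rcases S.eq_empty_or_nonempty with rfl | hne
      · simpa using hc
      · exact hc.union (ih ((Finset.subset_insert _ _).trans hS) hne)
  have := hun (A + B) subset_rfl (hA.add hB)
  convert this using 1
  ext z
  rw [Finset.mem_biUnion]
  exact ⟨fun hz => ⟨z, hz, (hf z hz).2.1⟩, fun ⟨c, hc, hz⟩ => (hf c hc).1 hz⟩

/-- Kneser's theorem. -/
theorem kneser {G : Type*} [AddCommGroup G] [Fintype G] [DecidableEq G]
    {A B : Finset G} (hA : A.Nonempty) (hB : B.Nonempty) :
    ∃ H : AddSubgroup G, ∃ A' B' : Finset G, A ⊆ A' ∧ B ⊆ B' ∧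
      (∀ x ∈ A', ∀ h ∈ H, x + h ∈ A') ∧ (∀ x ∈ B', ∀ h ∈ H, x + h ∈ B') ∧
      A'.card + B'.card ≤ (A + B).card + Nat.card H := by
  classical
  set H := periodGroup (A + B)
  set F := Finset.univ.filter (· ∈ H) with hF
  have F0 : (0 : G) ∈ F := by simp [hF, H.zero_mem]
  have hsum : (A + F) + (B + F) = A + B := by
    apply subset_antisymm
    · intro z hz
      obtain ⟨u, hu, v, hv, rfl⟩ := Finset.mem_add.1 hz
      obtain ⟨a, ha, h, hh, rfl⟩ := Finset.mem_add.1 hu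
      obtain ⟨b, hb, h', hh', rfl⟩ := Finset.mem_add.1 hv
      have e : a + h + (b + h') = a + b + (h + h') := by abel
      rw [e]
      have : h + h' ∈ H := H.add_mem (by simpa [hF] using hh) (by simpa [hF] using hh')
      exact (this _).2 (Finset.add_mem_add ha hb)
    · intro z hz
      obtain ⟨a, ha, b, hb, rfl⟩ := Finset.mem_add.1 hz
      exact Finset.add_mem_add (by simpa using Finset.add_mem_add ha F0)
        (by simpa using Finset.add_mem_add hb F0)
  have per : ∀ S : Finset G, ∀ x ∈ S + F, ∀ h ∈ H, x + h ∈ S + F := by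
    intro S x hx h hh
    obtain ⟨a, ha, h', hh', rfl⟩ := Finset.mem_add.1 hx
    rw [add_assoc]
    refine Finset.add_mem_add ha ?_
    simp only [hF, Finset.mem_filter, Finset.mem_univ, true_and] at hh' ⊢
    exact H.add_mem hh' hh
  obtain ⟨H', hH', hn⟩ := kneserBound_add (hA.add ⟨0, F0⟩) (hB.add ⟨0, F0⟩)
  rw [hsum] at hH' hn
  refine ⟨H, A + F, B + F, fun a ha => by simpa using Finset.add_mem_add ha F0,
    fun b hb => by simpa using Finset.add_mem_add hb F0, per A, per B, hn.trans ?_⟩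
  gcongr
  apply AddSubgroup.card_le_of_le
  intro h hh x
  exact ⟨fun hx => by simpa using hH' _ hx (-h) (H'.neg_mem hh), fun hx => hH' _ hx h hh⟩

/-- The set of residues modulo `d` of a finite set of integers. -/
def residues (d : ℕ) (X : Finset ℤ) : Finset (ZMod d) := X.image (Int.cast : ℤ → ZMod d)

lemma mem_residues {d : ℕ} {X : Finset ℤ} {r : ZMod d} :
    r ∈ residues d X ↔ ∃ x ∈ X, (x : ZMod d) = r := by simp [residues]

lemma residues_add (d : ℕ) (X Y : Finset ℤ) : residues d (X + Y) = residues d X + residues d Y := by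
  ext r
  simp only [mem_residues, Finset.mem_add]
  constructor
  · rintro ⟨_, ⟨x, hx, y, hy, rfl⟩, rfl⟩
    exact ⟨x, ⟨x, hx, rfl⟩, y, ⟨y, hy, rfl⟩, by push_cast; rfl⟩
  · rintro ⟨_, ⟨x, hx, rfl⟩, _, ⟨y, hy, rfl⟩, rfl⟩
    exact ⟨_, ⟨x, hx, y, hy, rfl⟩, by push_cast; rfl⟩

lemma kneser_int {b : ℕ} (hb : 0 < b) {X Y : Finset ℤ} (hX : X.Nonempty) (hY : Y.Nonempty) :
    ∃ d h : ℕ, d * h = b ∧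
      h * ((residues d X).card + (residues d Y).card) ≤ (residues b (X + Y)).card + h := by
  have : NeZero b := ⟨hb.ne'⟩
  obtain ⟨H, A', B', hA, hB, pA, pB, hn⟩ := kneser (A := residues b X) (B := residues b Y)
    (hX.image _) (hY.image _)
  have hdh : H.index * Nat.card H = b := by
    rw [H.index_mul_card, Nat.card_zmod]
  have hdvd : H.index ∣ b := ⟨_, hdh.symm⟩
  set f := ZMod.castHom hdvd (ZMod H.index) with hf
  have hker : ∀ x ∈ H, f x = 0 := by
    intro x hx
    have hcy := Int.subgroup_cyclic (H.comap (Int.castAddHom (ZMod b)))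
    obtain ⟨a, ha⟩ := hcy
    rw [← AddSubgroup.zmultiples_eq_closure] at ha
    have hidx : (H.comap (Int.castAddHom (ZMod b))).index = H.index :=
      AddSubgroup.index_comap_of_surjective _ ZMod.intCast_surjective
    rw [ha, Int.index_zmultiples] at hidx
    obtain ⟨n, rfl⟩ := ZMod.intCast_surjective x
    have : n ∈ H.comap (Int.castAddHom (ZMod b)) := hx
    rw [ha, Int.mem_zmultiples_iff] at this
    rw [map_intCast, ZMod.intCast_zmod_eq_zero_iff_dvd, ← hidx]
    exact Int.natAbs_dvd.2 this
  have key : ∀ (Z : Finset ℤ) (A' : Finset (ZMod b)), residues b Z ⊆ A' →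
      (∀ x ∈ A', ∀ h ∈ H, x + h ∈ A') →
      Nat.card H * (residues H.index Z).card ≤ A'.card := by
    intro Z A' hA pA
    refine le_trans ?_ (Finset.mul_card_image_le_card (f := f) A' (Nat.card H) ?_)
    · gcongr
      intro r hr
      obtain ⟨x, hx, rfl⟩ := mem_residues.1 hr
      exact Finset.mem_image.2 ⟨(x : ZMod b), hA (mem_residues.2 ⟨x, hx, rfl⟩), map_intCast f x⟩
    · intro r hr
      obtain ⟨a, ha, rfl⟩ := Finset.mem_image.1 hr
      have e : Nat.card H = ((H : Set (ZMod b)).toFinite.toFinset).card := by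
        rw [← Set.ncard_eq_toFinset_card]; rfl
      rw [e, ← Finset.card_image_of_injective _ (add_right_injective a)]
      apply Finset.card_le_card
      intro z hz
      obtain ⟨h, hh, rfl⟩ := Finset.mem_image.1 hz
      have hh' : h ∈ H := by simpa using hh
      refine Finset.mem_filter.2 ⟨pA a ha h hh', ?_⟩
      simp only [map_add, hker h hh', add_zero]
  refine ⟨H.index, Nat.card H, hdh, ?_⟩
  rw [residues_add, mul_add]
  exact (add_le_add (key X A' hA pA) (key Y B' hB pB)).trans hn

lemma card_residues_le (d : ℕ) (X : Finset ℤ) : (residues d X).card ≤ X.card :=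
  Finset.card_image_le

lemma card_residues_mul_le {b d h : ℕ} (hb : 0 < b) (hdh : d * h = b) (X : Finset ℤ) :
    (residues b X).card ≤ h * (residues d X).card := by
  have : NeZero b := ⟨hb.ne'⟩
  have hdvd : d ∣ b := ⟨h, hdh.symm⟩
  have hd : 0 < d := Nat.pos_of_dvd_of_pos hdvd hb
  have : NeZero d := ⟨hd.ne'⟩
  set f := ZMod.castHom hdvd (ZMod d)
  have hsub : (residues d X) = (residues b X).image f := by
    ext r
    simp only [mem_residues, Finset.mem_image]
    constructor
    · rintro ⟨x, hx, rfl⟩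
      exact ⟨x, ⟨x, hx, rfl⟩, map_intCast f x⟩
    · rintro ⟨_, ⟨x, hx, rfl⟩, rfl⟩
      exact ⟨x, hx, (map_intCast f x).symm⟩
  rw [hsub]
  refine Finset.card_le_mul_card_image (f := f) _ h ?_
  intro r hr
  have : (Finset.range h).card = h := Finset.card_range h
  rw [← this]
  refine Finset.card_le_card_of_injOn (fun z => z.val / d) ?_ ?_
  · intro z _
    simp only [Finset.coe_range, Set.mem_Iio]
    apply Nat.div_lt_of_lt_mul
    rw [hdh]
    exact ZMod.val_lt z
  · intro z hz w hw hzw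
    simp only [Finset.coe_filter, Set.mem_ofPred_eq] at hz hw
    have e : f z = f w := hz.2.trans hw.2.symm
    have e' : z.val % d = w.val % d := by
      have h1 : f z = ((z.val : ℕ) : ZMod d) := by
        conv_lhs => rw [← ZMod.natCast_zmod_val z]
        exact map_natCast f _
      have h2 : f w = ((w.val : ℕ) : ZMod d) := by
        conv_lhs => rw [← ZMod.natCast_zmod_val w]
        exact map_natCast f _
      rw [h1, h2] at e
      exact (ZMod.natCast_eq_natCast_iff _ _ _).1 e
    apply ZMod.val_injective b
    rw [← Nat.div_add_mod z.val d, ← Nat.div_add_mod w.val d, e']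
    simp only at hzw
    rw [hzw]

/-- Integers in a half-open interval of length `b` have distinct residues modulo `b`. -/
lemma card_residues_eq {b : ℕ} {X : Finset ℤ} {a : ℤ} (h : ∀ x ∈ X, a ≤ x ∧ x < a + b) :
    (residues b X).card = X.card := by
  refine Finset.card_image_of_injOn ?_
  intro x hx y hy hxy
  have hx := h x hx
  have hy := h y hy
  have h1 := (ZMod.intCast_eq_intCast_iff_dvd_sub x y b).1 hxy
  have h2 := Int.eq_zero_of_abs_lt_dvd h1 (by rw [abs_lt]; constructor <;> omega)
  omega

lemma residues_mono {d : ℕ} {X Y : Finset ℤ} (h : X ⊆ Y) : residues d X ⊆ residues d Y :=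
  Finset.image_subset_image h

lemma card_le_card_residues_add_one {b : ℕ} {X : Finset ℤ} {a : ℤ}
    (h : ∀ x ∈ X, a ≤ x ∧ x ≤ a + b) : X.card ≤ (residues b X).card + 1 := by
  have h1 : (residues b (X.erase (a + b))).card = (X.erase (a + b)).card := by
    refine card_residues_eq (a := a) fun x hx => ?_
    have := h x (Finset.mem_of_mem_erase hx)
    have := Finset.ne_of_mem_erase hx
    omega
  have h2 := Finset.card_le_card (residues_mono (d := b) (Finset.erase_subset (a + b) X))
  have h3 := Finset.pred_card_le_card_erase (s := X) (a := a + b)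
  omega

lemma min_le_card_residues {b N : ℕ} {C : Finset ℤ} {c : ℤ}
    (h : ∀ j : ℤ, 0 ≤ j → j < N → c + j ∈ C) : min b N ≤ (residues b C).card := by
  have hsub : Finset.Ico c (c + (min b N : ℕ)) ⊆ C := by
    intro z hz
    rw [Finset.mem_Ico] at hz
    have := h (z - c) (by omega) (by omega)
    rwa [add_sub_cancel] at this
  have h1 := card_residues_eq (b := b) (X := Finset.Ico c (c + (min b N : ℕ))) (a := c)
    (fun x hx => by rw [Finset.mem_Ico] at hx; omega)
  have h2 := Finset.card_le_card (residues_mono (d := b) hsub)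
  rw [h1, Int.card_Ico] at h2
  omega

/-- Modulo the difference of two elements of `Y`, every residue class met by `X + Y` contains
more elements of `X + Y` than of `X`. -/
lemma card_add_card_residues_le {b : ℕ} (hb : 0 < b) {X Y : Finset ℤ} {a : ℤ}
    (h0 : a ∈ Y) (h1 : a + b ∈ Y) :
    X.card + (residues b (X + Y)).card ≤ (X + Y).card := by
  set X' := X.image (· + a) with hX'
  have hX'c : X'.card = X.card := Finset.card_image_of_injective _ (add_left_injective a)
  have hsub : X' ⊆ X + Y := by
    intro z hz
    obtain ⟨x, hx, rfl⟩ := Finset.mem_image.1 hz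
    exact Finset.add_mem_add hx h0
  have h2 : residues b (X + Y) ⊆ residues b ((X + Y) \ X') := by
    intro r hr
    obtain ⟨z, hz, rfl⟩ := mem_residues.1 hr
    by_cases hzX : z ∈ X'
    · set F := X'.filter (fun x : ℤ => (x : ZMod b) = z) with hF
      have hFne : F.Nonempty := ⟨z, by simp [hF, hzX]⟩
      have hM := F.max'_mem hFne
      set M := F.max' hFne with hMdef
      obtain ⟨hMX, hMz⟩ := Finset.mem_filter.1 hM
      refine mem_residues.2 ⟨M + b, Finset.mem_sdiff.2 ⟨?_, fun hcon => ?_⟩, by simp [hMz]⟩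
      · obtain ⟨x, hx, hxa⟩ := Finset.mem_image.1 hMX
        have : M + b = x + (a + b) := by rw [← hxa]; ring
        rw [this]
        exact Finset.add_mem_add hx h1
      · have : M + b ≤ M := F.le_max' _ (Finset.mem_filter.2 ⟨hcon, by simp [hMz]⟩)
        omega
    · exact mem_residues.2 ⟨z, Finset.mem_sdiff.2 ⟨hz, hzX⟩, rfl⟩
  have h3 := (Finset.card_le_card h2).trans (card_residues_le b _)
  have h4 := Finset.card_sdiff_add_card_eq_card hsub
  omega

lemma card_fiber_le {b d h : ℕ} (hd : 0 < d) (hdh : d * h = b) {X : Finset ℤ}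
    (hX : ∀ x ∈ X, 0 ≤ x ∧ x ≤ b) (α : ZMod d) :
    (X.filter (fun x : ℤ => (x : ZMod d) = α)).card ≤ h + 1 ∧
      (α ≠ 0 → (X.filter (fun x : ℤ => (x : ZMod d) = α)).card ≤ h) := by
  have hd' : (0 : ℤ) < d := by exact_mod_cast hd
  have hinj : Set.InjOn (fun x : ℤ => (x / d).toNat)
      (X.filter (fun x : ℤ => (x : ZMod d) = α) : Finset ℤ) := by
    intro x hx y hy hxy
    simp only [Finset.coe_filter, Set.mem_ofPred_eq] at hx hy
    have e : x % d = y % d := (ZMod.intCast_eq_intCast_iff' _ _ _).1 (hx.2.trans hy.2.symm)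
    have h1 := Int.ediv_nonneg (hX x hx.1).1 hd'.le
    have h2 := Int.ediv_nonneg (hX y hy.1).1 hd'.le
    have h3 : x / d = y / d := by simp only at hxy; omega
    rw [← Int.mul_ediv_add_emod x d, ← Int.mul_ediv_add_emod y d, e, h3]
  have hb : (b : ℤ) = d * h := by exact_mod_cast hdh.symm
  constructor
  · have : (Finset.range (h + 1)).card = h + 1 := Finset.card_range _
    rw [← this]
    refine Finset.card_le_card_of_injOn _ (fun x hx => ?_) hinj
    simp only [Finset.coe_filter, Set.mem_ofPred_eq] at hx
    have h1 : x / d ≤ h := by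
      apply Int.ediv_le_of_le_mul hd'
      have := (hX x hx.1).2
      rw [hb] at this
      linarith [mul_comm (d : ℤ) h]
    simp only [Finset.coe_range, Set.mem_Iio]
    omega
  · intro hα
    have : (Finset.range h).card = h := Finset.card_range _
    rw [← this]
    refine Finset.card_le_card_of_injOn _ (fun x hx => ?_) hinj
    simp only [Finset.coe_filter, Set.mem_ofPred_eq] at hx
    have hxb := hX x hx.1
    have hne : x ≠ b := by
      rintro rfl
      apply hα
      rw [← hx.2, hb]
      simp
    have h1 : x / d < h := by
      apply Int.ediv_lt_of_lt_mul hd'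
      rw [mul_comm]
      omega
    have h2 := Int.ediv_nonneg hxb.1 hd'.le
    simp only [Finset.coe_range, Set.mem_Iio]
    omega

/-- Lower bound for a sumset in terms of the sizes of the summands in residue classes. -/
lemma card_add_ge_of_classes {d : ℕ} {X Y : Finset ℤ} {w r : ℕ} {α : ZMod d}
    (hα : α ∈ residues d X)
    (hw : ∀ β ∈ residues d X, ∀ γ ∈ residues d Y,
      w + 1 ≤ (X.filter (fun x : ℤ => (x : ZMod d) = β)).card +
        (Y.filter (fun x : ℤ => (x : ZMod d) = γ)).card)
    (hr : (residues d Y).card + r ≤ (residues d (X + Y)).card) :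
    (residues d Y).card * (X.filter (fun x : ℤ => (x : ZMod d) = α)).card + Y.card + r * w ≤
      (X + Y).card + (residues d Y).card := by
  set s : ZMod d → ℕ := fun β => (X.filter (fun x : ℤ => (x : ZMod d) = β)).card with hs
  set t : ZMod d → ℕ := fun β => (Y.filter (fun x : ℤ => (x : ZMod d) = β)).card with ht
  set u : ZMod d → ℕ := fun β => ((X + Y).filter (fun x : ℤ => (x : ZMod d) = β)).card with hu
  have cd : ∀ β ∈ residues d X, ∀ γ ∈ residues d Y, s β + t γ ≤ u (β + γ) + 1 := by
    intro β hβ γ hγ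
    obtain ⟨x, hx, hxβ⟩ := mem_residues.1 hβ
    obtain ⟨y, hy, hyγ⟩ := mem_residues.1 hγ
    have h1 := cauchy_davenport_add_of_linearOrder_isCancelAdd
      (s := X.filter (fun x : ℤ => (x : ZMod d) = β))
      (t := Y.filter (fun x : ℤ => (x : ZMod d) = γ))
      ⟨x, Finset.mem_filter.2 ⟨hx, hxβ⟩⟩ ⟨y, Finset.mem_filter.2 ⟨hy, hyγ⟩⟩
    have h2 : X.filter (fun x : ℤ => (x : ZMod d) = β) + Y.filter (fun x : ℤ => (x : ZMod d) = γ) ⊆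
        (X + Y).filter (fun x : ℤ => (x : ZMod d) = β + γ) := by
      intro z hz
      obtain ⟨x, hx, y, hy, rfl⟩ := Finset.mem_add.1 hz
      obtain ⟨hx, hx'⟩ := Finset.mem_filter.1 hx
      obtain ⟨hy, hy'⟩ := Finset.mem_filter.1 hy
      exact Finset.mem_filter.2 ⟨Finset.add_mem_add hx hy, by push_cast; rw [hx', hy']⟩
    have h3 := Finset.card_le_card h2
    have h4 := h1.trans h3
    simp only [hs, ht, hu]
    omega
  have hsum : (X + Y).card = ∑ γ ∈ residues d (X + Y), u γ :=
    Finset.card_eq_sum_card_fiberwise (f := fun x : ℤ => (x : ZMod d))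
      (fun x hx => mem_residues.2 ⟨x, hx, rfl⟩)
  have hsumY : Y.card = ∑ γ ∈ residues d Y, t γ :=
    Finset.card_eq_sum_card_fiberwise (f := fun x : ℤ => (x : ZMod d))
      (fun x hx => mem_residues.2 ⟨x, hx, rfl⟩)
  set R := (residues d Y).image (α + ·) with hR
  have hRc : R.card = (residues d Y).card :=
    Finset.card_image_of_injective _ (add_right_injective α)
  have hRsub : R ⊆ residues d (X + Y) := by
    intro z hz
    obtain ⟨y, hy, rfl⟩ := Finset.mem_image.1 hz
    rw [residues_add]
    exact Finset.add_mem_add hα hy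
  have h1 : ∑ γ ∈ R, u γ = ∑ γ ∈ residues d Y, u (α + γ) :=
    Finset.sum_image (fun _ _ _ _ h => add_left_cancel h)
  have h2 : ∑ γ ∈ residues d Y, (s α + t γ) ≤ ∑ γ ∈ residues d Y, (u (α + γ) + 1) :=
    Finset.sum_le_sum fun γ hγ => cd α hα γ hγ
  rw [Finset.sum_add_distrib, Finset.sum_add_distrib, Finset.sum_const, Finset.sum_const,
    ← hsumY, ← h1] at h2
  have h3 : (residues d (X + Y) \ R).card * w ≤ ∑ γ ∈ residues d (X + Y) \ R, u γ := by
    rw [← smul_eq_mul]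
    apply Finset.card_nsmul_le_sum
    intro γ hγ
    have := (Finset.mem_sdiff.1 hγ).1
    rw [residues_add] at this
    obtain ⟨β, hβ, γ, hγ', rfl⟩ := Finset.mem_add.1 this
    have h4 := cd β hβ γ hγ'
    have h5 := hw β hβ γ hγ'
    simp only [hs, ht] at h4
    omega
  have h4 := Finset.sum_sdiff (f := u) hRsub
  have h5 := Finset.card_sdiff_add_card_eq_card hRsub
  have h6 : r ≤ (residues d (X + Y) \ R).card := by omega
  have h7 := Nat.mul_le_mul_right w h6
  simp only [smul_eq_mul, mul_one] at h2
  simp only [hs] at h2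
  omega

lemma sum_le_mul_max_add_min {ι : Type*} [DecidableEq ι] {R : Finset ι} {f : ι → ℕ} {M : ℕ} {i : ι}
    (hi : i ∈ R) (hM : ∀ j ∈ R, f j ≤ M) : ∑ j ∈ R, f j + M ≤ R.card * M + f i := by
  rw [← Finset.add_sum_erase _ _ hi]
  have h1 : ∑ j ∈ R.erase i, f j ≤ (R.erase i).card * M := by
    rw [← smul_eq_mul]
    exact Finset.sum_le_card_nsmul _ _ _ fun j hj => hM j (Finset.mem_of_mem_erase hj)
  have h2 := Finset.card_erase_add_one hi
  rw [← h2, add_mul]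
  omega

lemma sum_le_mul_add_min {ι : Type*} [DecidableEq ι] {R : Finset ι} {f : ι → ℕ} {h : ℕ} {i i₀ : ι}
    (hi : i ∈ R) (hM : ∀ j ∈ R, j ≠ i₀ → f j ≤ h) (hM' : f i₀ ≤ h + 1) :
    ∑ j ∈ R, f j + h ≤ R.card * h + f i + 1 := by
  rw [← Finset.add_sum_erase _ _ hi]
  have h1 : ∑ j ∈ R.erase i, f j ≤ (R.erase i).card * h + 1 := by
    by_cases hi₀ : i₀ ∈ R.erase i
    · rw [← Finset.add_sum_erase _ _ hi₀]
      have h3 : ∑ j ∈ (R.erase i).erase i₀, f j ≤ ((R.erase i).erase i₀).card * h := by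
        rw [← smul_eq_mul]
        exact Finset.sum_le_card_nsmul _ _ _ fun j hj =>
          hM j (Finset.mem_of_mem_erase (Finset.mem_of_mem_erase hj)) (Finset.ne_of_mem_erase hj)
      have h2 := Finset.card_erase_add_one hi₀
      rw [← h2, add_mul]
      omega
    · have : ∑ j ∈ R.erase i, f j ≤ (R.erase i).card * h := by
        rw [← smul_eq_mul]
        refine Finset.sum_le_card_nsmul _ _ _ fun j hj => hM j (Finset.mem_of_mem_erase hj) ?_
        rintro rfl
        exact hi₀ hj
      omega
  have h2 := Finset.card_erase_add_one hi
  rw [← h2, add_mul]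
  omega

lemma balanced_sumset_arith {m k h S T s t C : ℤ} (hm : 2 ≤ m)
    (hh : h * (2 * m - 1) ≤ 2 * k - 4)
    (hS : S ≤ h + 1) (hT : T ≤ h + 1)
    (hs : k + S ≤ m * S + s) (ht : k + T ≤ m * T + t)
    (hs' : k + h ≤ m * h + s + 1) (ht' : k + h ≤ m * h + t + 1)
    (h1 : m * S + k + (m - 1) * (s + t - 1) ≤ C + m)
    (h2 : m * T + k + (m - 1) * (s + t - 1) ≤ C + m) : 3 * k - 3 ≤ C := by
  rcases eq_or_lt_of_le hm with rfl | hm3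
  · linarith
  have key : 4 ≤ 2 * k - (2 * m - 1) * h := by linarith
  have p0 : 0 ≤ (m - 3) * (2 * k - (2 * m - 1) * h - 4) :=
    mul_nonneg (by linarith) (by linarith)
  have aux : ∀ S : ℤ, S = h + 1 → m * S + k + (m - 1) * (s + t - 1) ≤ C + m → 3 * k - 3 ≤ C := by
    rintro S rfl h1
    have p1 : (m - 1) * (2 * (k + h - m * h - 1) - 1) ≤ (m - 1) * (s + t - 1) :=
      mul_le_mul_of_nonneg_left (by linarith) (by linarith)
    nlinarith
  by_cases hS1 : S = h + 1
  · exact aux S hS1 h1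
  by_cases hT1 : T = h + 1
  · exact aux T hT1 h2
  have hS2 : S ≤ h := by omega
  have hT2 : T ≤ h := by omega
  have p1 : (m - 1) * (2 * k - (m - 1) * (S + T) - 1) ≤ (m - 1) * (s + t - 1) :=
    mul_le_mul_of_nonneg_left (by linarith) (by linarith)
  have p2 : 0 ≤ ((2 * m - 1) * (m - 2)) * (2 * h - S - T) :=
    mul_nonneg (mul_nonneg (by linarith) (by linarith)) (by linarith)
  nlinarith

/-- Two sets of `k` integers, the longer of diameter `b`, with a sumset of at most `3k - 4`
elements: either `b ≤ 2k - 4`, or both lie in the multiples of a common integer. -/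
lemma diam_le_or_dvd {k b : ℕ} (hb : 0 < b) {X Y : Finset ℤ}
    (hXc : X.card = k) (hYc : Y.card = k) (hX0 : 0 ∈ X) (hY0 : 0 ∈ Y) (hYb : (b : ℤ) ∈ Y)
    (hX : ∀ x ∈ X, 0 ≤ x ∧ x ≤ b) (hY : ∀ y ∈ Y, 0 ≤ y ∧ y ≤ b)
    (hC : (X + Y).card + 4 ≤ 3 * k) :
    b + 4 ≤ 2 * k ∨ ∃ d : ℕ, 2 ≤ d ∧ (∀ x ∈ X, (d : ℤ) ∣ x) ∧ ∀ y ∈ Y, (d : ℤ) ∣ y := by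
  classical
  have hc : (residues b (X + Y)).card + 4 ≤ 2 * k := by
    have := card_add_card_residues_le hb (X := X) (a := 0) hY0 (by simpa using hYb)
    omega
  obtain ⟨d, h, hdh, hn⟩ := kneser_int hb (X := X) (Y := Y) ⟨0, hX0⟩ ⟨0, hY0⟩
  have hd : 0 < d := by
    rcases Nat.eq_zero_or_pos d with rfl | h
    · simp at hdh; omega
    · exact h
  have hh : 0 < h := by
    rcases Nat.eq_zero_or_pos h with rfl | h
    · simp at hdh; omega
    · exact h
  have hrX := card_residues_mul_le hb hdh X
  have hrY := card_residues_mul_le hb hdh Y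
  have hrC := card_residues_mul_le hb hdh (X + Y)
  have hkX := card_le_card_residues_add_one (b := b) (X := X) (a := 0) (by simpa using hX)
  have hkY := card_le_card_residues_add_one (b := b) (X := Y) (a := 0) (by simpa using hY)
  set q := (residues d X).card with hq
  set m := (residues d Y).card with hm
  have hqm : q = m := by
    rcases lt_trichotomy q m with hlt | heq | hlt
    · have : h * (2 * q + 1) ≤ h * (q + m) := Nat.mul_le_mul_left _ (by omega)
      have e : h * (2 * q + 1) = 2 * (h * q) + h := by ring
      omega
    · exact heq
    · have : h * (2 * m + 1) ≤ h * (q + m) := Nat.mul_le_mul_left _ (by omega)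
      have e : h * (2 * m + 1) = 2 * (h * m) + h := by ring
      omega
  have hm0 : 0 < m := Finset.card_pos.2 ⟨0, mem_residues.2 ⟨0, hY0, by simp⟩⟩
  rcases Nat.lt_or_ge m 2 with hm1 | hm2
  · have hm1 : m = 1 := by omega
    rcases Nat.lt_or_ge d 2 with hd1 | hd2
    · left
      have : d = 1 := by omega
      subst this
      rw [hqm, hm1] at hn
      omega
    · right
      have aux : ∀ Z : Finset ℤ, 0 ∈ Z → (residues d Z).card = 1 → ∀ z ∈ Z, (d : ℤ) ∣ z := by
        intro Z h0 hZ z hz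
        obtain ⟨r, hr⟩ := Finset.card_eq_one.1 hZ
        have h1 : ((0 : ℤ) : ZMod d) ∈ residues d Z := mem_residues.2 ⟨0, h0, rfl⟩
        have h2 : (z : ZMod d) ∈ residues d Z := mem_residues.2 ⟨z, hz, rfl⟩
        rw [hr, Finset.mem_singleton] at h1 h2
        rw [← ZMod.intCast_zmod_eq_zero_iff_dvd, h2, ← h1, Int.cast_zero]
      exact ⟨d, hd2, aux X hX0 (by omega), aux Y hY0 (by omega)⟩
  · exfalso
    set s : ZMod d → ℕ := fun β => (X.filter (fun x : ℤ => (x : ZMod d) = β)).card with hs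
    set t : ZMod d → ℕ := fun β => (Y.filter (fun x : ℤ => (x : ZMod d) = β)).card with ht
    have hXne : (residues d X).Nonempty := ⟨0, mem_residues.2 ⟨0, hX0, by simp⟩⟩
    have hYne : (residues d Y).Nonempty := ⟨0, mem_residues.2 ⟨0, hY0, by simp⟩⟩
    obtain ⟨α, hα, hαm⟩ := Finset.exists_max_image _ s hXne
    obtain ⟨β, hβ, hβm⟩ := Finset.exists_max_image _ t hYne
    obtain ⟨α', hα', hαm'⟩ := Finset.exists_min_image _ s hXne
    obtain ⟨β', hβ', hβm'⟩ := Finset.exists_min_image _ t hYne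
    have hsX : ∑ γ ∈ residues d X, s γ = k := by
      rw [← hXc]
      exact (Finset.card_eq_sum_card_fiberwise (f := fun x : ℤ => (x : ZMod d))
        (fun x hx => mem_residues.2 ⟨x, hx, rfl⟩)).symm
    have hsY : ∑ γ ∈ residues d Y, t γ = k := by
      rw [← hYc]
      exact (Finset.card_eq_sum_card_fiberwise (f := fun x : ℤ => (x : ZMod d))
        (fun x hx => mem_residues.2 ⟨x, hx, rfl⟩)).symm
    have hsp : 0 < s α' := by
      obtain ⟨x, hx, hx'⟩ := mem_residues.1 hα'
      exact Finset.card_pos.2 ⟨x, Finset.mem_filter.2 ⟨hx, hx'⟩⟩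
    have htp : 0 < t β' := by
      obtain ⟨x, hx, hx'⟩ := mem_residues.1 hβ'
      exact Finset.card_pos.2 ⟨x, Finset.mem_filter.2 ⟨hx, hx'⟩⟩
    have hrn : 2 * m - 1 ≤ (residues d (X + Y)).card := by
      have : h * (2 * m) ≤ h * ((residues d (X + Y)).card + 1) := by
        rw [hqm] at hn
        have e : m + m = 2 * m := by ring
        rw [e] at hn
        have := hn.trans (Nat.add_le_add_right hrC h)
        linarith
      have := Nat.le_of_mul_le_mul_left this hh
      omega
    have b1 := card_add_ge_of_classes (d := d) (X := X) (Y := Y) (w := s α' + t β' - 1)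
      (r := m - 1) hα (fun β hβ γ hγ => by
        have := hαm' β hβ
        have := hβm' γ hγ
        simp only [hs, ht] at *
        omega) (by omega)
    have b2 := card_add_ge_of_classes (d := d) (X := Y) (Y := X) (w := s α' + t β' - 1)
      (r := m - 1) hβ (fun β hβ γ hγ => by
        have := hαm' γ hγ
        have := hβm' β hβ
        simp only [hs, ht] at *
        omega) (by rw [add_comm Y X]; omega)
    have m1 := sum_le_mul_max_add_min (f := s) hα' hαm
    have m2 := sum_le_mul_max_add_min (f := t) hβ' hβm
    have m3 := sum_le_mul_add_min (f := s) (h := h) (i₀ := 0) hα'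
      (fun j _ hj => (card_fiber_le hd hdh hX j).2 hj) (card_fiber_le hd hdh hX 0).1
    have m4 := sum_le_mul_add_min (f := t) (h := h) (i₀ := 0) hβ'
      (fun j _ hj => (card_fiber_le hd hdh hY j).2 hj) (card_fiber_le hd hdh hY 0).1
    rw [hsX] at m1 m3
    rw [hsY] at m2 m4
    rw [add_comm Y X, hXc] at b2
    rw [hYc] at b1
    rw [← hq, hqm] at m1 m3 b2
    rw [← hm] at m2 m4 b1
    have hS : s α ≤ h + 1 := (card_fiber_le hd hdh hX α).1
    have hT : t β ≤ h + 1 := (card_fiber_le hd hdh hY β).1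
    have hfin := balanced_sumset_arith (m := m) (k := k) (h := h) (S := s α) (T := t β) (s := s α')
      (t := t β') (C := (X + Y).card) (by exact_mod_cast hm2)
      (by rw [hqm] at hn; zify at hn hc; linarith)
      (by exact_mod_cast hS) (by exact_mod_cast hT)
      (by exact_mod_cast m1) (by exact_mod_cast m2) (by exact_mod_cast m3) (by exact_mod_cast m4)
      (by
        have : ((s α' + t β' - 1 : ℕ) : ℤ) = s α' + t β' - 1 := by omega
        rw [← this]
        have e : ((m - 1 : ℕ) : ℤ) = m - 1 := by omega
        rw [← e]
        exact_mod_cast b1)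
      (by
        have : ((s α' + t β' - 1 : ℕ) : ℤ) = s α' + t β' - 1 := by omega
        rw [← this]
        have e : ((m - 1 : ℕ) : ℤ) = m - 1 := by omega
        rw [← e]
        exact_mod_cast b2)
    omega

lemma card_add_three_le {α : Type*} [DecidableEq α] {T S₁ S₂ S₃ : Finset α} (h₁ : S₁ ⊆ T)
    (h₂ : S₂ ⊆ T) (h₃ : S₃ ⊆ T) (h₁₂ : Disjoint S₁ S₂) (h₁₃ : Disjoint S₁ S₃)
    (h₂₃ : Disjoint S₂ S₃) : S₁.card + S₂.card + S₃.card ≤ T.card := by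
  rw [← Finset.card_union_of_disjoint h₁₂,
    ← Finset.card_union_of_disjoint (Finset.disjoint_union_left.2 ⟨h₁₃, h₂₃⟩)]
  exact Finset.card_le_card (Finset.union_subset (Finset.union_subset h₁ h₂) h₃)

lemma exists_add_residue {d : ℕ} (hd : 0 < d) {X Y : Finset ℤ}
    (h : d < (residues d X).card + (residues d Y).card) (z : ℤ) :
    ∃ a ∈ X, ∃ b ∈ Y, (d : ℤ) ∣ a + b - z := by
  have : NeZero d := ⟨hd.ne'⟩
  have h1 : ((residues d Y).image (fun r => (z : ZMod d) - r)).card = (residues d Y).card :=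
    Finset.card_image_of_injective _ sub_right_injective
  have h2 : (Finset.univ : Finset (ZMod d)).card = d := by rw [Finset.card_univ, ZMod.card]
  obtain ⟨r, hr⟩ := Finset.inter_nonempty_of_card_lt_card_add_card (Finset.subset_univ _)
    (Finset.subset_univ _) (by rw [h2, h1]; exact h :
      (Finset.univ : Finset (ZMod d)).card < (residues d X).card +
        ((residues d Y).image (fun r => (z : ZMod d) - r)).card)
  obtain ⟨hr1, hr2⟩ := Finset.mem_inter.1 hr
  obtain ⟨a, ha, rfl⟩ := mem_residues.1 hr1
  obtain ⟨s, hs, hsa⟩ := Finset.mem_image.1 hr2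
  obtain ⟨b, hb, rfl⟩ := mem_residues.1 hs
  refine ⟨a, ha, b, hb, ?_⟩
  rw [← ZMod.intCast_zmod_eq_zero_iff_dvd]
  push_cast
  rw [← hsa]
  ring

/-- Two missing sums, one below `x` and one above `y`, are either close or far apart. -/
lemma missing_sums_dist {x y : ℤ} (hxy : x ≤ y) {X Y : Finset ℤ}
    (hX : ∀ t ∈ X, 0 ≤ t ∧ t ≤ x) (hY : ∀ t ∈ Y, 0 ≤ t ∧ t ≤ y)
    (h1 : y + 3 ≤ X.card + Y.card) {z z' : ℤ} (hz : z < x) (hz' : y < z')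
    (hzC : z ∉ X + Y) (hzC' : z' ∉ X + Y) (hd : x ≤ z' - z) :
    (X.card : ℤ) + Y.card ≤ z' - z := by
  by_contra hcon
  obtain ⟨d, hdz⟩ := Int.eq_ofNat_of_zero_le (show 0 ≤ z' - z by omega)
  have hd0 : 0 < d := by omega
  have hrX : X.card ≤ (residues d X).card + (if x = d then 1 else 0) := by
    split_ifs with hxd
    · exact card_le_card_residues_add_one (b := d) (X := X) (a := 0)
        (fun t ht => by have := hX t ht; omega)
    · rw [card_residues_eq (b := d) (X := X) (a := 0)
        (fun t ht => by have := hX t ht; omega)]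
      omega
  have key : d < (residues d X).card + (residues d Y).card := by
    by_cases hdy : (d : ℤ) ≤ y
    · have e1 : (residues d (Y.filter (· < (d : ℤ)))).card = (Y.filter (· < (d : ℤ))).card :=
        card_residues_eq (a := 0) (fun t ht => by
          have := hY t (Finset.mem_filter.1 ht).1
          have := (Finset.mem_filter.1 ht).2
          omega)
      have e2 := Finset.card_le_card (residues_mono (d := d) (Finset.filter_subset (· < (d : ℤ)) Y))
      have e3 := Finset.card_filter_add_card_filter_not (s := Y) (· < (d : ℤ))
      have e4 : (Y.filter (fun t => ¬ t < (d : ℤ))).card ≤ (Finset.Icc (d : ℤ) y).card :=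
        Finset.card_le_card fun t ht => by
          have := hY t (Finset.mem_filter.1 ht).1
          have := (Finset.mem_filter.1 ht).2
          rw [Finset.mem_Icc]
          omega
      rw [Int.card_Icc] at e4
      split_ifs at hrX <;> omega
    · rw [card_residues_eq (b := d) (X := Y) (a := 0)
        (fun t ht => by have := hY t ht; omega)]
      split_ifs at hrX <;> omega
  obtain ⟨a, ha, b, hb, k, hk⟩ := exists_add_residue hd0 key z
  have ha' := hX a ha
  have hb' := hY b hb
  have hk0 : -1 < k := by
    by_contra h
    have : (d : ℤ) * k ≤ d * (-1) := mul_le_mul_of_nonneg_left (by omega) (by omega)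
    omega
  have hk2 : k < 2 := by
    by_contra h
    have : (d : ℤ) * 2 ≤ d * k := mul_le_mul_of_nonneg_left (by omega) (by omega)
    omega
  have hk3 : k = 0 ∨ k = 1 := by omega
  rcases hk3 with rfl | rfl
  · exact hzC (by rw [show z = a + b by omega]; exact Finset.add_mem_add ha hb)
  · exact hzC' (by rw [show z' = a + b by omega]; exact Finset.add_mem_add ha hb)

lemma mem_add_of_mem_Icc {x y : ℤ} {X Y : Finset ℤ}
    (hX : ∀ t ∈ X, 0 ≤ t ∧ t ≤ x) (hY : ∀ t ∈ Y, 0 ≤ t ∧ t ≤ y)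
    (hy : 0 ≤ y) (h1 : y + 3 ≤ X.card + Y.card) {z : ℤ} (hz : x ≤ z) (hz' : z ≤ y) : z ∈ X + Y := by
  have e1 : (X.image (fun t => z - t)).card = X.card :=
    Finset.card_image_of_injective _ sub_right_injective
  obtain ⟨r, hr⟩ := Finset.inter_nonempty_of_card_lt_card_add_card (s := Finset.Icc 0 y)
    (t := X.image (fun t => z - t)) (u := Y)
    (fun t ht => by
      obtain ⟨a, ha, rfl⟩ := Finset.mem_image.1 ht
      have := hX a ha
      rw [Finset.mem_Icc]; omega)
    (fun t ht => Finset.mem_Icc.2 (hY t ht)) (by rw [e1, Int.card_Icc]; omega)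
  obtain ⟨hr1, hr2⟩ := Finset.mem_inter.1 hr
  obtain ⟨a, ha, rfl⟩ := Finset.mem_image.1 hr1
  rw [show z = a + (z - a) by ring]
  exact Finset.add_mem_add ha hr2

lemma exists_Icc_subset_add {x y : ℤ} (hxy : x ≤ y) {X Y : Finset ℤ}
    (hX : ∀ t ∈ X, 0 ≤ t ∧ t ≤ x) (hY : ∀ t ∈ Y, 0 ≤ t ∧ t ≤ y)
    (hX0 : 0 ∈ X) (hXx : x ∈ X) (hY0 : 0 ∈ Y) (hYy : y ∈ Y) (hx : 1 ≤ x)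
    (h1 : y + 3 ≤ X.card + Y.card)
    (hC : (X + Y).card + 4 ≤ X.card + Y.card + min X.card Y.card) :
    ∃ c : ℤ, ∀ j : ℤ, 0 ≤ j → j + 1 < X.card + Y.card → c + j ∈ X + Y := by
  set L := (Finset.Icc 0 (x - 1)).filter (· ∉ X + Y) with hL
  set H := (Finset.Icc (y + 1) (x + y)).filter (· ∉ X + Y) with hH
  have mL : ∀ z, z ∈ L ↔ (0 ≤ z ∧ z ≤ x - 1) ∧ z ∉ X + Y := by simp [hL]
  have mH : ∀ z, z ∈ H ↔ (y + 1 ≤ z ∧ z ≤ x + y) ∧ z ∉ X + Y := by simp [hH]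
  have hCI : ∀ z ∈ X + Y, 0 ≤ z ∧ z ≤ x + y := by
    intro z hz
    obtain ⟨a, ha, b, hb, rfl⟩ := Finset.mem_add.1 hz
    have := hX a ha
    have := hY b hb
    omega
  have hgood : ∀ z, x ≤ z → z ≤ y → z ∈ X + Y := fun z => mem_add_of_mem_Icc hX hY (by omega) h1
  have far : ∀ z z', z < x → y < z' → z ∉ X + Y → z' ∉ X + Y → x ≤ z' - z →
      (X.card : ℤ) + Y.card ≤ z' - z := fun z z' => missing_sums_dist hxy hX hY h1
  by_cases hov : ∃ z ∈ L, ∃ z' ∈ H, z' - z < x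
  swap
  · push Not at hov
    obtain ⟨zl, hzl, hzlm⟩ := Finset.exists_max_image (insert (-1) L) id ⟨-1, by simp⟩
    obtain ⟨zh, hzh, hzhm⟩ := Finset.exists_min_image (insert (x + y + 1) H) id ⟨x + y + 1, by simp⟩
    have pl : zl < x ∧ zl ∉ X + Y ∧ -1 ≤ zl := by
      rcases Finset.mem_insert.1 hzl with rfl | h
      · exact ⟨by omega, fun h => by have := hCI _ h; omega, le_rfl⟩
      · have := (mL zl).1 h
        exact ⟨by omega, this.2, by omega⟩
    have ph : y < zh ∧ zh ∉ X + Y ∧ zh ≤ x + y + 1 := by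
      rcases Finset.mem_insert.1 hzh with rfl | h
      · exact ⟨by omega, fun h => by have := hCI _ h; omega, le_rfl⟩
      · have := (mH zh).1 h
        exact ⟨by omega, this.2, by omega⟩
    have hdist : x ≤ zh - zl := by
      rcases Finset.mem_insert.1 hzl with h | h
      · omega
      · rcases Finset.mem_insert.1 hzh with h' | h'
        · omega
        · exact hov zl h zh h'
    have := far zl zh pl.1 ph.1 pl.2.1 ph.2.1 hdist
    refine ⟨zl + 1, fun j hj0 hj1 => ?_⟩
    by_contra hbad
    rcases lt_or_ge (zl + 1 + j) x with h | h
    · have := hzlm (zl + 1 + j) (Finset.mem_insert_of_mem ((mL _).2 ⟨by omega, hbad⟩))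
      simp only [id] at this
      omega
    · rcases le_or_gt (zl + 1 + j) y with h' | h'
      · exact hbad (hgood _ h h')
      · have := hzhm (zl + 1 + j) (Finset.mem_insert_of_mem ((mH _).2 ⟨by omega, hbad⟩))
        simp only [id] at this
        omega
  · exfalso
    obtain ⟨za, hza, hzam⟩ := Finset.exists_min_image (L.filter (fun z => ∃ z' ∈ H, z' - z < x)) id
      (by obtain ⟨z, hz, h⟩ := hov; exact ⟨z, Finset.mem_filter.2 ⟨hz, h⟩⟩)
    obtain ⟨hzaL, hza'⟩ := Finset.mem_filter.1 hza
    obtain ⟨zb, hzb, hzbm⟩ := Finset.exists_max_image (H.filter (fun z' => z' - za < x)) id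
      (by obtain ⟨z, hz, h⟩ := hza'; exact ⟨z, Finset.mem_filter.2 ⟨hz, h⟩⟩)
    obtain ⟨hzbH, hzab⟩ := Finset.mem_filter.1 hzb
    obtain ⟨ha, haC⟩ := (mL za).1 hzaL
    obtain ⟨hb, hbC⟩ := (mH zb).1 hzbH
    -- missing sums beyond the extreme overlapping pair are far away
    have f1 : ∀ z ∈ L, z < za → ∀ z' ∈ H, (X.card : ℤ) + Y.card ≤ z' - z := by
      intro z hz hlt z' hz'
      obtain ⟨q, qC⟩ := (mL z).1 hz
      obtain ⟨q', qC'⟩ := (mH z').1 hz'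
      refine far z z' (by omega) (by omega) qC qC' ?_
      by_contra hcon
      have := hzam z (Finset.mem_filter.2 ⟨hz, z', hz', by omega⟩)
      simp only [id] at this
      omega
    have f2 : ∀ z' ∈ H, zb < z' → (X.card : ℤ) + Y.card ≤ z' - za := by
      intro z' hz' hlt
      obtain ⟨q', qC'⟩ := (mH z').1 hz'
      refine far za z' (by omega) (by omega) haC qC' ?_
      by_contra hcon
      have := hzbm z' (Finset.mem_filter.2 ⟨hz', by omega⟩)
      simp only [id] at this
      omega
    have f3 : ∀ z ∈ L, ∀ z' ∈ H, z' - z ≠ x ∧ z' - z ≠ y := by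
      intro z hz z' hz'
      obtain ⟨q, qC⟩ := (mL z).1 hz
      obtain ⟨q', qC'⟩ := (mH z').1 hz'
      constructor <;> intro h
      · have := far z z' (by omega) (by omega) qC qC' (by omega)
        omega
      · have := far z z' (by omega) (by omega) qC qC' (by omega)
        omega
    have notX : ∀ z b : ℤ, b ∈ Y → z ∉ X + Y → z - b ∉ X := fun z b hb hz h =>
      hz (by rw [show z = z - b + b by ring]; exact Finset.add_mem_add h hb)
    have notY : ∀ z a : ℤ, a ∈ X → z ∉ X + Y → z - a ∉ Y := fun z a ha hz h =>
      hz (by rw [show z = a + (z - a) by ring]; exact Finset.add_mem_add ha h)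
    have hXh : ((Finset.Icc 0 x \ X).card : ℤ) = x + 1 - X.card := by
      have := Finset.card_sdiff_add_card_eq_card (s := X) (t := Finset.Icc 0 x)
        (fun t ht => Finset.mem_Icc.2 (hX t ht))
      rw [Int.card_Icc] at this
      omega
    have hYh : ((Finset.Icc 0 y \ Y).card : ℤ) = y + 1 - Y.card := by
      have := Finset.card_sdiff_add_card_eq_card (s := Y) (t := Finset.Icc 0 y)
        (fun t ht => Finset.mem_Icc.2 (hY t ht))
      rw [Int.card_Icc] at this
      omega
    have hCc : ((X + Y).card : ℤ) + L.card + H.card = x + y + 1 := by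
      have e1 := Finset.card_sdiff_add_card_eq_card (s := X + Y) (t := Finset.Icc 0 (x + y))
        (fun t ht => Finset.mem_Icc.2 (hCI t ht))
      have e2 : Finset.Icc 0 (x + y) \ (X + Y) = L ∪ H := by
        ext z
        rw [Finset.mem_sdiff, Finset.mem_union, mL, mH, Finset.mem_Icc]
        constructor
        · rintro ⟨q, qC⟩
          by_cases h : z < x
          · exact Or.inl ⟨by omega, qC⟩
          · by_cases h' : z ≤ y
            · exact absurd (hgood z (by omega) h') qC
            · exact Or.inr ⟨by omega, qC⟩
        · rintro (⟨q, qC⟩ | ⟨q, qC⟩)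
          · exact ⟨by omega, qC⟩
          · exact ⟨by omega, qC⟩
      have e3 : Disjoint L H := by
        rw [Finset.disjoint_left]
        intro z h h'
        have := ((mL z).1 h).1
        have := ((mH z).1 h').1
        omega
      rw [e2, Finset.card_union_of_disjoint e3, Int.card_Icc] at e1
      omega
    have split : ∀ (S : Finset ℤ) (w : ℤ), w ∈ S →
        S.card = (S.filter (· < w)).card + (S.filter (w < ·)).card + 1 := by
      intro S w hw
      have e1 := Finset.card_filter_add_card_filter_not (s := S) (· < w)
      have e2 : S.filter (fun z => ¬ z < w) = insert w (S.filter (w < ·)) := by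
        ext z
        simp only [Finset.mem_filter, Finset.mem_insert]
        constructor
        · rintro ⟨h, h'⟩
          rcases eq_or_lt_of_le (not_lt.1 h') with rfl | h''
          · exact Or.inl rfl
          · exact Or.inr ⟨h, h''⟩
        · rintro (rfl | ⟨h, h'⟩)
          · exact ⟨hw, lt_irrefl _⟩
          · exact ⟨h, by omega⟩
      rw [e2, Finset.card_insert_of_notMem (by simp)] at e1
      omega
    have sL := split L za hzaL
    have sH := split H zb hzbH
    have inj : ∀ (S : Finset ℤ) (w : ℤ), (S.image (fun t => w - t)).card = S.card :=
      fun S w => Finset.card_image_of_injective _ sub_right_injective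
    have inj' : ∀ (S : Finset ℤ) (w : ℤ), (S.image (fun t => t - w)).card = S.card :=
      fun S w => Finset.card_image_of_injective _ sub_left_injective
    -- generic counting of holes, below and above
    have lowHoles : ∀ (P Q : Finset ℤ) (u v : ℤ), 0 ∈ Q → v ∈ Q → za ≤ u → za < x →
        (∀ t ∈ P, 0 ≤ t) → x ≤ u → u ≤ y → x ≤ v → v ≤ y → u + v = x + y →
        (∀ z b : ℤ, b ∈ Q → z ∉ X + Y → z - b ∉ P) → (∀ t ∈ Q, 0 ≤ t) →
        (Q.filter (· ≤ za)).card + (L.filter (za < ·)).card + (H.filter (zb < ·)).card ≤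
          (Finset.Icc 0 u \ P).card := by
      intro P Q u v hQ0 hQv _ _ _ hxu huy hxv hvy huv hnot hQp
      rw [← inj (Q.filter (· ≤ za)) za, ← inj' (H.filter (zb < ·)) v]
      apply card_add_three_le
      · intro t ht
        obtain ⟨b, hb, rfl⟩ := Finset.mem_image.1 ht
        obtain ⟨hb, hb'⟩ := Finset.mem_filter.1 hb
        have := hQp b hb
        exact Finset.mem_sdiff.2 ⟨Finset.mem_Icc.2 (by omega), hnot _ _ hb haC⟩
      · intro t ht
        obtain ⟨ht, ht'⟩ := Finset.mem_filter.1 ht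
        obtain ⟨q, qC⟩ := (mL t).1 ht
        refine Finset.mem_sdiff.2 ⟨Finset.mem_Icc.2 (by omega), ?_⟩
        simpa using hnot t 0 hQ0 qC
      · intro t ht
        obtain ⟨z, hz, rfl⟩ := Finset.mem_image.1 ht
        obtain ⟨hz, hz'⟩ := Finset.mem_filter.1 hz
        obtain ⟨q, qC⟩ := (mH z).1 hz
        exact Finset.mem_sdiff.2 ⟨Finset.mem_Icc.2 (by omega), hnot _ _ hQv qC⟩
      · rw [Finset.disjoint_left]
        intro t ht ht'
        obtain ⟨b, hb, rfl⟩ := Finset.mem_image.1 ht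
        have := hQp b (Finset.mem_filter.1 hb).1
        have := (Finset.mem_filter.1 ht').2
        omega
      · rw [Finset.disjoint_left]
        intro t ht ht'
        obtain ⟨b, hb, rfl⟩ := Finset.mem_image.1 ht
        obtain ⟨z, hz, hzt⟩ := Finset.mem_image.1 ht'
        obtain ⟨hz, hz'⟩ := Finset.mem_filter.1 hz
        have := hQp b (Finset.mem_filter.1 hb).1
        have := f2 z hz hz'
        omega
      · rw [Finset.disjoint_left]
        intro t ht ht'
        obtain ⟨z, hz, rfl⟩ := Finset.mem_image.1 ht'
        obtain ⟨hz, hz'⟩ := Finset.mem_filter.1 hz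
        obtain ⟨ht, -⟩ := Finset.mem_filter.1 ht
        have h1 := far (z - v) z (by have := ((mL _).1 ht).1; omega)
          (by have := ((mH _).1 hz).1; omega)
          ((mL _).1 ht).2 ((mH _).1 hz).2 (by omega)
        omega
    have highHoles : ∀ (P Q : Finset ℤ) (u v : ℤ), 0 ∈ Q → v ∈ Q →
        x ≤ u → u ≤ y → x ≤ v → v ≤ y → u + v = x + y →
        (∀ z b : ℤ, b ∈ Q → z ∉ X + Y → z - b ∉ P) → (∀ t ∈ Q, t ≤ v) →
        (Q.filter (zb - u ≤ ·)).card + (L.filter (· < za)).card + (H.filter (· < zb)).card ≤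
          (Finset.Icc 0 u \ P).card := by
      intro P Q u v hQ0 hQv hxu huy hxv hvy huv hnot hQp
      rw [← inj (Q.filter (zb - u ≤ ·)) zb, ← inj' (H.filter (· < zb)) v]
      apply card_add_three_le
      · intro t ht
        obtain ⟨b, hb, rfl⟩ := Finset.mem_image.1 ht
        obtain ⟨hb, hb'⟩ := Finset.mem_filter.1 hb
        have := hQp b hb
        exact Finset.mem_sdiff.2 ⟨Finset.mem_Icc.2 (by omega), hnot _ _ hb hbC⟩
      · intro t ht
        obtain ⟨ht, ht'⟩ := Finset.mem_filter.1 ht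
        obtain ⟨q, qC⟩ := (mL t).1 ht
        refine Finset.mem_sdiff.2 ⟨Finset.mem_Icc.2 (by omega), ?_⟩
        simpa using hnot t 0 hQ0 qC
      · intro t ht
        obtain ⟨z, hz, rfl⟩ := Finset.mem_image.1 ht
        obtain ⟨hz, hz'⟩ := Finset.mem_filter.1 hz
        obtain ⟨q, qC⟩ := (mH z).1 hz
        exact Finset.mem_sdiff.2 ⟨Finset.mem_Icc.2 (by omega), hnot _ _ hQv qC⟩
      · rw [Finset.disjoint_left]
        intro t ht ht'
        obtain ⟨b, hb, rfl⟩ := Finset.mem_image.1 ht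
        have := hQp b (Finset.mem_filter.1 hb).1
        obtain ⟨ht1, ht2⟩ := Finset.mem_filter.1 ht'
        have := f1 _ ht1 ht2 zb hzbH
        omega
      · rw [Finset.disjoint_left]
        intro t ht ht'
        obtain ⟨b, hb, rfl⟩ := Finset.mem_image.1 ht
        obtain ⟨z, hz, hzt⟩ := Finset.mem_image.1 ht'
        obtain ⟨hz, hz'⟩ := Finset.mem_filter.1 hz
        have := hQp b (Finset.mem_filter.1 hb).1
        omega
      · rw [Finset.disjoint_left]
        intro t ht ht'
        obtain ⟨z, hz, rfl⟩ := Finset.mem_image.1 ht'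
        obtain ⟨hz, hz'⟩ := Finset.mem_filter.1 hz
        obtain ⟨ht, -⟩ := Finset.mem_filter.1 ht
        have h1 := far (z - v) z (by have := ((mL _).1 ht).1; omega)
          (by have := ((mH _).1 hz).1; omega)
          ((mL _).1 ht).2 ((mH _).1 hz).2 (by omega)
        omega
    have i1 := lowHoles X Y x y hY0 hYy (by omega) (by omega) (fun t ht => (hX t ht).1) le_rfl hxy
      hxy le_rfl rfl notX (fun t ht => (hY t ht).1)
    have i2 := highHoles Y X y x hX0 hXx hxy le_rfl le_rfl hxy (add_comm y x) notY
      (fun t ht => (hX t ht).2)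
    have i3 := lowHoles Y X y x hX0 hXx (by omega) (by omega) (fun t ht => (hY t ht).1) hxy le_rfl
      le_rfl hxy (add_comm y x) notY (fun t ht => (hX t ht).1)
    have i4 := highHoles X Y x y hY0 hYy le_rfl hxy hxy le_rfl rfl notX
      (fun t ht => (hY t ht).2)
    have cover : ∀ (S : Finset ℤ) (w : ℤ), w ≤ za + 1 →
        S.card ≤ (S.filter (· ≤ za)).card + (S.filter (w ≤ ·)).card := by
      intro S w hw
      rw [← Finset.card_filter_add_card_filter_not (s := S) (· ≤ za)]
      gcongr
      intro h
      omega
    have c1 := cover X (zb - y) (by omega)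
    have c2 := cover Y (zb - x) (by omega)
    have hm1 := min_le_left X.card Y.card
    have hm2 := min_le_right X.card Y.card
    omega

/-- `X` and `Y` lie in short progressions with the same difference, and `X + Y` contains a long
progression with that difference. -/
def ProgressionStructure (k : ℕ) (X Y : Finset ℤ) : Prop :=
  ∃ d a b c : ℤ, 0 < d ∧
    (∀ x ∈ X, ∃ j : ℤ, 0 ≤ j ∧ j + 4 ≤ X.card + k ∧ x = a + j * d) ∧
    (∀ y ∈ Y, ∃ j : ℤ, 0 ≤ j ∧ j + 4 ≤ Y.card + k ∧ y = b + j * d) ∧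
    (∀ j : ℤ, 0 ≤ j → j + 1 < X.card + Y.card → c + j * d ∈ X + Y)

lemma ProgressionStructure.symm {k : ℕ} {X Y : Finset ℤ} (h : ProgressionStructure k X Y) :
    ProgressionStructure k Y X := by
  obtain ⟨d, a, b, c, hd, hX, hY, hC⟩ := h
  refine ⟨d, b, a, c, hd, hY, hX, fun j h0 h1 => ?_⟩
  rw [add_comm Y X]
  exact hC j h0 (by omega)

/-- The image of a set of integers under `t ↦ u + d * t`. -/
def affineImage (u d : ℤ) (X : Finset ℤ) : Finset ℤ := X.image (fun t => u + d * t)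

lemma mem_affineImage {u d : ℤ} {X : Finset ℤ} {z : ℤ} :
    z ∈ affineImage u d X ↔ ∃ t ∈ X, u + d * t = z := by simp [affineImage]

lemma card_affineImage {u d : ℤ} (hd : 0 < d) (X : Finset ℤ) :
    (affineImage u d X).card = X.card := by
  apply Finset.card_image_of_injective
  intro s t h
  have : d * s = d * t := by simpa using h
  exact mul_left_cancel₀ hd.ne' this

lemma affineImage_add (u v d : ℤ) (X Y : Finset ℤ) :
    affineImage u d X + affineImage v d Y = affineImage (u + v) d (X + Y) := by
  ext z
  simp only [mem_affineImage, Finset.mem_add]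
  constructor
  · rintro ⟨_, ⟨s, hs, rfl⟩, _, ⟨t, ht, rfl⟩, rfl⟩
    exact ⟨_, ⟨s, hs, t, ht, rfl⟩, by ring⟩
  · rintro ⟨_, ⟨s, hs, t, ht, rfl⟩, rfl⟩
    exact ⟨_, ⟨s, hs, rfl⟩, _, ⟨t, ht, rfl⟩, by ring⟩

lemma ProgressionStructure.affineImage {k : ℕ} {X Y : Finset ℤ} {d : ℤ} (hd : 0 < d) (u v : ℤ)
    (h : ProgressionStructure k X Y) :
    ProgressionStructure k (affineImage u d X) (affineImage v d Y) := by
  obtain ⟨e, a, b, c, he, hX, hY, hC⟩ := h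
  refine ⟨d * e, u + d * a, v + d * b, (u + v) + d * c, mul_pos hd he, ?_, ?_, ?_⟩
  · intro x hx
    obtain ⟨t, ht, rfl⟩ := mem_affineImage.1 hx
    obtain ⟨j, h0, h1, rfl⟩ := hX t ht
    exact ⟨j, h0, by rwa [card_affineImage hd], by ring⟩
  · intro x hx
    obtain ⟨t, ht, rfl⟩ := mem_affineImage.1 hx
    obtain ⟨j, h0, h1, rfl⟩ := hY t ht
    exact ⟨j, h0, by rwa [card_affineImage hd], by ring⟩
  · intro j h0 h1
    rw [card_affineImage hd, card_affineImage hd] at h1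
    rw [affineImage_add]
    exact mem_affineImage.2 ⟨_, hC j h0 h1, by ring⟩

lemma exists_eq_affineImage {u d : ℤ} {X : Finset ℤ} (h : ∀ x ∈ X, d ∣ x - u) :
    ∃ X', X = affineImage u d X' := by
  refine ⟨X.image (fun x => (x - u) / d), ?_⟩
  ext z
  simp only [mem_affineImage, Finset.mem_image]
  constructor
  · intro hz
    exact ⟨_, ⟨z, hz, rfl⟩, by rw [Int.mul_ediv_cancel' (h z hz)]; ring⟩
  · rintro ⟨_, ⟨x, hx, rfl⟩, rfl⟩
    rw [Int.mul_ediv_cancel' (h x hx)]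
    simpa using hx

lemma progressionStructure_of_diam_le {k : ℕ} {X Y : Finset ℤ} {x y : ℤ}
    (hX : ∀ t ∈ X, 0 ≤ t ∧ t ≤ x) (hY : ∀ t ∈ Y, 0 ≤ t ∧ t ≤ y)
    (hX0 : 0 ∈ X) (hXx : x ∈ X) (hY0 : 0 ∈ Y) (hYy : y ∈ Y) (hk : 2 ≤ k)
    (hkX : k ≤ X.card) (hkY : k ≤ Y.card)
    (hx : x + 4 ≤ X.card + k) (hy : y + 4 ≤ Y.card + k)
    (hC : (X + Y).card + 4 ≤ X.card + Y.card + k) : ProgressionStructure k X Y := by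
  have pos : ∀ (Z : Finset ℤ) (z : ℤ), (∀ t ∈ Z, 0 ≤ t ∧ t ≤ z) → k ≤ Z.card → 1 ≤ z := by
    intro Z z hZ hZk
    have := Finset.card_le_card (fun t ht => Finset.mem_Icc.2 (hZ t ht) : Z ⊆ Finset.Icc 0 z)
    rw [Int.card_Icc] at this
    omega
  have hx1 := pos X x hX hkX
  have hy1 := pos Y y hY hkY
  have hmin : k ≤ min X.card Y.card := le_min hkX hkY
  have run : ∃ c : ℤ, ∀ j : ℤ, 0 ≤ j → j + 1 < X.card + Y.card → c + j ∈ X + Y := by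
    rcases le_total x y with hxy | hxy
    · exact exists_Icc_subset_add hxy hX hY hX0 hXx hY0 hYy hx1 (by omega) (by omega)
    · rw [add_comm (X.card : ℤ), add_comm X]
      rw [add_comm X] at hC
      rw [min_comm] at hmin
      exact exists_Icc_subset_add hxy hY hX hY0 hYy hX0 hXx hy1 (by omega) (by omega)
  obtain ⟨c, hc⟩ := run
  refine ⟨1, 0, 0, c, one_pos, fun t ht => ⟨t, (hX t ht).1, by have := hX t ht; omega, by ring⟩,
    fun t ht => ⟨t, (hY t ht).1, by have := hY t ht; omega, by ring⟩, fun j h0 h1 => ?_⟩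
  rw [mul_one]
  exact hc j h0 h1

lemma progressionStructure_of_card_eq_of_mem {k : ℕ} (hk : 3 ≤ k) (b : ℕ) :
    ∀ (X Y : Finset ℤ) (x : ℤ),
    X.card = k → Y.card = k → (∀ t ∈ X, 0 ≤ t ∧ t ≤ x) → (∀ t ∈ Y, 0 ≤ t ∧ t ≤ b) →
    x ≤ b → 0 ∈ X → x ∈ X → 0 ∈ Y → (b : ℤ) ∈ Y → (X + Y).card + 4 ≤ 3 * k →
    ProgressionStructure k X Y := by
  induction b using Nat.strong_induction_on with
  | _ b ih =>
    intro X Y x hXc hYc hX hY hxb hX0 hXx hY0 hYb hC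
    have hb : 0 < b := by
      have := Finset.card_le_card (fun t ht => Finset.mem_Icc.2 (hY t ht) :
        Y ⊆ Finset.Icc 0 (b : ℤ))
      rw [Int.card_Icc] at this
      omega
    rcases diam_le_or_dvd hb hXc hYc hX0 hY0 hYb (fun t ht => by have := hX t ht; omega) hY hC
      with h | ⟨d, hd, hdX, hdY⟩
    · exact progressionStructure_of_diam_le hX hY hX0 hXx hY0 hYb (by omega) hXc.ge hYc.ge
        (by omega) (by omega) (by omega)
    · have hd0 : (0 : ℤ) < d := by omega
      obtain ⟨X', rfl⟩ := exists_eq_affineImage (u := 0) (d := d) (X := X) (by simpa using hdX)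
      obtain ⟨Y', rfl⟩ := exists_eq_affineImage (u := 0) (d := d) (X := Y) (by simpa using hdY)
      obtain ⟨x', rfl⟩ := hdX x hXx
      obtain ⟨b', hb'⟩ := hdY b hYb
      have hb'0 : 0 < b' := by
        by_contra hcon
        have : (d : ℤ) * b' ≤ 0 := mul_nonpos_of_nonneg_of_nonpos hd0.le (by omega)
        omega
      obtain ⟨n, rfl⟩ := Int.eq_ofNat_of_zero_le hb'0.le
      have mem : ∀ (Z : Finset ℤ) (t : ℤ), (d : ℤ) * t ∈ affineImage 0 d Z → t ∈ Z := by
        intro Z t ht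
        obtain ⟨s, hs, hst⟩ := mem_affineImage.1 ht
        rw [zero_add] at hst
        rwa [← mul_left_cancel₀ hd0.ne' hst]
      rw [affineImage_add, card_affineImage hd0] at hC
      rw [card_affineImage hd0] at hXc hYc
      refine ProgressionStructure.affineImage hd0 0 0 (ih n ?_ X' Y' x' hXc hYc ?_ ?_ ?_
        (mem X' 0 (by simpa using hX0)) (mem X' x' hXx) (mem Y' 0 (by simpa using hY0))
        (mem Y' n (hb' ▸ hYb)) hC)
      · have : (2 : ℤ) * n ≤ d * n := mul_le_mul_of_nonneg_right (by omega) (by omega)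
        omega
      · intro t ht
        have := hX (0 + d * t) (mem_affineImage.2 ⟨t, ht, rfl⟩)
        rw [zero_add] at this
        exact ⟨nonneg_of_mul_nonneg_right this.1 hd0, le_of_mul_le_mul_left this.2 hd0⟩
      · intro t ht
        have := hY (0 + d * t) (mem_affineImage.2 ⟨t, ht, rfl⟩)
        rw [zero_add, hb'] at this
        exact ⟨nonneg_of_mul_nonneg_right this.1 hd0, le_of_mul_le_mul_left this.2 hd0⟩
      · rw [hb'] at hxb
        exact le_of_mul_le_mul_left hxb hd0

/-- Any finite nonempty set in a residue class is an affine image of a set starting at `0`. -/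
lemma exists_normalized {d : ℤ} (hd : 0 < d) {X : Finset ℤ} (hX : X.Nonempty)
    (h : ∀ x ∈ X, ∀ x' ∈ X, d ∣ x - x') :
    ∃ (u x : ℤ) (X' : Finset ℤ), X = affineImage u d X' ∧ 0 ∈ X' ∧ x ∈ X' ∧
      ∀ t ∈ X', 0 ≤ t ∧ t ≤ x := by
  obtain ⟨m, hm, hmin⟩ : ∃ m ∈ X, ∀ x ∈ X, m ≤ x :=
    ⟨X.min' hX, X.min'_mem hX, fun x hx => X.min'_le x hx⟩
  obtain ⟨X', hX'⟩ := exists_eq_affineImage (fun x hx => h x hx _ hm)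
  have h0 : 0 ∈ X' := by
    rw [hX'] at hm
    obtain ⟨t, ht, hte⟩ := mem_affineImage.1 hm
    have h0 : d * t = 0 := by linarith
    rcases mul_eq_zero.1 h0 with h | h
    · omega
    · rwa [← h]
  refine ⟨m, X'.max' ⟨0, h0⟩, X', hX', h0, X'.max'_mem _, fun t ht => ⟨?_, X'.le_max' t ht⟩⟩
  have := hmin (m + d * t) (hX' ▸ mem_affineImage.2 ⟨t, ht, rfl⟩)
  exact nonneg_of_mul_nonneg_right (by linarith : 0 ≤ d * t) hd

lemma progressionStructure_of_card_eq {k : ℕ} (hk : 3 ≤ k) {X Y : Finset ℤ} (hX : X.card = k)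
    (hY : Y.card = k) (hC : (X + Y).card + 4 ≤ 3 * k) : ProgressionStructure k X Y := by
  obtain ⟨u, x, X', rfl, hX0, hXx, hXb⟩ := exists_normalized one_pos
    (Finset.card_pos.1 (by omega : 0 < X.card)) (fun _ _ _ _ => one_dvd _)
  obtain ⟨v, y, Y', rfl, hY0, hYy, hYb⟩ := exists_normalized one_pos
    (Finset.card_pos.1 (by omega : 0 < Y.card)) (fun _ _ _ _ => one_dvd _)
  rw [affineImage_add, card_affineImage one_pos] at hC
  rw [card_affineImage one_pos] at hX hY
  apply ProgressionStructure.affineImage one_pos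
  obtain ⟨m, rfl⟩ := Int.eq_ofNat_of_zero_le (hXb x hXx).1
  obtain ⟨n, rfl⟩ := Int.eq_ofNat_of_zero_le (hYb y hYy).1
  rcases le_total m n with h | h
  · exact progressionStructure_of_card_eq_of_mem hk n X' Y' m hX hY hXb hYb (by omega) hX0
      hXx hY0 hYy hC
  · exact (progressionStructure_of_card_eq_of_mem hk m Y' X' n hY hX hYb hXb (by omega) hY0
      hYy hX0 hXx
      (by rwa [add_comm Y' X'])).symm

lemma progressionStructure_of_run {k : ℕ} (hk : 2 ≤ k) {X Y : Finset ℤ} {x y c : ℤ}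
    (hX : ∀ t ∈ X, 0 ≤ t ∧ t ≤ x) (hY : ∀ t ∈ Y, 0 ≤ t ∧ t ≤ y)
    (hX0 : 0 ∈ X) (hXx : x ∈ X) (hY0 : 0 ∈ Y) (hYy : y ∈ Y)
    (hkX : k ≤ X.card) (hkY : k ≤ Y.card)
    (hC : (X + Y).card + 4 ≤ X.card + Y.card + k)
    (hrun : ∀ j : ℤ, 0 ≤ j → j + 2 < X.card + Y.card → c + j ∈ X + Y) :
    ProgressionStructure k X Y := by
  have bound : ∀ (P Q : Finset ℤ) (q : ℤ), X + Y = P + Q → X.card + Y.card = P.card + Q.card →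
      k ≤ P.card → k ≤ Q.card → 0 ∈ Q → q ∈ Q → (∀ t ∈ Q, 0 ≤ t ∧ t ≤ q) →
      q + 4 ≤ Q.card + k := by
    intro P Q q h1 h2 hP hQ h0 hq hQb
    obtain ⟨n, rfl⟩ := Int.eq_ofNat_of_zero_le (hQb q hq).1
    have hn : 0 < n := by
      have := Finset.card_le_card (fun t ht => Finset.mem_Icc.2 (hQb t ht) :
        Q ⊆ Finset.Icc 0 (n : ℤ))
      rw [Int.card_Icc] at this
      omega
    have e1 := card_add_card_residues_le hn (X := P) (Y := Q) (a := 0) h0 (by simpa using hq)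
    have e2 := min_le_card_residues (b := n) (N := X.card + Y.card - 2) (C := X + Y) (c := c)
      (fun j h0 h1 => hrun j h0 (by omega))
    rw [← h1] at e1
    omega
  exact progressionStructure_of_diam_le hX hY hX0 hXx hY0 hYy hk hkX hkY
    (bound Y X x (add_comm _ _) (add_comm _ _) hkY hkX hX0 hXx hX)
    (bound X Y y rfl rfl hkX hkY hY0 hYy hY) hC

lemma progressionStructure_of_erase {k : ℕ} (hk : 2 ≤ k) {X Y : Finset ℤ} (hX : X.Nonempty)
    (hkX : k < X.card) (hkY : k ≤ Y.card)
    (hC : (X + Y).card + 4 ≤ X.card + Y.card + k)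
    (h : ProgressionStructure k (X.erase (X.max' hX)) Y) : ProgressionStructure k X Y := by
  obtain ⟨d, a, b, c, hd, pX, pY, pC⟩ := h
  set e := X.max' hX with he
  have hXc := Finset.card_erase_add_one (X.max'_mem hX)
  rw [← he] at hXc
  have dX : ∀ x ∈ X.erase e, d ∣ x - a := by
    intro x hx
    obtain ⟨j, -, -, rfl⟩ := pX x hx
    exact ⟨j, by ring⟩
  have dY : ∀ x ∈ Y, d ∣ x - b := by
    intro x hx
    obtain ⟨j, -, -, rfl⟩ := pY x hx
    exact ⟨j, by ring⟩
  have hYne : Y.Nonempty := Finset.card_pos.1 (by omega)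
  have hYb : Y.Nonempty := hYne
  have hde : d ∣ e - a := by
    by_contra hcon
    have hdis : Disjoint (X.erase e + Y) (({e} : Finset ℤ) + Y) := by
      rw [Finset.disjoint_left]
      intro z hz hz'
      obtain ⟨x, hx, y, hy, rfl⟩ := Finset.mem_add.1 hz
      obtain ⟨x', hx', y', hy', hxy⟩ := Finset.mem_add.1 hz'
      rw [Finset.mem_singleton] at hx'
      subst hx'
      apply hcon
      have : e - a = (x - a) + (y - b) - (y' - b) := by
        rw [he]
        linarith
      rw [this]
      exact dvd_sub (dvd_add (dX x hx) (dY y hy)) (dY y' hy')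
    have h1 : (X.erase e + Y) ∪ (({e} : Finset ℤ) + Y) ⊆ X + Y :=
      Finset.union_subset (Finset.add_subset_add_right (Finset.erase_subset _ _))
        (Finset.add_subset_add_right (Finset.singleton_subset_iff.2 (X.max'_mem hX)))
    have h2 := Finset.card_le_card h1
    rw [Finset.card_union_of_disjoint hdis, Finset.card_singleton_add] at h2
    have h3 := cauchy_davenport_add_of_linearOrder_isCancelAdd (s := X.erase e) (t := Y)
      (Finset.card_pos.1 (by omega)) hYne
    omega
  have dX' : ∀ x ∈ X, d ∣ x - a := by
    intro x hx
    by_cases hxe : x = e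
    · rwa [hxe]
    · exact dX x (Finset.mem_erase.2 ⟨hxe, hx⟩)
  have hrun : ∀ j : ℤ, 0 ≤ j → j + 2 < X.card + Y.card → c + j * d ∈ X + Y := by
    intro j h0 h1
    exact Finset.add_subset_add_right (Finset.erase_subset _ _) (pC j h0 (by omega))
  clear_value e
  clear pX pC dX hde
  obtain ⟨u, x, X', rfl, hX0, hXx, hXb⟩ := exists_normalized hd hX (fun s hs t ht => by
    have := dvd_sub (dX' s hs) (dX' t ht)
    rwa [show s - a - (t - a) = s - t by ring] at this)
  obtain ⟨v, y, Y', rfl, hY0, hYy, hYb⟩ := exists_normalized hd hYne (fun s hs t ht => by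
    have := dvd_sub (dY s hs) (dY t ht)
    rwa [show s - b - (t - b) = s - t by ring] at this)
  rw [affineImage_add, card_affineImage hd] at hC
  rw [card_affineImage hd] at hkX hkY hC
  rw [card_affineImage hd] at hC
  apply ProgressionStructure.affineImage hd
  rw [affineImage_add, card_affineImage hd, card_affineImage hd] at hrun
  obtain ⟨c', hc', hcc⟩ := mem_affineImage.1 (hrun 0 le_rfl (by omega))
  refine progressionStructure_of_run (c := c') hk hXb hYb hX0 hXx hY0 hYy hkX.le hkY hC ?_
  intro j h0 h1
  obtain ⟨t, ht, hte⟩ := mem_affineImage.1 (hrun j h0 h1)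
  have : d * t = d * (c' + j) := by linarith
  rwa [← mul_left_cancel₀ hd.ne' this]

lemma card_erase_max_add_lt {X Y : Finset ℤ} (hX : X.Nonempty) (hY : Y.Nonempty) :
    (X.erase (X.max' hX) + Y).card < (X + Y).card := by
  apply Finset.card_lt_card
  refine ⟨Finset.add_subset_add_right (Finset.erase_subset _ _), fun h => ?_⟩
  obtain ⟨x, hx, y, hy, hxy⟩ := Finset.mem_add.1
    (h (Finset.add_mem_add (X.max'_mem hX) (Y.max'_mem hY)))
  have h1 := X.le_max' x (Finset.mem_of_mem_erase hx)
  have h2 := Y.le_max' y hy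
  have h3 := Finset.ne_of_mem_erase hx
  omega

/-- Structure of pairs of finite sets of integers with a small sumset. -/
theorem progressionStructure_of_card_add_le {k : ℕ} (hk : 3 ≤ k) (n : ℕ) : ∀ X Y : Finset ℤ,
    X.card + Y.card = n → k ≤ X.card → k ≤ Y.card → (X + Y).card + 4 ≤ X.card + Y.card + k →
    ProgressionStructure k X Y := by
  induction n with
  | zero => intro X Y h; omega
  | succ n ih =>
    intro X Y hn hX hY hC
    have hXne : X.Nonempty := Finset.card_pos.1 (by omega)
    have hYne : Y.Nonempty := Finset.card_pos.1 (by omega)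
    rcases eq_or_lt_of_le hX with h | h
    · rcases eq_or_lt_of_le hY with h' | h'
      · exact progressionStructure_of_card_eq hk h.symm h'.symm (by omega)
      · have h1 := card_erase_max_add_lt hYne hXne
        have h2 := Finset.card_erase_add_one (Y.max'_mem hYne)
        rw [add_comm Y X] at h1
        exact (progressionStructure_of_erase (by omega) hYne h' hX (by rw [add_comm Y]; omega)
          (ih _ _ (by omega) (by omega) hX (by omega))).symm
    · have h1 := card_erase_max_add_lt hXne hYne
      have h2 := Finset.card_erase_add_one (X.max'_mem hXne)
      exact progressionStructure_of_erase (by omega) hXne h hY hC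
        (ih _ _ (by omega) (by omega) hY (by omega))

/-- Translates of `F` pairwise share fewer than `k` elements. -/
def TranslateSparse {p : ℕ} (k : ℕ) (F : Finset (ZMod p)) : Prop :=
  ∀ x y : ZMod p, x ≠ y → ((F + {x}) ∩ (F + {y})).card < k

lemma eq_univ_of_add_singleton_eq {p : ℕ} [Fact p.Prime] {F : Finset (ZMod p)} (hF : F.Nonempty)
    {x : ZMod p} (hx : x ≠ 0) (h : F + {x} = F) : F = Finset.univ := by
  obtain ⟨f, hf⟩ := hF
  have key : ∀ n : ℕ, f + n * x ∈ F := by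
    intro n
    induction n with
    | zero => simpa using hf
    | succ n ih =>
      rw [← h]
      exact Finset.mem_add.2 ⟨_, ih, x, Finset.mem_singleton_self x, by push_cast; ring⟩
  rw [Finset.eq_univ_iff_forall]
  intro z
  have := key ((z - f) / x).val
  rw [ZMod.natCast_zmod_val, div_mul_cancel₀ _ hx] at this
  simpa using this

/-- Every pair `A, X` admits a set `F` which is no worse than `X` and has sparse translates. -/
lemma exists_translateSparse {p : ℕ} [Fact p.Prime] {k : ℕ} (hk : 0 < k)
    {A X : Finset (ZMod p)} (hA : A.Nonempty) (hX : k ≤ X.card) (hAX : (A + X).card + k ≤ p) :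
    ∃ F : Finset (ZMod p), k ≤ F.card ∧ (A + F).card + k ≤ p ∧
      (A + F).card + X.card ≤ (A + X).card + F.card ∧ TranslateSparse k F := by
  have cle : ∀ S : Finset (ZMod p), S.card ≤ p := fun S => by
    simpa [ZMod.card] using S.card_le_univ
  obtain ⟨F, hF, hmin⟩ := Finset.exists_min_image
    (Finset.univ.filter (fun S : Finset (ZMod p) => k ≤ S.card ∧ (A + S).card + k ≤ p))
    (fun S => (p + 1) * ((A + S).card + p - S.card) + S.card)
    ⟨X, by simp [hX, hAX]⟩
  simp only [Finset.mem_filter, Finset.mem_univ, true_and] at hF hmin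
  obtain ⟨hFk, hFp⟩ := hF
  have opt : ∀ S : Finset (ZMod p), k ≤ S.card → (A + S).card + k ≤ p →
      (A + F).card + S.card < (A + S).card + F.card ∨
        (A + F).card + S.card = (A + S).card + F.card ∧ F.card ≤ S.card := by
    intro S h1 h2
    have h3 := hmin S ⟨h1, h2⟩
    have c1 := cle S
    have c2 := cle F
    rcases lt_trichotomy ((A + F).card + p - F.card) ((A + S).card + p - S.card) with h | h | h
    · left; omega
    · right
      rw [h] at h3
      omega
    · exfalso
      have : (p + 1) * ((A + S).card + p - S.card + 1) ≤ (p + 1) * ((A + F).card + p - F.card) :=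
        Nat.mul_le_mul_left _ h
      rw [mul_add] at this
      omega
  have hdual : F.card + (A + F).card ≤ p := by
    set N := (A + F)ᶜ with hN
    have hNc : N.card + (A + F).card = p := by
      rw [hN, Finset.card_compl_add_card, ZMod.card]
    have hsub : A + (-N) ⊆ (-F)ᶜ := by
      intro z hz
      obtain ⟨a, ha, n, hn, rfl⟩ := Finset.mem_add.1 hz
      rw [Finset.mem_compl]
      intro h
      rw [Finset.mem_neg'] at h hn
      rw [hN, Finset.mem_compl] at hn
      exact hn (Finset.mem_add.2 ⟨a, ha, _, h, by ring⟩)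
    have h1 := Finset.card_le_card hsub
    have h2 : ((-F)ᶜ).card + F.card = p := by
      have := Finset.card_compl_add_card (-F)
      rwa [Finset.card_neg, ZMod.card] at this
    have h3 : (-N).card = N.card := Finset.card_neg _
    have := opt (-N) (by omega) (by omega)
    omega
  have hopt' := opt X hX hAX
  refine ⟨F, hFk, hFp, by omega, fun x y hxy => ?_⟩
  by_contra hcon
  push Not at hcon
  set F₁ := F + {x} with hF₁
  set F₂ := F + {y} with hF₂
  have e1 : F₁.card = F.card := Finset.card_add_singleton _ _
  have e2 : F₂.card = F.card := Finset.card_add_singleton _ _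
  have a1 : (A + F₁).card = (A + F).card := by
    rw [hF₁, ← add_assoc, Finset.card_add_singleton]
  have a2 : (A + F₂).card = (A + F).card := by
    rw [hF₂, ← add_assoc, Finset.card_add_singleton]
  have hFne : F.Nonempty := Finset.card_pos.1 (by omega)
  have hlt : (F₁ ∩ F₂).card < F.card := by
    by_contra h
    have h1 : F₁ ∩ F₂ = F₁ := Finset.eq_of_subset_of_card_le Finset.inter_subset_left (by omega)
    have h2 : F₁ ∩ F₂ = F₂ := Finset.eq_of_subset_of_card_le Finset.inter_subset_right (by omega)
    have h3 : F₁ = F₂ := h1.symm.trans h2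
    have h4 : F + {x - y} = F := by
      have : F + {x} + {-y} = F + {y} + {-y} := by rw [← hF₁, ← hF₂, h3]
      rw [add_assoc, add_assoc, Finset.singleton_add_singleton, Finset.singleton_add_singleton,
        add_neg_cancel] at this
      rw [sub_eq_add_neg, this]
      rw [Finset.singleton_zero, add_zero]
    have h5 := eq_univ_of_add_singleton_eq hFne (sub_ne_zero.2 hxy) h4
    have h6 : F.card = p := by rw [h5, Finset.card_univ, ZMod.card]
    have := Finset.card_le_card_add_left (t := F) hA
    omega
  have i1 : A + (F₁ ∩ F₂) ⊆ (A + F₁) ∩ (A + F₂) := Finset.subset_inter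
    (Finset.add_subset_add_left Finset.inter_subset_left)
    (Finset.add_subset_add_left Finset.inter_subset_right)
  have i2 := Finset.card_union_add_card_inter (A + F₁) (A + F₂)
  rw [← Finset.add_union] at i2
  have i3 := Finset.card_le_card i1
  have i4 := Finset.card_union_add_card_inter F₁ F₂
  have i5 := Finset.card_le_card (Finset.inter_subset_left.trans (subset_refl (A + F₁)) :
    (A + F₁) ∩ (A + F₂) ⊆ A + F₁)
  have o1 := opt (F₁ ∩ F₂) hcon (by omega)
  have o2 := opt (F₁ ∪ F₂) (by omega) (by omega)
  omega

lemma TranslateSparse.card_add_two {p : ℕ} {k : ℕ} {F S : Finset (ZMod p)}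
    (hF : TranslateSparse k F) (hS : 2 ≤ S.card) : 2 * F.card + 1 ≤ (S + F).card + k := by
  obtain ⟨x, hx, y, hy, hxy⟩ := Finset.one_lt_card.1 hS
  have h1 := Finset.card_union_add_card_inter (F + {x}) (F + {y})
  rw [Finset.card_add_singleton, Finset.card_add_singleton] at h1
  have h2 := hF x y hxy
  have h3 : (F + {x}) ∪ (F + {y}) ⊆ S + F := by
    rw [add_comm S F]
    exact Finset.union_subset (Finset.add_subset_add_left (by simpa using hx))
      (Finset.add_subset_add_left (by simpa using hy))
  have := Finset.card_le_card h3
  omega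

lemma TranslateSparse.card_add_three {p : ℕ} {k : ℕ} {F S : Finset (ZMod p)}
    (hF : TranslateSparse k F) (hS : 3 ≤ S.card) : 3 * F.card + 3 ≤ (S + F).card + 3 * k := by
  obtain ⟨x, hx, y, hy, z, hz, hxy, hxz, hyz⟩ := Finset.two_lt_card.1 hS
  have h1 := Finset.card_union_add_card_inter (F + {x}) (F + {y})
  have h2 := Finset.card_union_add_card_inter ((F + {x}) ∪ (F + {y})) (F + {z})
  rw [Finset.union_inter_distrib_right] at h2
  have h3 := Finset.card_union_le ((F + {x}) ∩ (F + {z})) ((F + {y}) ∩ (F + {z}))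
  rw [Finset.card_add_singleton, Finset.card_add_singleton] at h1
  rw [Finset.card_add_singleton] at h2
  have e1 := hF x y hxy
  have e2 := hF x z hxz
  have e3 := hF y z hyz
  have h3 : (F + {x}) ∪ (F + {y}) ∪ (F + {z}) ⊆ S + F := by
    rw [add_comm S F]
    exact Finset.union_subset (Finset.union_subset (Finset.add_subset_add_left (by simpa using hx))
      (Finset.add_subset_add_left (by simpa using hy)))
      (Finset.add_subset_add_left (by simpa using hz))
  have := Finset.card_le_card h3
  omega

/-- A small set `F` which has a small sumset with `A`, and a small set `F'` which has a small sumset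
with `F`. -/
lemma exists_small_pair {p : ℕ} [Fact p.Prime] {k : ℕ} (hk : 3 ≤ k)
    {A B : Finset (ZMod p)} (hA : k ≤ A.card) (hB : k ≤ B.card) (hAB : (A + B).card + k ≤ p)
    (h : (A + B).card + 4 ≤ A.card + B.card + k) :
    ∃ F F' : Finset (ZMod p), k ≤ F.card ∧ k ≤ F'.card ∧ F.card ≤ 4 * k ∧ F'.card ≤ 4 * k ∧
      (A + F).card + k ≤ p ∧ (A + F).card + 4 ≤ A.card + F.card + k ∧
      (F + F').card + 4 ≤ F.card + F'.card + k := by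
  obtain ⟨F, h1, h2, h3, h4⟩ := exists_translateSparse (by omega)
    (Finset.card_pos.1 (by omega : 0 < A.card)) hB hAB
  obtain ⟨F', g1, g2, g3, g4⟩ := exists_translateSparse (by omega) (A := F) (X := A)
    (Finset.card_pos.1 (by omega : 0 < F.card)) hA (by rwa [add_comm F A])
  rw [add_comm F A] at g3
  have e1 := g4.card_add_three (S := F) (by omega)
  have e2 := h4.card_add_three (S := F') (by omega)
  rw [add_comm F' F] at e2
  exact ⟨F, F', h1, g1, by omega, by omega, h2, by omega, by omega⟩

/-- `A` is contained in a progression of length `n`. -/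
def ContainedInAP {p : ℕ} (n : ℕ) (A : Finset (ZMod p)) : Prop :=
  ∃ x d : ZMod p, d ≠ 0 ∧ ∀ a ∈ A, ∃ j : ℕ, j < n ∧ a = x + j * d

lemma containedInAP_of_card_le_add_one {p : ℕ} [Fact p.Prime] {A : Finset (ZMod p)} {u d : ZMod p}
    (hd : d ≠ 0) (hne : A ≠ Finset.univ) (hA : A.Nonempty)
    (h : (A + {u, u + d}).card ≤ A.card + 1) :
    ContainedInAP A.card A := by
  have hex : ∀ a : ZMod p, ∃ n : ℕ, a + n * d ∉ A := by
    obtain ⟨z, hz⟩ : ∃ z, z ∉ A := by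
      by_contra hcon
      push Not at hcon
      exact hne (Finset.eq_univ_iff_forall.2 hcon)
    intro a
    refine ⟨((z - a) / d).val, ?_⟩
    rw [ZMod.natCast_zmod_val, div_mul_cancel₀ _ hd]
    simpa using hz
  classical
  have uniq : ∀ a ∈ A, ∀ a' ∈ A, a + d ∉ A → a' + d ∉ A → a = a' := by
    intro a ha a' ha' h1 h2
    by_contra hne
    have hsub : insert (a + (u + d)) (insert (a' + (u + d)) (A + {u})) ⊆ A + {u, u + d} := by
      refine Finset.insert_subset (Finset.add_mem_add ha (by simp))
        (Finset.insert_subset (Finset.add_mem_add ha' (by simp))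
          (Finset.add_subset_add_left (by simp)))
    have aux : ∀ a, a + d ∉ A → a + (u + d) ∉ A + {u} := by
      intro a h1 h3
      obtain ⟨b, hb, c, hc, hbe⟩ := Finset.mem_add.1 h3
      rw [Finset.mem_singleton] at hc
      subst hc
      apply h1
      have : b = a + d := by
        have : b + c = (a + d) + c := by rw [hbe]; ring
        exact add_right_cancel this
      rwa [← this]
    have h3 := Finset.card_le_card hsub
    rw [Finset.card_insert_of_notMem, Finset.card_insert_of_notMem (aux a' h2),
      Finset.card_add_singleton] at h3
    · omega
    · rw [Finset.mem_insert, not_or]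
      exact ⟨fun h => hne (add_right_cancel h), aux a h1⟩
  have key : ∀ a ∈ A, ∃ m : ℕ, m < A.card ∧ a + m * d ∈ A ∧ a + m * d + d ∉ A := by
    intro a ha
    have hmin : ∀ m < Nat.find (hex a), a + m * d ∈ A := fun m hm =>
      not_not.1 (Nat.find_min (hex a) hm)
    have hspec := Nat.find_spec (hex a)
    set n := Nat.find (hex a)
    have hn0 : n ≠ 0 := by
      intro h0
      rw [h0] at hspec
      exact hspec (by simpa using ha)
    have hcard : n ≤ A.card := by
      have : (Finset.range n).card = n := Finset.card_range n
      rw [← this]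
      refine Finset.card_le_card_of_injOn (fun m => a + m * d) (fun m hm => ?_) ?_
      · exact hmin m (by simpa using hm)
      · have aux : ∀ i j : ℕ, i < j → j < n → a + i * d ≠ a + j * d := by
          intro i j hij hj he
          have h1 := hmin (n - (j - i)) (by omega)
          apply hspec
          have e : ((n - (j - i) : ℕ) : ZMod p) = n - (j - i) := by
            rw [Nat.cast_sub (by omega), Nat.cast_sub (by omega)]
          rw [e] at h1
          have e' : a + ((n : ZMod p) - (j - i)) * d = a + n * d - ((a + j * d) - (a + i * d)) := by
            ring
          rwa [e', he, sub_self, sub_zero] at h1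
        intro i hi j hj he
        simp only [Finset.coe_range, Set.mem_Iio] at hi hj
        rcases lt_trichotomy i j with hlt | heq | hlt
        · exact absurd he (aux i j hlt hj)
        · exact heq
        · exact absurd he.symm (aux j i hlt hi)
    refine ⟨n - 1, by omega, hmin _ (by omega), ?_⟩
    have e : ((n : ℕ) : ZMod p) = ((n - 1 : ℕ) : ZMod p) + 1 := by
      rw [Nat.cast_sub (by omega)]; push_cast; ring
    rw [e] at hspec
    have : a + ((n - 1 : ℕ) : ZMod p) * d + d = a + (((n - 1 : ℕ) : ZMod p) + 1) * d := by ring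
    rwa [this]
  obtain ⟨a₀, ha₀⟩ := hA
  obtain ⟨m₀, -, hm₀, hm₀'⟩ := key a₀ ha₀
  refine ⟨a₀ + m₀ * d, -d, neg_ne_zero.2 hd, fun a ha => ?_⟩
  obtain ⟨m, hm, h1, h2⟩ := key a ha
  refine ⟨m, hm, ?_⟩
  rw [uniq _ hm₀ _ h1 hm₀' h2]
  ring

/-- Vosper's theorem. -/
theorem vosper {p : ℕ} [Fact p.Prime] {A B : Finset (ZMod p)} (hA : 2 ≤ A.card) (hB : 2 ≤ B.card)
    (hAB : (A + B).card + 2 ≤ p) (h : (A + B).card + 1 ≤ A.card + B.card) :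
    ContainedInAP A.card A := by
  have hAne : A.Nonempty := Finset.card_pos.1 (by omega)
  obtain ⟨F, h1, h2, h3, h4⟩ := exists_translateSparse (by omega) hAne hB hAB
  obtain ⟨F', g1, g2, g3, g4⟩ := exists_translateSparse (by omega) (A := F) (X := A)
    (Finset.card_pos.1 (by omega : 0 < F.card)) hA (by rwa [add_comm F A])
  rw [add_comm F A] at g3
  have hF2 : F.card = 2 := by
    by_contra hcon
    have e1 := g4.card_add_three (S := F) (by omega)
    have e2 := h4.card_add_two (S := F') (by omega)
    rw [add_comm F' F] at e2
    by_cases hF' : 3 ≤ F'.card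
    · have e3 := h4.card_add_three (S := F') hF'
      rw [add_comm F' F] at e3
      omega
    · omega
  obtain ⟨u, v, huv, rfl⟩ := Finset.card_eq_two.1 hF2
  refine containedInAP_of_card_le_add_one (u := u) (d := v - u) (sub_ne_zero.2 huv.symm) ?_ hAne ?_
  · rintro rfl
    have := Finset.card_le_card_add_right (s := (Finset.univ : Finset (ZMod p))) (t := {u, v})
      ⟨u, by simp⟩
    rw [Finset.card_univ, ZMod.card] at this
    omega
  · rw [add_sub_cancel]
    omega

/-- The box of all combinations of the elements of `X` with coefficients at most `M`. -/
def coeffBox {G : Type*} [AddCommGroup G] [DecidableEq G] (X : Finset G) (M : ℕ) : Finset G :=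
  ∑ x ∈ X, (Finset.range (M + 1)).image (fun n : ℕ => n • x)

lemma zero_mem_sum_finset {G : Type*} [AddCommGroup G] [DecidableEq G] (X : Finset G)
    (I : G → Finset G) (h : ∀ x, 0 ∈ I x) : (0 : G) ∈ ∑ x ∈ X, I x := by
  induction X using Finset.induction_on with
  | empty => simp
  | insert x X hx ih =>
    rw [Finset.sum_insert hx]
    exact Finset.mem_add.2 ⟨0, h x, 0, ih, by simp⟩

lemma card_sum_finset_le {G : Type*} [AddCommGroup G] [DecidableEq G] (X : Finset G)
    (I : G → Finset G) (n : ℕ) (h : ∀ x, (I x).card ≤ n) : (∑ x ∈ X, I x).card ≤ n ^ X.card := by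
  induction X using Finset.induction_on with
  | empty => simp
  | insert x X hx ih =>
    rw [Finset.sum_insert hx, Finset.card_insert_of_notMem hx, pow_succ']
    exact Finset.card_add_le.trans (Nat.mul_le_mul (h x) ih)

lemma zero_mem_coeffBox {G : Type*} [AddCommGroup G] [DecidableEq G] (X : Finset G) (M : ℕ) :
    (0 : G) ∈ coeffBox X M :=
  zero_mem_sum_finset X _ fun _ => Finset.mem_image.2 ⟨0, by simp, by simp⟩

lemma card_coeffBox_le {G : Type*} [AddCommGroup G] [DecidableEq G] (X : Finset G) (M : ℕ) :
    (coeffBox X M).card ≤ (M + 1) ^ X.card :=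
  card_sum_finset_le X _ _ fun _ => Finset.card_image_le.trans (by simp)

lemma coeffBox_add {G : Type*} [AddCommGroup G] [DecidableEq G] (X : Finset G) (M N : ℕ) :
    coeffBox X M + coeffBox X N = coeffBox X (M + N) := by
  rw [coeffBox, coeffBox, ← Finset.sum_add_distrib]
  refine Finset.sum_congr rfl fun x _ => ?_
  ext z
  simp only [Finset.mem_add, Finset.mem_image, Finset.mem_range]
  constructor
  · rintro ⟨_, ⟨m, hm, rfl⟩, _, ⟨n, hn, rfl⟩, rfl⟩
    exact ⟨m + n, by omega, add_nsmul _ _ _⟩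
  · rintro ⟨j, hj, rfl⟩
    exact ⟨_, ⟨min j M, by omega, rfl⟩, _, ⟨j - min j M, by omega, rfl⟩, by
      rw [← add_nsmul]; congr 1; omega⟩

lemma exists_coeffBox_two_mul {G : Type*} [AddCommGroup G] [DecidableEq G] (X : Finset G) (M : ℕ) :
    ∃ E : Finset G, E.card ≤ 2 ^ X.card ∧ coeffBox X (2 * M) = E + coeffBox X M := by
  refine ⟨∑ x ∈ X, {0, M • x}, card_sum_finset_le X _ _ fun _ => Finset.card_le_two, ?_⟩
  rw [coeffBox, coeffBox, ← Finset.sum_add_distrib]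
  refine Finset.sum_congr rfl fun x _ => ?_
  ext z
  simp only [Finset.mem_add, Finset.mem_image, Finset.mem_range, Finset.mem_insert,
    Finset.mem_singleton]
  constructor
  · rintro ⟨j, hj, rfl⟩
    rcases le_or_gt j M with h | h
    · exact ⟨0, Or.inl rfl, _, ⟨j, by omega, rfl⟩, zero_add _⟩
    · exact ⟨_, Or.inr rfl, _, ⟨j - M, by omega, rfl⟩, by
        rw [← add_nsmul]; congr 1; omega⟩
  · rintro ⟨_, rfl | rfl, _, ⟨n, hn, rfl⟩, rfl⟩
    · exact ⟨n, by omega, (zero_add _).symm⟩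
    · exact ⟨M + n, by omega, add_nsmul _ _ _⟩

lemma subset_coeffBox_one {G : Type*} [AddCommGroup G] [DecidableEq G] (X : Finset G) :
    X ⊆ coeffBox X 1 := by
  induction X using Finset.induction_on with
  | empty => simp
  | insert x X hx ih =>
    rw [coeffBox, Finset.sum_insert hx]
    intro z hz
    rcases Finset.mem_insert.1 hz with rfl | hz
    · exact Finset.mem_add.2 ⟨z, Finset.mem_image.2 ⟨1, by simp, by simp⟩, 0,
        zero_mem_coeffBox X 1, by simp⟩
    · exact Finset.mem_add.2 ⟨0, Finset.mem_image.2 ⟨0, by simp, by simp⟩, z, ih hz, by simp⟩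

lemma card_coeffBox_two_mul_add_le {G : Type*} [AddCommGroup G] [DecidableEq G] (X S : Finset G)
    (M : ℕ) : (coeffBox X (2 * M) + S).card ≤ 2 ^ X.card * (coeffBox X M + S).card := by
  obtain ⟨E, hE, h⟩ := exists_coeffBox_two_mul X M
  rw [h, add_assoc]
  exact Finset.card_add_le.trans (Nat.mul_le_mul_right _ hE)

/-- A set with a covering property `S + S ⊆ X + S` admits sets `W` of bounded doubling which are
almost invariant under translation by elements of `S`. -/
lemma exists_almost_invariant {G : Type*} [AddCommGroup G] [DecidableEq G] {X S : Finset G}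
    (hS : S.Nonempty) (hX : S + S ⊆ X + S) {m : ℕ} (hm : 1 ≤ m) :
    ∃ W : Finset G, W.Nonempty ∧ (W + W).card ≤ 4 ^ X.card * W.card ∧
      m * (W + S).card ≤ (m + 1) * W.card ∧
      W.card ≤ (m * 2 ^ X.card * 2 + 1) ^ X.card * S.card := by
  set M₀ := m * 2 ^ X.card with hM₀
  have hM₀1 : 1 ≤ M₀ := Nat.mul_pos hm (by positivity)
  set w : ℕ → Finset G := fun M => coeffBox X M + S with hw
  have hne : ∀ M, (w M).Nonempty := fun M => Finset.Nonempty.add ⟨0, zero_mem_coeffBox X M⟩ hS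
  have mono : ∀ M N, M ≤ N → w M ⊆ w N := by
    intro M N hMN
    refine Finset.add_subset_add_right ?_
    rw [← Nat.add_sub_cancel' hMN, ← coeffBox_add]
    exact Finset.subset_add_left _ (zero_mem_coeffBox X _)
  have step : ∀ M, w M + S ⊆ w (M + 1) := by
    intro M
    simp only [hw]
    rw [add_assoc, ← coeffBox_add, add_assoc]
    exact Finset.add_subset_add_left
      (hX.trans (Finset.add_subset_add_right (subset_coeffBox_one X)))
  have dbl : ∀ M, (w (2 * M)).card ≤ 2 ^ X.card * (w M).card := fun M =>
    card_coeffBox_two_mul_add_le X S M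
  obtain ⟨M, hM1, hM2, hM3⟩ : ∃ M, M₀ ≤ M ∧ M < 2 * M₀ ∧
      m * (w (M + 1)).card ≤ (m + 1) * (w M).card := by
    by_contra hcon
    push Not at hcon
    have grow : ∀ i ≤ M₀, (m + i) * (w M₀).card ≤ m * (w (M₀ + i)).card := by
      intro i
      induction i with
      | zero => intro _; simp
      | succ i ih =>
        intro hi
        have h1 := ih (by omega)
        have h2 := hcon (M₀ + i) (by omega) (by omega)
        have h3 : (w M₀).card ≤ (w (M₀ + i)).card := Finset.card_le_card (mono _ _ (by omega))
        rw [← add_assoc M₀, ← add_assoc]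
        nlinarith
    have h1 := grow M₀ le_rfl
    have h2 := dbl M₀
    rw [← two_mul] at h1
    have h3 : (m + M₀) * (w M₀).card ≤ M₀ * (w M₀).card := by
      calc _ ≤ _ := h1
        _ ≤ m * (2 ^ X.card * (w M₀).card) := Nat.mul_le_mul_left _ h2
        _ = _ := by rw [hM₀]; ring
    have h4 := Nat.le_of_mul_le_mul_right h3 (Finset.card_pos.2 (hne M₀))
    omega
  refine ⟨w M, hne M, ?_, ?_, ?_⟩
  · have h1 : w M + w M ⊆ w (2 * (2 * M)) := by
      refine subset_trans ?_ (mono (2 * M + 1) _ (by omega))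
      refine subset_trans ?_ (step (2 * M))
      simp only [hw]
      rw [add_add_add_comm, coeffBox_add, two_mul, add_assoc]
    refine (Finset.card_le_card h1).trans ((dbl _).trans ?_)
    calc _ ≤ 2 ^ X.card * (2 ^ X.card * (w M).card) := Nat.mul_le_mul_left _ (dbl M)
      _ = _ := by rw [← mul_assoc, ← mul_pow]; norm_num
  · exact (Nat.mul_le_mul_left _ (Finset.card_le_card (step M))).trans hM3
  · refine Finset.card_add_le.trans (Nat.mul_le_mul_right _ ((card_coeffBox_le X M).trans ?_))
    exact Nat.pow_le_pow_left (by omega) _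

lemma card_nsmul_sub_nsmul_le {G : Type*} [AddCommGroup G] [DecidableEq G] {A B : Finset G}
    (hA : A.Nonempty) {K : ℕ} (h : (A + B).card ≤ K * A.card) (m n : ℕ) :
    (m • B - n • B).card ≤ K ^ (m + n) * A.card := by
  have h1 := Finset.pluennecke_ruzsa_inequality_nsmul_sub_nsmul_add hA B m n
  have hpos : (0 : ℚ≥0) < A.card := by exact_mod_cast Finset.card_pos.2 hA
  have h2 : ((A + B).card : ℚ≥0) / A.card ≤ K := by
    rw [div_le_iff₀ hpos]
    exact_mod_cast h
  have h3 : ((m • B - n • B).card : ℚ≥0) ≤ (K : ℚ≥0) ^ (m + n) * A.card :=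
    h1.trans (mul_le_mul_of_nonneg_right (pow_le_pow_left₀ (by positivity) h2 _) (by positivity))
  exact_mod_cast h3

lemma card_nsmul_le {G : Type*} [AddCommGroup G] [DecidableEq G] {A B : Finset G}
    (hA : A.Nonempty) {K : ℕ} (h : (A + B).card ≤ K * A.card) (m : ℕ) :
    (m • B).card ≤ K ^ m * A.card := by
  have := card_nsmul_sub_nsmul_le hA h m 0
  simpa using this

/-- Covering of the double of the difference set of `F + F'` when `F + F'` is small. -/
lemma exists_covering :
    ∃ D : ℕ, ∀ (G : Type) [AddCommGroup G] [DecidableEq G] (k : ℕ) (F F' : Finset G),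
      1 ≤ k → k ≤ F.card → k ≤ F'.card → F.card ≤ 4 * k →
      F'.card ≤ 4 * k → (F + F').card ≤ 9 * k →
      ∃ X : Finset G, X.card ≤ D ∧ ((F + F') - (F + F')).card ≤ D * k ∧
        ((F + F') - (F + F')) + ((F + F') - (F + F')) ⊆ X + ((F + F') - (F + F')) := by
  obtain ⟨C, hC⟩ : ∃ C : ℕ, C = 9 ^ 3 * 4 * (9 * (9 ^ 3 * 4)) := ⟨_, rfl⟩
  refine ⟨C ^ 5 + C ^ 2 * 9, fun G _ _ k F F' hk h1 h2 h3 h4 h5 => ?_⟩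
  have hF : F.Nonempty := Finset.card_pos.1 (by omega)
  have hF' : F'.Nonempty := Finset.card_pos.1 (by omega)
  have a1 : (3 • F').card ≤ 9 ^ 3 * F.card := card_nsmul_le hF (by omega) 3
  have a2 : (3 • F).card ≤ 9 ^ 3 * F'.card :=
    card_nsmul_le hF' (by rw [add_comm]; omega) 3
  have a3 := Finset.ruzsa_triangle_inequality_add_add_add F F' (2 • F')
  have a4 := Finset.ruzsa_triangle_inequality_add_add_add (2 • F) F (2 • F')
  have e1 : F' + 2 • F' = 3 • F' := by rw [← succ_nsmul' F' 2]
  have e2 : 2 • F + F = 3 • F := by rw [← succ_nsmul F 2]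
  rw [e1] at a3
  rw [e2] at a4
  set T := F + F' with hT
  have hTT : T + T = 2 • F + 2 • F' := by rw [hT, two_nsmul, two_nsmul, add_add_add_comm]
  have hTk : k ≤ T.card := h1.trans (Finset.card_le_card_add_right hF')
  have hTne : T.Nonempty := hF.add hF'
  have a5 : (F + 2 • F').card ≤ (9 * (9 ^ 3 * 4)) * k := by
    refine Nat.le_of_mul_le_mul_right (c := k) ?_ hk
    calc _ ≤ (F + 2 • F').card * F'.card := Nat.mul_le_mul_left _ h2
      _ ≤ _ := a3
      _ ≤ (9 * k) * (9 ^ 3 * (4 * k)) :=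
        Nat.mul_le_mul h5 (a1.trans (Nat.mul_le_mul_left _ h3))
      _ = _ := by ring
  have a6 : (T + T).card ≤ C * k := by
    rw [hTT]
    refine Nat.le_of_mul_le_mul_right (c := k) ?_ hk
    calc _ ≤ (2 • F + 2 • F').card * F.card := Nat.mul_le_mul_left _ h1
      _ ≤ _ := a4
      _ ≤ (9 ^ 3 * (4 * k)) * ((9 * (9 ^ 3 * 4)) * k) :=
        Nat.mul_le_mul (a2.trans (Nat.mul_le_mul_left _ h4)) a5
      _ = _ := by rw [hC]; ring
  have a7 : (T + T).card ≤ C * T.card := a6.trans (Nat.mul_le_mul_left _ hTk)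
  have b1 := card_nsmul_sub_nsmul_le hTne a7 3 2
  have b2 := card_nsmul_sub_nsmul_le hTne a7 1 1
  rw [one_nsmul] at b2
  have e3 : 3 • T - 2 • T = ((T - T) + (T - T)) + T := by
    have e : 3 • T = T + T + T := by rw [← two_nsmul, ← succ_nsmul]
    rw [e, two_nsmul]
    simp only [sub_eq_add_neg, neg_add]
    generalize -T = U
    abel
  rw [e3] at b1
  obtain ⟨X, -, hX1, hX2⟩ := Finset.ruzsa_covering_add (K := ((C ^ 5 : ℕ) : ℝ)) hTne
    (by exact_mod_cast b1)
  refine ⟨X, ?_, ?_, hX2⟩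
  · have : X.card ≤ C ^ 5 := by exact_mod_cast hX1
    omega
  · calc _ ≤ C ^ 2 * T.card := b2
      _ ≤ C ^ 2 * (9 * k) := Nat.mul_le_mul_left _ h5
      _ = C ^ 2 * 9 * k := by ring
      _ ≤ _ := Nat.mul_le_mul_right _ (by omega)

/-- The Fourier coefficient of the indicator function of `W` at frequency `-q`. -/
noncomputable def fourierSum {p : ℕ} [NeZero p] (W : Finset (ZMod p)) (q : ZMod p) : ℂ :=
  ∑ w ∈ W, ZMod.stdAddChar (w * q)

lemma sum_norm_sq_charSum {p : ℕ} [NeZero p] {ι : Type*} (I : Finset ι) (φ : ι → ZMod p) :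
    ∑ q : ZMod p, ‖∑ i ∈ I, (ZMod.stdAddChar (φ i * q) : ℂ)‖ ^ 2 =
      p * ((I ×ˢ I).filter (fun x => φ x.1 = φ x.2)).card := by
  have key : ∀ q : ZMod p, ((‖∑ i ∈ I, (ZMod.stdAddChar (φ i * q) : ℂ)‖ ^ 2 : ℝ) : ℂ) =
      ∑ x ∈ I ×ˢ I, ZMod.stdAddChar (q * (φ x.1 - φ x.2)) := by
    intro q
    rw [← Complex.normSq_eq_norm_sq, Complex.normSq_eq_conj_mul_self, map_sum, mul_comm,
      Finset.sum_mul_sum, Finset.sum_product]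
    refine Finset.sum_congr rfl fun i _ => Finset.sum_congr rfl fun j _ => ?_
    rw [← AddChar.map_neg_eq_conj, ← AddChar.map_add_eq_mul]
    congr 1
    ring
  have : ((∑ q : ZMod p, ‖∑ i ∈ I, (ZMod.stdAddChar (φ i * q) : ℂ)‖ ^ 2 : ℝ) : ℂ) =
      ((p * ((I ×ˢ I).filter (fun x => φ x.1 = φ x.2)).card : ℝ) : ℂ) := by
    rw [Complex.ofReal_sum]
    simp_rw [key]
    rw [Finset.sum_comm]
    have : ∀ x ∈ I ×ˢ I, ∑ q : ZMod p, (ZMod.stdAddChar (q * (φ x.1 - φ x.2)) : ℂ) =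
        if φ x.1 = φ x.2 then (p : ℂ) else 0 := by
      intro x _
      rw [AddChar.sum_mulShift _ (ZMod.isPrimitive_stdAddChar p), ZMod.card]
      simp [sub_eq_zero]
    rw [Finset.sum_congr rfl this, ← Finset.sum_filter, Finset.sum_const, nsmul_eq_mul]
    push_cast
    ring
  exact_mod_cast this

lemma sum_norm_fourierSum_sq {p : ℕ} [NeZero p] (W : Finset (ZMod p)) :
    ∑ q, ‖fourierSum W q‖ ^ 2 = p * W.card := by
  have h := sum_norm_sq_charSum W (fun w => w)
  have e : ((W ×ˢ W).filter (fun x => x.1 = x.2)).card = W.card := by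
    rw [← Finset.diag_eq_filter, Finset.diag_card]
  rw [e] at h
  exact h

lemma sum_norm_fourierSum_four {p : ℕ} [NeZero p] (W : Finset (ZMod p)) :
    ∑ q, ‖fourierSum W q‖ ^ 4 = p * (Finset.addEnergy W W : ℝ) := by
  have h := sum_norm_sq_charSum (W ×ˢ W) (fun w => w.1 + w.2)
  rw [Finset.addEnergy_eq_card_filter, ← h]
  refine Finset.sum_congr rfl fun q _ => ?_
  have : ∑ i ∈ W ×ˢ W, (ZMod.stdAddChar ((i.1 + i.2) * q) : ℂ) = fourierSum W q ^ 2 := by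
    rw [sq, fourierSum, Finset.sum_mul_sum, Finset.sum_product]
    refine Finset.sum_congr rfl fun i _ => Finset.sum_congr rfl fun j _ => ?_
    rw [← AddChar.map_add_eq_mul, add_mul]
  rw [this, norm_pow]
  ring

lemma fourierSum_zero {p : ℕ} [NeZero p] (W : Finset (ZMod p)) : fourierSum W 0 = W.card := by
  simp [fourierSum]

/-- A set of bounded doubling and small density has a large nontrivial Fourier coefficient. -/
lemma exists_large_fourierSum {p : ℕ} [NeZero p] {W : Finset (ZMod p)} (hW : W.Nonempty) {K : ℕ}
    (hK : (W + W).card ≤ K * W.card) (hp : 2 * K * W.card ≤ p) :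
    ∃ q : ZMod p, q ≠ 0 ∧ (W.card : ℝ) ^ 2 ≤ 2 * K * ‖fourierSum W q‖ ^ 2 := by
  by_contra hcon
  push Not at hcon
  have hwpos : (0 : ℝ) < W.card := by exact_mod_cast Finset.card_pos.2 hW
  set w : ℝ := (W.card : ℝ) with hw
  have hK' : (0 : ℝ) ≤ K := by positivity
  have hE : w ^ 3 ≤ K * (Finset.addEnergy W W : ℝ) := by
    have h1 := Finset.le_card_add_mul_addEnergy W W
    have h2 := h1.trans (Nat.mul_le_mul_right _ hK)
    have h3 : w ^ 2 * w ^ 2 ≤ K * w * (Finset.addEnergy W W : ℝ) := by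
      rw [hw]
      exact_mod_cast h2
    have h4 : w * w ^ 3 ≤ w * (K * (Finset.addEnergy W W : ℝ)) := by nlinarith
    exact le_of_mul_le_mul_left h4 hwpos
  have h2 := sum_norm_fourierSum_sq W
  have h4 := sum_norm_fourierSum_four W
  rw [← Finset.add_sum_erase _ _ (Finset.mem_univ (0 : ZMod p)), fourierSum_zero] at h2 h4
  rw [Complex.norm_natCast, ← hw] at h2 h4
  have h5 : ∑ q ∈ Finset.univ.erase (0 : ZMod p), 2 * K * ‖fourierSum W q‖ ^ 4 ≤
      ∑ q ∈ Finset.univ.erase (0 : ZMod p), w ^ 2 * ‖fourierSum W q‖ ^ 2 := by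
    refine Finset.sum_le_sum fun q hq => ?_
    have := hcon q (Finset.ne_of_mem_erase hq)
    nlinarith [sq_nonneg ‖fourierSum W q‖]
  rw [← Finset.mul_sum, ← Finset.mul_sum] at h5
  have hp' : 2 * K * w ≤ p := by rw [hw]; exact_mod_cast hp
  have h6 : 2 * K * w ^ 4 ≤ p * w ^ 3 := by
    nlinarith [pow_pos hwpos 3]
  have h7 : (p : ℝ) * w ^ 3 ≤ p * (K * (Finset.addEnergy W W : ℝ)) :=
    mul_le_mul_of_nonneg_left hE (by positivity)
  nlinarith [pow_pos hwpos 4]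

lemma fourierSum_mul_le {p : ℕ} [NeZero p] {W : Finset (ZMod p)} {s : ZMod p} {n : ℕ}
    (h : (W ∪ (W + {s})).card ≤ W.card + n) (q : ZMod p) :
    ‖fourierSum W q‖ * ‖(ZMod.stdAddChar (s * q) : ℂ) - 1‖ ≤ 2 * n := by
  have e1 : fourierSum (W + {s}) q = fourierSum W q * ZMod.stdAddChar (s * q) := by
    have e : W + {s} = W.image (fun w => w + s) := by ext; simp only [Finset.mem_add,
      Finset.mem_singleton, exists_eq_left, Finset.mem_image]
    rw [fourierSum, fourierSum, Finset.sum_mul, e]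
    rw [Finset.sum_image fun a _ b _ hab => add_right_cancel hab]
    refine Finset.sum_congr rfl fun w _ => ?_
    rw [← AddChar.map_add_eq_mul, add_mul]
  have hb : ∀ V : Finset (ZMod p), ‖fourierSum V q‖ ≤ V.card := by
    intro V
    refine (norm_sum_le _ _).trans ?_
    simp
  have hs : ∀ V U : Finset (ZMod p), fourierSum V q = fourierSum (V \ U) q + fourierSum (V ∩ U) q :=
    fun V U => by rw [fourierSum, fourierSum, fourierSum, add_comm, Finset.sum_inter_add_sum_sdiff]
  have e2 : fourierSum W q * ((ZMod.stdAddChar (s * q) : ℂ) - 1) =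
      fourierSum ((W + {s}) \ W) q - fourierSum (W \ (W + {s})) q := by
    rw [mul_sub, ← e1, mul_one, hs (W + {s}) W, hs W (W + {s}), Finset.inter_comm W]
    have := hs W (W + {s})
    ring
  have c1 := Finset.card_sdiff_add_card (W + {s}) W
  have c2 := Finset.card_sdiff_add_card W (W + {s})
  have c3 := Finset.card_add_singleton W s
  rw [Finset.union_comm] at c1
  rw [← norm_mul, e2]
  refine (norm_sub_le _ _).trans ((add_le_add (hb _) (hb _)).trans ?_)
  have : (((W + {s}) \ W).card + (W \ (W + {s})).card : ℕ) ≤ 2 * n := by omega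
  exact_mod_cast this

lemma four_mul_valMinAbs_le {p : ℕ} [NeZero p] (x : ZMod p) :
    4 * |(x.valMinAbs : ℝ)| ≤ p * ‖(ZMod.stdAddChar x : ℂ) - 1‖ := by
  have hp : (0 : ℝ) < p := by exact_mod_cast Nat.pos_of_ne_zero (NeZero.ne p)
  set v := x.valMinAbs with hv
  have hx : x = (v : ZMod p) := by rw [hv, ZMod.coe_valMinAbs]
  have hle : |(v : ℝ)| * 2 ≤ p := by
    have h1 := ZMod.natAbs_valMinAbs_le x
    have h2 : v.natAbs * 2 ≤ p := by rw [hv]; omega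
    rw [← Int.cast_abs, Int.abs_eq_natAbs]
    exact_mod_cast h2
  set θ : ℝ := 2 * Real.pi * v / p with hθ
  have e : (ZMod.stdAddChar x : ℂ) = Complex.exp (Complex.I * θ) := by
    rw [hx, ZMod.stdAddChar_coe, hθ]
    congr 1
    push_cast
    ring
  rw [e, Complex.norm_exp_I_mul_ofReal_sub_one, norm_mul, Real.norm_eq_abs, Real.norm_eq_abs,
    abs_of_pos (by norm_num : (0 : ℝ) < 2)]
  have hpi := Real.pi_pos
  have habs : |θ / 2| = Real.pi * |(v : ℝ)| / p := by
    rw [hθ, abs_div, abs_div, abs_mul, abs_mul, abs_of_pos hpi, abs_of_pos hp,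
      abs_of_pos (by norm_num : (0 : ℝ) < 2)]
    ring
  have h1 : 2 / Real.pi * |θ / 2| ≤ |Real.sin (θ / 2)| := by
    refine Real.mul_abs_le_abs_sin ?_
    rw [habs, div_le_div_iff₀ hp (by norm_num)]
    nlinarith
  rw [habs] at h1
  have h2 : 2 / Real.pi * (Real.pi * |(v : ℝ)| / p) = 2 * |(v : ℝ)| / p := by field_simp
  rw [h2, div_le_iff₀ hp] at h1
  linarith

/-- If `F + F'` is small then after a dilation both `F` and `F'` lie in short intervals. -/
theorem exists_rectification : ∃ N : ℕ, ∀ (p : ℕ) [Fact p.Prime] (k : ℕ) (F F' : Finset (ZMod p)),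
    1 ≤ k → k ≤ F.card → k ≤ F'.card → F.card ≤ 4 * k → F'.card ≤ 4 * k →
    (F + F').card ≤ 9 * k → N * k ≤ p →
    ∃ q : ZMod p, q ≠ 0 ∧ (∀ f ∈ F, ∀ g ∈ F, 100 * |((f - g) * q).valMinAbs| ≤ p) ∧
      ∀ f ∈ F', ∀ g ∈ F', 100 * |((f - g) * q).valMinAbs| ≤ p := by
  obtain ⟨D, hD⟩ := exists_covering
  obtain ⟨K, hK⟩ : ∃ K : ℕ, K = 4 ^ D := ⟨_, rfl⟩
  have hK1 : 1 ≤ K := by rw [hK]; exact Nat.one_le_pow _ _ (by norm_num)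
  obtain ⟨m, hm⟩ : ∃ m : ℕ, m = 100 * K := ⟨_, rfl⟩
  refine ⟨2 * K * ((m * 2 ^ D * 2 + 1) ^ D * D), fun p _ k F F' hk h1 h2 h3 h4 h5 hp => ?_⟩
  obtain ⟨X, hX1, hX2, hX3⟩ := hD (ZMod p) k F F' hk h1 h2 h3 h4 h5
  have hF : F.Nonempty := Finset.card_pos.1 (by omega)
  have hF' : F'.Nonempty := Finset.card_pos.1 (by omega)
  set S := (F + F') - (F + F') with hS
  have hSne : S.Nonempty := (hF.add hF').sub (hF.add hF')
  obtain ⟨W, hW, w1, w2, w3⟩ := exists_almost_invariant hSne hX3 (m := m) (by omega)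
  have w1' : (W + W).card ≤ K * W.card := w1.trans (Nat.mul_le_mul_right _ (by
    rw [hK]; exact Nat.pow_le_pow_right (by norm_num) hX1))
  have w3' : 2 * K * W.card ≤ p := by
    refine le_trans ?_ hp
    rw [mul_assoc (2 * K) _ k, mul_assoc _ D k]
    refine Nat.mul_le_mul_left _ (w3.trans (Nat.mul_le_mul ?_ hX2))
    calc _ ≤ (m * 2 ^ D * 2 + 1) ^ X.card := by
          refine Nat.pow_le_pow_left ?_ _
          have : 2 ^ X.card ≤ 2 ^ D := Nat.pow_le_pow_right (by norm_num) hX1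
          nlinarith
      _ ≤ _ := Nat.pow_le_pow_right (by omega) hX1
  obtain ⟨q, hq, hqW⟩ := exists_large_fourierSum hW w1' w3'
  refine ⟨q, hq, ?_⟩
  have hwpos : (0 : ℝ) < W.card := by exact_mod_cast Finset.card_pos.2 hW
  have key : ∀ s ∈ S, 100 * |(s * q).valMinAbs| ≤ p := by
    intro s hs
    have h0 : (0 : ZMod p) ∈ S := Finset.zero_mem_sub_iff.2 (by
      rw [disjoint_self, Finset.bot_eq_empty]; exact (hF.add hF').ne_empty)
    have u1 : W ∪ (W + {s}) ⊆ W + S := Finset.union_subset (Finset.subset_add_left _ h0)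
      (Finset.add_subset_add_left (by simpa using hs))
    have u2 : (W ∪ (W + {s})).card ≤ W.card + W.card / m := by
      have h6 := Nat.mul_le_mul_left m (Finset.card_le_card u1)
      have h7 : m * (W ∪ (W + {s})).card ≤ (m + 1) * W.card := h6.trans w2
      have h8 : (W ∪ (W + {s})).card - W.card ≤ W.card / m := by
        rw [Nat.le_div_iff_mul_le (by omega), Nat.sub_mul]
        have : W.card * m + W.card = (m + 1) * W.card := by ring
        rw [mul_comm _ m]
        omega
      omega
    have u3 := fourierSum_mul_le u2 q
    have u4 : ((W.card / m : ℕ) : ℝ) ≤ W.card / m := Nat.cast_div_le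
    have u5 := four_mul_valMinAbs_le (s * q)
    set z := ‖(ZMod.stdAddChar (s * q) : ℂ) - 1‖ with hz
    set Y := ‖fourierSum W q‖ with hY
    have hz0 : 0 ≤ z := norm_nonneg _
    have hY0 : 0 ≤ Y := norm_nonneg _
    have hKr : (1 : ℝ) ≤ K := by exact_mod_cast hK1
    have hmr : (m : ℝ) = 100 * K := by rw [hm]; push_cast; ring
    have v1 : Y * z * (50 * K) ≤ W.card := by
      have : Y * z ≤ 2 * (W.card / m) := u3.trans (by linarith)
      rw [hmr] at this
      have h9 : 2 * ((W.card : ℝ) / (100 * K)) * (50 * K) = W.card := by field_simp; norm_num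
      rw [← h9]
      exact mul_le_mul_of_nonneg_right this (by positivity)
    have v2 : z * 25 ≤ 1 := by
      have v3 : (Y * z * (50 * K)) ^ 2 ≤ (W.card : ℝ) ^ 2 := pow_le_pow_left₀ (by positivity) v1 2
      have v4 := v3.trans hqW
      have hYpos : 0 < Y := by
        rcases hY0.lt_or_eq with h | h
        · exact h
        · rw [← h] at hqW
          nlinarith [pow_pos hwpos 2]
      have v5 : (z * 25) ^ 2 * (2 * K * Y ^ 2) ≤ 1 * (2 * K * Y ^ 2) := by
        have : 0 ≤ (Y * z) ^ 2 * (K * (K - 1)) := by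
          have : 0 ≤ (K : ℝ) - 1 := by linarith
          positivity
        nlinarith
      have v6 := le_of_mul_le_mul_right v5 (by positivity)
      nlinarith
    have hpr : (0 : ℝ) ≤ p := by positivity
    have v7 : 100 * |((s * q).valMinAbs : ℝ)| ≤ p := by nlinarith
    exact_mod_cast v7
  refine ⟨fun f hf g hg => key _ ?_, fun f hf g hg => key _ ?_⟩
  · obtain ⟨u, hu⟩ := hF'
    exact Finset.mem_sub.2 ⟨f + u, Finset.add_mem_add hf hu, g + u, Finset.add_mem_add hg hu,
      by ring⟩
  · obtain ⟨u, hu⟩ := hF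
    exact Finset.mem_sub.2 ⟨u + f, Finset.add_mem_add hu hf, u + g, Finset.add_mem_add hu hg,
      by ring⟩

/-- The number of elements of `A` which leave `A` under translation by `x`. -/
def translationDefect {p : ℕ} (A : Finset (ZMod p)) (x : ZMod p) : ℕ :=
  (A.filter (fun a => a + x ∉ A)).card

lemma translationDefect_add_le {p : ℕ} (A : Finset (ZMod p)) (x y : ZMod p) :
    translationDefect A (x + y) ≤ translationDefect A x + translationDefect A y := by
  have h1 : A.filter (fun a => a + (x + y) ∉ A) ⊆ A.filter (fun a => a + x ∉ A) ∪
      (A.filter (fun a => a + y ∉ A)).image (fun a => a - x) := by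
    intro a ha
    rw [Finset.mem_filter] at ha
    by_cases h : a + x ∈ A
    · refine Finset.mem_union_right _ (Finset.mem_image.2 ⟨a + x, ?_, by ring⟩)
      rw [Finset.mem_filter, add_assoc]
      exact ⟨h, ha.2⟩
    · exact Finset.mem_union_left _ (Finset.mem_filter.2 ⟨ha.1, h⟩)
  exact (Finset.card_le_card h1).trans ((Finset.card_union_le _ _).trans
    (Nat.add_le_add_left Finset.card_image_le _))

lemma translationDefect_sub_le {p : ℕ} (A : Finset (ZMod p)) {F : Finset (ZMod p)} {f g : ZMod p}
    (hf : f ∈ F) (hg : g ∈ F) :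
    translationDefect A (f - g) + A.card ≤ (A + F).card := by
  have h1 : (A.filter (fun a => a + (f - g) ∉ A)).image (fun a => a + f) ⊆
      (A + F) \ (A + {g}) := by
    intro z hz
    obtain ⟨a, ha, rfl⟩ := Finset.mem_image.1 hz
    rw [Finset.mem_filter] at ha
    rw [Finset.mem_sdiff]
    refine ⟨Finset.add_mem_add ha.1 hf, fun h => ha.2 ?_⟩
    obtain ⟨b, hb, c, hc, hbc⟩ := Finset.mem_add.1 h
    rw [Finset.mem_singleton] at hc
    subst hc
    have : a + (f - c) = b := by
      have : a + (f - c) = (a + f) - c := by ring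
      rw [this, ← hbc]
      ring
    rwa [this]
  have h2 := Finset.card_le_card h1
  rw [Finset.card_image_of_injective _ (add_left_injective f)] at h2
  have h3 : A + {g} ⊆ A + F := Finset.add_subset_add_left (by simpa using hg)
  have h4 := Finset.card_sdiff_add_card_eq_card h3
  rw [Finset.card_add_singleton] at h4
  rw [translationDefect]
  omega

/-- A set of integers occupying more than half of `[0, L]`, normalised to contain the endpoints. -/
structure DenseInterval (k : ℕ) (G : Finset ℤ) (L : ℕ) : Prop where
  zero_mem : 0 ∈ G
  last_mem : (L : ℤ) ∈ G
  bounds : ∀ g ∈ G, 0 ≤ g ∧ g ≤ L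
  length_add_four_le : L + 4 ≤ G.card + k
  le_card : k ≤ G.card

lemma DenseInterval.reflect {k : ℕ} {G : Finset ℤ} {L : ℕ} (h : DenseInterval k G L) :
    DenseInterval k (G.image (fun g => (L : ℤ) - g)) L := by
  have hc : (G.image (fun g => (L : ℤ) - g)).card = G.card :=
    Finset.card_image_of_injective _ sub_right_injective
  refine ⟨Finset.mem_image.2 ⟨L, h.last_mem, sub_self _⟩,
    Finset.mem_image.2 ⟨0, h.zero_mem, sub_zero _⟩, ?_, ?_, ?_⟩
  · intro g hg
    obtain ⟨x, hx, rfl⟩ := Finset.mem_image.1 hg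
    have := h.bounds x hx
    omega
  · rw [hc]; exact h.length_add_four_le
  · rw [hc]; exact h.le_card

lemma DenseInterval.exists_sub {k : ℕ} {G : Finset ℤ} {L : ℕ} (h : DenseInterval k G L)
    {x : ℤ} (hx0 : 0 ≤ x) (hxL : x ≤ L) :
    ∃ g ∈ G, ∃ g' ∈ G, x = g - g' ∨ x = (g - g') + L := by
  have h1 := h.length_add_four_le
  have h2 := h.le_card
  rcases Nat.eq_zero_or_pos L with hL | hL
  · exact ⟨0, h.zero_mem, 0, h.zero_mem, Or.inl (by omega)⟩
  have hLz : (0 : ℤ) < L := by exact_mod_cast hL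
  set G₀ := G.erase (L : ℤ) with hG₀
  have hc : G₀.card + 1 = G.card := Finset.card_erase_add_one h.last_mem
  have hb : ∀ g ∈ G₀, 0 ≤ g ∧ g < L := by
    intro g hg
    rw [hG₀, Finset.mem_erase] at hg
    have := h.bounds g hg.2
    omega
  set G₁ := G₀.image (fun g => (g + x) % (L : ℤ)) with hG₁
  have hc1 : G₁.card = G₀.card := by
    refine Finset.card_image_of_injOn fun g hg g' hg' he => ?_
    have e1 : g % (L : ℤ) = g' % L := Int.ModEq.add_right_cancel' x he
    have b1 := hb g hg
    have b2 := hb g' hg'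
    rwa [Int.emod_eq_of_lt b1.1 b1.2, Int.emod_eq_of_lt b2.1 b2.2] at e1
  have hu : G₀ ∪ G₁ ⊆ Finset.Ico (0 : ℤ) L := by
    intro g hg
    rw [Finset.mem_Ico]
    rcases Finset.mem_union.1 hg with hg | hg
    · exact hb g hg
    · obtain ⟨y, -, rfl⟩ := Finset.mem_image.1 hg
      exact ⟨Int.emod_nonneg _ hLz.ne', Int.emod_lt_of_pos _ hLz⟩
  have hu' := Finset.card_le_card hu
  rw [Int.card_Ico] at hu'
  have hi := Finset.card_union_add_card_inter G₀ G₁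
  obtain ⟨g, hg⟩ : (G₀ ∩ G₁).Nonempty := Finset.card_pos.1 (by omega)
  rw [Finset.mem_inter] at hg
  obtain ⟨g', hg', he⟩ := Finset.mem_image.1 hg.2
  have b1 := hb g hg.1
  have b2 := hb g' hg'
  refine ⟨g, Finset.mem_of_mem_erase hg.1, g', Finset.mem_of_mem_erase hg', ?_⟩
  by_cases hlt : g' + x < L
  · rw [Int.emod_eq_of_lt (by omega) hlt] at he
    left; omega
  · rw [Int.emod_eq_sub_self_emod, Int.emod_eq_of_lt (by omega) (by omega)] at he
    right; omega

/-- The sumset of a large set with a dense interval contains a long interval, if it is small. -/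
lemma DenseInterval.exists_run {p k : ℕ} {G : Finset ℤ} {L : ℕ} (h : DenseInterval k G L)
    {A : Finset (ZMod p)} (hGk : G.card ≤ 4 * k)
    (hA : 60 * k < A.card)
    (hAF : (A + G.image (Int.cast : ℤ → ZMod p)).card + 4 ≤ A.card + G.card + k) :
    ∃ z : ZMod p, ∀ j : ℕ, j < L → z + j ∈ A + G.image (Int.cast : ℤ → ZMod p) := by
  set F := G.image (Int.cast : ℤ → ZMod p) with hF
  have hl := h.length_add_four_le
  have hle := h.le_card
  have hFm : ∀ g ∈ G, (g : ZMod p) ∈ F := fun g hg => Finset.mem_image_of_mem _ hg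
  have dl : translationDefect A (L : ZMod p) ≤ 5 * k := by
    have := translationDefect_sub_le A (hFm _ h.last_mem) (hFm _ h.zero_mem)
    simp only [Int.cast_natCast, Int.cast_zero, sub_zero] at this
    omega
  have d1 : ∀ x : ℤ, 0 ≤ x → x ≤ L → translationDefect A (x : ZMod p) ≤ 10 * k := by
    intro x hx0 hxL
    obtain ⟨g, hg, g', hg', hx | hx⟩ := h.exists_sub hx0 hxL
    · have := translationDefect_sub_le A (hFm _ hg) (hFm _ hg')
      rw [hx, Int.cast_sub]
      omega
    · have := translationDefect_sub_le A (hFm _ hg) (hFm _ hg')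
      rw [hx, Int.cast_add, Int.cast_sub, Int.cast_natCast]
      have := translationDefect_add_le A ((g : ZMod p) - g') (L : ZMod p)
      omega
  have d2 : ∀ x ∈ Finset.Icc (0 : ℤ) (2 * L), translationDefect A (x : ZMod p) ≤ 15 * k := by
    intro x hx
    rw [Finset.mem_Icc] at hx
    rcases le_or_gt x L with hxL | hxL
    · have := d1 x hx.1 hxL
      omega
    · have e : (x : ZMod p) = ((x - L : ℤ) : ZMod p) + (L : ZMod p) := by push_cast; ring
      have := translationDefect_add_le A ((x - L : ℤ) : ZMod p) (L : ZMod p)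
      rw [e]
      have := d1 (x - L) (by omega) (by omega)
      omega
  obtain ⟨a, ha, hab⟩ : ∃ a ∈ A,
      ((Finset.Icc (0 : ℤ) (2 * L)).filter (fun x : ℤ => a + (x : ZMod p) ∉ A)).card < G.card := by
    by_contra hcon
    push Not at hcon
    have e1 : A.card * G.card ≤ ∑ a ∈ A,
        ((Finset.Icc (0 : ℤ) (2 * L)).filter (fun x : ℤ => a + (x : ZMod p) ∉ A)).card := by
      rw [← smul_eq_mul]
      exact Finset.card_nsmul_le_sum _ _ _ hcon
    have e2 : ∑ a ∈ A,
        ((Finset.Icc (0 : ℤ) (2 * L)).filter (fun x : ℤ => a + (x : ZMod p) ∉ A)).card =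
        ∑ x ∈ Finset.Icc (0 : ℤ) (2 * L), translationDefect A (x : ZMod p) := by
      simp only [translationDefect, Finset.card_filter]
      exact Finset.sum_comm
    have e3 := Finset.sum_le_card_nsmul _ _ _ d2
    rw [Int.card_Icc, smul_eq_mul] at e3
    have e4 : (2 * (L : ℤ) + 1 - 0).toNat ≤ 4 * G.card := by omega
    have e5 : A.card * G.card ≤ (60 * k) * G.card := by
      calc _ ≤ _ := e1
        _ = _ := e2
        _ ≤ _ := e3
        _ ≤ 4 * G.card * (15 * k) := Nat.mul_le_mul_right _ e4
        _ = _ := by ring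
    have := Nat.le_of_mul_le_mul_right e5 (by omega)
    omega
  refine ⟨a + L, fun j hj => ?_⟩
  by_contra hcon
  have hsub : G.image (fun g => (L : ℤ) + j - g) ⊆
      (Finset.Icc (0 : ℤ) (2 * L)).filter (fun x : ℤ => a + (x : ZMod p) ∉ A) := by
    intro x hx
    obtain ⟨g, hg, rfl⟩ := Finset.mem_image.1 hx
    have := h.bounds g hg
    rw [Finset.mem_filter, Finset.mem_Icc]
    refine ⟨by omega, fun hm => hcon ?_⟩
    exact Finset.mem_add.2 ⟨_, hm, _, hFm g hg, by push_cast; ring⟩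
  have := Finset.card_le_card hsub
  rw [Finset.card_image_of_injective _ sub_right_injective] at this
  omega

/-- If `A` misses `L` consecutive elements then its sum with a subset of `[0, L]` can be lifted to
the integers. -/
lemma exists_lift_of_gap {p : ℕ} [Fact p.Prime] {A : Finset (ZMod p)} {G : Finset ℤ} {L : ℕ}
    (hG : ∀ g ∈ G, 0 ≤ g ∧ g ≤ L) {z : ZMod p} (hz : ∀ j : ℕ, j < L → z + j ∉ A) :
    ∃ (c : ZMod p) (X : Finset ℤ), X.card = A.card ∧
      (X + G).card ≤ (A + G.image (Int.cast : ℤ → ZMod p)).card ∧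
      (∀ x ∈ X, 0 ≤ x ∧ x < p) ∧ (∀ a ∈ A, ∃ x ∈ X, a = c + x) ∧
      ∀ s ∈ X + G, c + s ∈ A + G.image (Int.cast : ℤ → ZMod p) := by
  set c : ZMod p := z + L with hc
  set X := A.image (fun a => ((a - c).val : ℤ)) with hX
  have hbd : ∀ a ∈ A, (a - c).val + L < p := by
    intro a ha
    by_contra hcon
    have hlt := ZMod.val_lt (a - c)
    refine hz ((a - c).val + L - p) (by omega) ?_
    have e : z + (((a - c).val + L - p : ℕ) : ZMod p) = a := by
      rw [Nat.cast_sub (by omega), Nat.cast_add, ZMod.natCast_zmod_val, ZMod.natCast_self, hc]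
      ring
    rwa [e]
  have hmem : ∀ s ∈ X + G, 0 ≤ s ∧ s < p ∧
      c + s ∈ A + G.image (Int.cast : ℤ → ZMod p) := by
    intro s hs
    obtain ⟨x, hx, g, hg, rfl⟩ := Finset.mem_add.1 hs
    obtain ⟨a, ha, rfl⟩ := Finset.mem_image.1 hx
    have h1 := hbd a ha
    have h2 := hG g hg
    refine ⟨by omega, by omega, Finset.mem_add.2 ⟨a, ha, g, Finset.mem_image_of_mem _ hg, ?_⟩⟩
    push_cast
    rw [ZMod.natCast_zmod_val]
    ring
  refine ⟨c, X, ?_, ?_, ?_, ?_, fun s hs => (hmem s hs).2.2⟩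
  · refine Finset.card_image_of_injective _ fun a b hab => ?_
    have h1 : (a - c).val = (b - c).val := by exact_mod_cast hab
    exact sub_left_injective (ZMod.val_injective p h1)
  · refine Finset.card_le_card_of_injOn (fun s => c + (s : ZMod p)) (fun s hs => (hmem s hs).2.2) ?_
    intro s hs t ht he
    have b1 := hmem s hs
    have b2 := hmem t ht
    have e := (ZMod.intCast_eq_intCast_iff' s t p).1 (add_left_cancel he)
    rwa [Int.emod_eq_of_lt b1.1 b1.2.1, Int.emod_eq_of_lt b2.1 b2.2.1] at e
  · intro x hx
    obtain ⟨a, ha, rfl⟩ := Finset.mem_image.1 hx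
    have := hbd a ha
    omega
  · intro a ha
    refine ⟨_, Finset.mem_image_of_mem _ ha, ?_⟩
    rw [Int.cast_natCast, ZMod.natCast_zmod_val]
    ring

/-- A common difference of a progression containing two distinct close integers is small. -/
lemma intCast_ne_zero_of_progression {p : ℕ} {X : Finset ℤ} (hX : 2 ≤ X.card)
    (hXp : ∀ x ∈ X, ∀ y ∈ X, x - y < p) {a d : ℤ} (hd : 0 < d)
    (h : ∀ x ∈ X, ∃ j : ℤ, x = a + j * d) : (d : ZMod p) ≠ 0 := by
  obtain ⟨x, hx, y, hy, hxy⟩ := Finset.one_lt_card.1 hX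
  wlog hlt : y < x generalizing x y
  · exact this y hy x hx hxy.symm (by omega)
  obtain ⟨i, hi⟩ := h x hx
  obtain ⟨j, hj⟩ := h y hy
  have h1 := hXp x hx y hy
  rw [Ne, ZMod.intCast_zmod_eq_zero_iff_dvd]
  intro hdvd
  have h2 := Int.le_of_dvd hd hdvd
  have h3 : d ∣ x - y := ⟨i - j, by rw [hi, hj]; ring⟩
  have h4 := Int.le_of_dvd (by omega) h3
  omega

/-- If a set has a small sum with a dense interval, then it is contained in a short progression. -/
theorem DenseInterval.containedInAP {p k : ℕ} [Fact p.Prime] (hk : 3 ≤ k) (hp : 200 * k ≤ p)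
    {G : Finset ℤ} {L : ℕ} (h : DenseInterval k G L) (hGk : G.card ≤ 4 * k)
    {A : Finset (ZMod p)} (hA : k ≤ A.card)
    (hAp : (A + G.image (Int.cast : ℤ → ZMod p)).card + k ≤ p)
    (hAF : (A + G.image (Int.cast : ℤ → ZMod p)).card + 4 ≤ A.card + G.card + k) :
    ContainedInAP (A.card + k - 3) A := by
  set F := G.image (Int.cast : ℤ → ZMod p) with hF
  set G' := G.image (fun g => (L : ℤ) - g) with hG'
  have hr : DenseInterval k G' L := h.reflect
  have hG'c : G'.card = G.card := Finset.card_image_of_injective _ sub_right_injective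
  have hl := h.length_add_four_le
  have hGk' := h.le_card
  set N := (A + F)ᶜ with hN
  have hNc : N.card + (A + F).card = p := by
    rw [hN, Finset.card_compl_add_card, ZMod.card]
  set F' := G'.image (Int.cast : ℤ → ZMod p) with hF'
  have hdisj : ∀ a ∈ A, a + L ∉ N + F' := by
    intro a ha hmem
    obtain ⟨n, hn, f, hf, he⟩ := Finset.mem_add.1 hmem
    obtain ⟨g', hg', rfl⟩ := Finset.mem_image.1 hf
    obtain ⟨g, hg, rfl⟩ := Finset.mem_image.1 hg'
    rw [hN, Finset.mem_compl] at hn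
    refine hn (Finset.mem_add.2 ⟨a, ha, g, Finset.mem_image_of_mem _ hg, ?_⟩)
    push_cast at he
    linear_combination -he
  have hNF : (N + F').card + A.card ≤ p := by
    have h1 : A + {(L : ZMod p)} ⊆ (N + F')ᶜ := by
      intro x hx
      obtain ⟨a, ha, b, hb, rfl⟩ := Finset.mem_add.1 hx
      rw [Finset.mem_singleton] at hb
      rw [Finset.mem_compl, hb]
      exact hdisj a ha
    have h2 := Finset.card_le_card h1
    have h3 := Finset.card_compl_add_card (N + F')
    rw [Finset.card_add_singleton] at h2
    rw [ZMod.card] at h3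
    omega
  have hNF' : (N + F').card + 4 ≤ N.card + G'.card + k := by omega
  by_cases hbig : 60 * k < N.card
  · obtain ⟨z, hz⟩ := hr.exists_run (by omega) hbig hNF'
    have hgap : ∀ j : ℕ, j < L → (z - L) + j ∉ A := by
      intro j hj hm
      refine hdisj _ hm ?_
      have : z - L + j + L = z + j := by ring
      rw [this]
      exact hz j hj
    obtain ⟨c, X, hXc, hXG, hXb, hXA, -⟩ := exists_lift_of_gap h.bounds hgap
    rw [← hF] at hXG
    obtain ⟨d, a, -, -, hd, hX, -, -⟩ :=
      progressionStructure_of_card_add_le hk _ X G rfl (by omega) hGk' (by omega)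
    refine ⟨c + a, d, intCast_ne_zero_of_progression (by omega : 2 ≤ X.card) ?_ hd
      (fun x hx => (hX x hx).imp fun j hj => hj.2.2), ?_⟩
    · intro x hx y hy
      have := hXb x hx
      have := hXb y hy
      omega
    · intro b hb
      obtain ⟨x, hx, rfl⟩ := hXA b hb
      obtain ⟨j, hj0, hj1, rfl⟩ := hX x hx
      refine ⟨j.toNat, by omega, ?_⟩
      have : ((j.toNat : ℕ) : ZMod p) = (j : ZMod p) := by
        rw [← Int.cast_natCast, Int.toNat_of_nonneg hj0]
      rw [this]
      push_cast
      ring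
  · obtain ⟨z, hz⟩ := h.exists_run hGk (by omega : 60 * k < A.card) hAF
    have hgap : ∀ j : ℕ, j < L → z + j ∉ N := fun j hj => by
      rw [hN, Finset.mem_compl, not_not]
      exact hz j hj
    obtain ⟨c, X, hXc, hXG, hXb, -, hXs⟩ := exists_lift_of_gap hr.bounds hgap
    rw [← hF'] at hXG
    obtain ⟨d, a, -, b, hd, hX, -, hrun⟩ :=
      progressionStructure_of_card_add_le hk _ X G' rfl (by omega) (by omega) (by omega)
    have hd0 : (d : ZMod p) ≠ 0 := by
      refine intCast_ne_zero_of_progression (by omega : 2 ≤ X.card) ?_ hd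
        (fun x hx => (hX x hx).imp fun j hj => hj.2.2)
      intro x hx y hy
      have := hXb x hx
      have := hXb y hy
      omega
    set m := N.card + G.card - 1 with hm
    refine ⟨c + b - L + m * d, d, hd0, fun y hy => ?_⟩
    set i := ((y + L - c - b) / (d : ZMod p)).val with hi
    have hilt : i < p := ZMod.val_lt _
    have hie : y + L = c + b + i * d := by
      rw [hi, ZMod.natCast_zmod_val, div_mul_cancel₀ _ hd0]
      ring
    have him : m ≤ i := by
      by_contra hcon
      have h1 := hXs _ (hrun i (by omega) (by omega))
      apply hdisj y hy
      rw [hie]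
      push_cast at h1
      rwa [← add_assoc] at h1
    refine ⟨i - m, by omega, ?_⟩
    rw [Nat.cast_sub him]
    linear_combination hie

/-- If `F` and `F'` lie in short intervals and have a small sum then `F` is dense in a
progression. -/
lemma exists_denseInterval {p k : ℕ} [Fact p.Prime] (hk : 3 ≤ k) {F F' : Finset (ZMod p)}
    (hF : k ≤ F.card) (hF' : k ≤ F'.card) (hFF : (F + F').card + 4 ≤ F.card + F'.card + k)
    {q : ZMod p} (hq : q ≠ 0) (h : ∀ f ∈ F, ∀ g ∈ F, 100 * |((f - g) * q).valMinAbs| ≤ p)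
    (h' : ∀ f ∈ F', ∀ g ∈ F', 100 * |((f - g) * q).valMinAbs| ≤ p) :
    ∃ (u v : ZMod p) (G : Finset ℤ) (L : ℕ), v ≠ 0 ∧ DenseInterval k G L ∧ G.card = F.card ∧
      F = G.image (fun g : ℤ => u + g * v) := by
  have hp : (0 : ℤ) < p := by exact_mod_cast (Fact.out : p.Prime).pos
  obtain ⟨f₀, hf₀⟩ : F.Nonempty := Finset.card_pos.1 (by omega)
  obtain ⟨f₁, hf₁⟩ : F'.Nonempty := Finset.card_pos.1 (by omega)
  have inj : ∀ c : ZMod p, Function.Injective (fun f : ZMod p => ((f - c) * q).valMinAbs) := by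
    intro c f g hfg
    exact sub_left_injective (mul_left_injective₀ hq (ZMod.injective_valMinAbs hfg))
  set X := F.image (fun f => ((f - f₀) * q).valMinAbs) with hX
  set Y := F'.image (fun f => ((f - f₁) * q).valMinAbs) with hY
  have hXc : X.card = F.card := Finset.card_image_of_injective _ (inj f₀)
  have hYc : Y.card = F'.card := Finset.card_image_of_injective _ (inj f₁)
  have hXb : ∀ x ∈ X, 100 * |x| ≤ p := by
    intro x hx
    obtain ⟨f, hf, rfl⟩ := Finset.mem_image.1 hx
    exact h f hf f₀ hf₀
  have hYb : ∀ y ∈ Y, 100 * |y| ≤ p := by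
    intro y hy
    obtain ⟨f, hf, rfl⟩ := Finset.mem_image.1 hy
    exact h' f hf f₁ hf₁
  have hXY : (X + Y).card ≤ (F + F').card := by
    refine Finset.card_le_card_of_injOn (fun s : ℤ => (s : ZMod p) * q⁻¹ + (f₀ + f₁)) ?_ ?_
    · intro s hs
      obtain ⟨x, hx, y, hy, rfl⟩ := Finset.mem_add.1 hs
      obtain ⟨f, hf, rfl⟩ := Finset.mem_image.1 hx
      obtain ⟨g, hg, rfl⟩ := Finset.mem_image.1 hy
      refine Finset.mem_add.2 ⟨f, hf, g, hg, ?_⟩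
      push_cast
      field_simp
      ring
    · intro s hs t ht he
      have e := (ZMod.intCast_eq_intCast_iff_dvd_sub s t p).1
        (mul_left_injective₀ (inv_ne_zero hq) (add_right_cancel he))
      obtain ⟨x, hx, y, hy, rfl⟩ := Finset.mem_add.1 hs
      obtain ⟨x', hx', y', hy', rfl⟩ := Finset.mem_add.1 ht
      have b1 := hXb x hx
      have b2 := hXb x' hx'
      have b3 := hYb y hy
      have b4 := hYb y' hy'
      have := Int.eq_zero_of_abs_lt_dvd e (by
        have c1 := abs_sub (x' + y') (x + y)
        have c2 := abs_add_le x' y'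
        have c3 := abs_add_le x y
        omega)
      omega
  obtain ⟨d, a, -, -, hd, hXd, -, -⟩ :=
    progressionStructure_of_card_add_le hk _ X Y rfl (by omega) (by omega) (by omega)
  have hd0 : (d : ZMod p) ≠ 0 := by
    refine intCast_ne_zero_of_progression (by omega : 2 ≤ X.card) ?_ hd
      (fun x hx => (hXd x hx).imp fun j hj => hj.2.2)
    intro x hx y hy
    have b1 := hXb x hx
    have b2 := hXb y hy
    have c1 := le_abs_self x
    have c2 := neg_abs_le y
    omega
  have hdiv : ∀ j : ℤ, (a + j * d - a) / d = j := fun j => by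
    rw [add_sub_cancel_left, Int.mul_ediv_cancel _ hd.ne']
  set J := X.image (fun x => (x - a) / d) with hJ
  have hJc : J.card = X.card := by
    refine Finset.card_image_of_injOn fun x hx y hy he => ?_
    obtain ⟨i, -, -, rfl⟩ := hXd x hx
    obtain ⟨j, -, -, rfl⟩ := hXd y hy
    simp only [hdiv] at he
    rw [he]
  have hJb : ∀ j ∈ J, 0 ≤ j ∧ j + 4 ≤ X.card + k := by
    intro j hj
    obtain ⟨x, hx, rfl⟩ := Finset.mem_image.1 hj
    obtain ⟨i, h0, h1, rfl⟩ := hXd x hx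
    simp only [hdiv]
    exact ⟨h0, h1⟩
  have hJne : J.Nonempty := Finset.card_pos.1 (by omega)
  have hmin := J.min'_mem hJne
  have hmax := J.max'_mem hJne
  set s := J.min' hJne with hs
  set t := J.max' hJne with ht
  have hst : s ≤ t := J.min'_le _ hmax
  have hGc : (J.image (fun j => j - s)).card = J.card :=
    Finset.card_image_of_injective _ sub_left_injective
  refine ⟨f₀ + (a + s * d) * q⁻¹, d * q⁻¹, J.image (fun j => j - s), (t - s).toNat,
    mul_ne_zero hd0 (inv_ne_zero hq), ⟨?_, ?_, ?_, ?_, ?_⟩, by omega, ?_⟩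
  · exact Finset.mem_image.2 ⟨s, hmin, sub_self s⟩
  · exact Finset.mem_image.2 ⟨t, hmax, by omega⟩
  · intro g hg
    obtain ⟨j, hj, rfl⟩ := Finset.mem_image.1 hg
    have c1 := J.min'_le _ hj
    have c2 := J.le_max' _ hj
    omega
  · have := hJb t hmax
    have := hJb s hmin
    omega
  · omega
  · have key : ∀ f ∈ F, ∀ j : ℤ, ((f - f₀) * q).valMinAbs = a + j * d →
        f₀ + (a + s * d) * q⁻¹ + ((j - s : ℤ) : ZMod p) * (d * q⁻¹) = f := by
      intro f _ j hj
      have e : ((f - f₀) * q : ZMod p) = a + j * d := by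
        rw [← ZMod.coe_valMinAbs ((f - f₀) * q), hj]
        push_cast
        ring
      have e' : f - f₀ = (a + j * d) * q⁻¹ := by
        rw [← e, mul_assoc, mul_inv_cancel₀ hq, mul_one]
      push_cast
      linear_combination -e'
    ext f
    simp only [hJ, hX, Finset.mem_image, exists_exists_and_eq_and]
    constructor
    · intro hf
      obtain ⟨j, -, -, hj⟩ := hXd _ (Finset.mem_image_of_mem _ hf)
      refine ⟨f, hf, ?_⟩
      rw [hj, hdiv]
      exact key f hf j hj
    · rintro ⟨g, hg, rfl⟩
      obtain ⟨j, -, -, hj⟩ := hXd _ (Finset.mem_image_of_mem _ hg)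
      rw [hj, hdiv, key g hg j hj]
      exact hg

lemma containedInAP_of_card_add_le : ∃ N : ℕ, ∀ (p : ℕ) [Fact p.Prime] (k : ℕ)
    (A B : Finset (ZMod p)), 3 ≤ k → N * k ≤ p → k ≤ A.card → k ≤ B.card →
    (A + B).card + k ≤ p → (A + B).card + 4 ≤ A.card + B.card + k →
    ContainedInAP (A.card + k - 3) A := by
  obtain ⟨N, hN⟩ := exists_rectification
  refine ⟨N + 200, fun p _ k A B hk hp hA hB hABp hAB => ?_⟩
  rw [add_mul] at hp
  obtain ⟨F, F', h1, h2, h3, h4, h5, h6, h7⟩ := exists_small_pair hk hA hB hABp hAB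
  obtain ⟨q, hq, hq1, hq2⟩ := hN p k F F' (by omega) h1 h2 h3 h4 (by omega) (by omega)
  obtain ⟨u, v, G, L, hv, hG, hGF, hF⟩ := exists_denseInterval hk h1 h2 h7 hq hq1 hq2
  have inj : Function.Injective (fun a : ZMod p => a * v⁻¹) :=
    mul_left_injective₀ (inv_ne_zero hv)
  have hc : (A.image (fun a => a * v⁻¹)).card = A.card := Finset.card_image_of_injective _ inj
  have hs : (A.image (fun a => a * v⁻¹) + G.image (Int.cast : ℤ → ZMod p)).card = (A + F).card := by
    have e : A.image (fun a => a * v⁻¹) + G.image (Int.cast : ℤ → ZMod p) =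
        (A + F).image (fun z => (z - u) * v⁻¹) := by
      ext z
      simp only [Finset.mem_add, Finset.mem_image, hF]
      constructor
      · rintro ⟨_, ⟨a, ha, rfl⟩, _, ⟨g, hg, rfl⟩, rfl⟩
        refine ⟨_, ⟨a, ha, _, ⟨g, hg, rfl⟩, rfl⟩, ?_⟩
        field_simp
        ring
      · rintro ⟨_, ⟨a, ha, _, ⟨g, hg, rfl⟩, rfl⟩, rfl⟩
        refine ⟨_, ⟨a, ha, rfl⟩, _, ⟨g, hg, rfl⟩, ?_⟩
        field_simp
        ring
    rw [e]
    exact Finset.card_image_of_injective _ (inj.comp sub_left_injective)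
  obtain ⟨x, d, hd, h⟩ := hG.containedInAP hk (by omega) (by omega)
    (A := A.image (fun a => a * v⁻¹)) (by omega) (by omega) (by omega)
  rw [hc] at h
  refine ⟨x * v, d * v, mul_ne_zero hd hv, fun a ha => ?_⟩
  obtain ⟨j, hj, he⟩ := h _ (Finset.mem_image_of_mem _ ha)
  refine ⟨j, hj, ?_⟩
  have : a = (a * v⁻¹) * v := by field_simp
  rw [this, he]
  ring

lemma ContainedInAP.inAP {p n : ℕ} {A : Finset (ZMod p)} (h : ContainedInAP n A) {t : ℝ}
    (ht : (n : ℝ) ≤ t) : InAP A t := by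
  obtain ⟨x, d, hd, h⟩ := h
  refine ⟨n, x, d, hd, ht, fun a ha => ?_⟩
  obtain ⟨j, hj, rfl⟩ := h a ha
  exact Finset.mem_image.2 ⟨j, Finset.mem_range.2 hj, rfl⟩

theorem small_doubling_structure :
    ∃ c₀ : ℝ, c₀ > 0 ∧ ∀ c : ℝ, 0 < c → c ≤ c₀ →
      ∀ p : ℕ, p.Prime → ∀ A B : Finset (ZMod p),
        (A.card : ℝ) ≥ c * p + 3 → (B.card : ℝ) ≥ c * p + 3 →
        ((A + B).card : ℝ) ≤
          min ((A.card : ℝ) + (B.card : ℝ) - 1 + c * p) ((1 - c) * p - 3) →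
        InAP A ((A.card : ℝ) + c * p) ∧ InAP B ((B.card : ℝ) + c * p) := by
  obtain ⟨N, hN⟩ := containedInAP_of_card_add_le
  refine ⟨1 / (4 * (N + 1)), by positivity, fun c hc hc₀ p hp A B hA hB hAB => ?_⟩
  have : Fact p.Prime := ⟨hp⟩
  have hcp : 0 ≤ c * p := by positivity
  set r := ⌊c * p⌋₊ with hr
  have hr1 : (r : ℝ) ≤ c * p := Nat.floor_le hcp
  have hr2 : c * p < r + 1 := Nat.lt_floor_add_one _
  have half : ∀ A B : Finset (ZMod p), r + 3 ≤ A.card → r + 3 ≤ B.card →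
      (A + B).card + (r + 3) ≤ p → (A + B).card + 4 ≤ A.card + B.card + (r + 3) →
      InAP A ((A.card : ℝ) + c * p) := by
    intro A B h1 h2 h3 h4
    rcases Nat.eq_zero_or_pos r with h0 | h0
    · exact (vosper (A := A) (B := B) (by omega) (by omega) (by omega) (by omega)).inAP
        (by linarith)
    · refine (hN p (r + 3) A B (by omega) ?_ h1 h2 h3 h4).inAP ?_
      · have e1 : c * (4 * (N + 1)) ≤ 1 := by
          rwa [le_div_iff₀ (by positivity)] at hc₀
        have e2 : (1 : ℝ) ≤ r := by exact_mod_cast h0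
        have e3 : c * (4 * (N + 1)) * p ≤ 1 * p := mul_le_mul_of_nonneg_right e1 (by positivity)
        have e4 : (N : ℝ) * r ≤ N * (c * p) := mul_le_mul_of_nonneg_left hr1 (by positivity)
        have e5 : (N : ℝ) * 1 ≤ N * r := mul_le_mul_of_nonneg_left e2 (by positivity)
        have e6 : (N : ℝ) * (r + 3) ≤ p := by nlinarith
        exact_mod_cast e6
      · rw [show A.card + (r + 3) - 3 = A.card + r by omega]
        push_cast
        linarith
  have hA' : r + 3 ≤ A.card := by
    have : (r : ℝ) + 3 ≤ A.card := by linarith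
    exact_mod_cast this
  have hB' : r + 3 ≤ B.card := by
    have : (r : ℝ) + 3 ≤ B.card := by linarith
    exact_mod_cast this
  obtain ⟨hAB1, hAB2⟩ := le_min_iff.1 hAB
  have h3 : (A + B).card + (r + 3) ≤ p := by
    have : ((A + B).card : ℝ) + (r + 3) ≤ p := by linarith
    exact_mod_cast this
  have h4 : (A + B).card + 4 ≤ A.card + B.card + (r + 3) := by
    have : ((A + B).card : ℝ) + 1 < A.card + B.card + r + 1 := by linarith
    have : (A + B).card + 1 < A.card + B.card + r + 1 := by exact_mod_cast this
    omega
  refine ⟨half A B hA' hB' h3 h4, half B A hB' hA' ?_ ?_⟩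
  · rwa [add_comm B A]
  · rwa [add_comm B A, add_comm B.card]
end
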